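/- Let d = 3, p > 5, S > 0, and let m ≥ 40 be an integer. Suppose M : Γ₃ → ℝ and E_{αβ} : Γ₃ → ℝ (α,β ∈ {0,1,2,3}, E_{αβ} = E_{βα}) are smooth, satisfy M(e^S t, e^S x) = e^{−(4/(p−1))S} M(t,x) and E_{αβ}(e^S t, e^S x) = e^{−(2(p+1)/(p−1))S} E_{αβ}(t,x), satisfy (1/2)□M − (−E_{00} + ∑_{i=1}^{3}E_{ii}) > 0 and, for each α, ∂_α[(1/2)□M − (−E_{00} + ∑_i E_{ii})] = (p+1)[−∂_t E_{α0} + ∑_{i=1}^{3}∂_{x_i}E_{αi} − (1/2)∂_α(−E_{00} + ∑_i E_{ii})] on Γ₃, and suppose the 5×5 matrix with (0,0) entry M, zeroth row/column entries (1/2)∂_α M, and lower-right block (E_{αβ}) is strictly positive definite at every point of Γ₃. Then there exists a smooth nowhere-vanishing u : Γ₃ → ℝ^m \ {0} with ‖u‖² = M and ⟨∂_α u, ∂_β u⟩ = E_{αβ} on Γ₃ for all α,β, satisfying u(e^S t, e^S x) = e^{−(2/(p−1))S}u(t,x), ⟨u,□u⟩ > 0, and ∂_α⟨u,□u⟩ =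 (p+1)⟨∂_α u,□u⟩ on Γ₃, and such that θ := u/‖u‖ is injective up to the discrete scaling (θ(t,x) = θ(t',x') implies (t',x') = (e^{nS}t, e^{nS}x) for some n ∈ ℤ) and has linearly independent derivatives ∂_t θ, ∂_{x_1}θ, ∂_{x_2}θ, ∂_{x_3}θ at every point. -/

import Mathlib

open Real MeasureTheory
open scoped RealInnerProductSpace

noncomputable section

/-- Spacetime `ℝ^{1+d}` realised as `Fin (d+1) → ℝ`; coordinate `0` is the time `t`,
coordinates `i.succ` are the spatial coordinates `x_i`. -/
abbrev Sp (d : ℕ) := Fin (d + 1) → ℝ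

/-- The Euclidean target space `ℝ^m`. -/
abbrev Em (m : ℕ) := EuclideanSpace ℝ (Fin m)

/-- The coordinate partial derivative `∂_α`. -/
def pd {d : ℕ} {E : Type*} [NormedAddCommGroup E] [NormedSpace ℝ E]
    (α : Fin (d + 1)) (f : Sp d → E) : Sp d → E :=
  fun x => fderiv ℝ f x (Pi.single α 1)

/-- The d'Alembertian `□ = -∂_t² + ∑_i ∂_{x_i}²`. -/
def dAlembert {d : ℕ} {E : Type*} [NormedAddCommGroup E] [NormedSpace ℝ E]
    (f : Sp d → E) : Sp d → E :=
  fun x => -(pd 0 (pd 0 f) x) + ∑ i : Fin d, pd i.succ (pd i.succ f) x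

/-- The (truncated, solid) light cone `Γ_d = {(t,x) : t > 0, |x| ≤ t}`,
with `|x|` the Euclidean norm. -/
def Cone (d : ℕ) : Set (Sp d) :=
  {y | 0 < y 0 ∧ ∑ i : Fin d, (y i.succ) ^ 2 ≤ (y 0) ^ 2}

/-- The `5×5` Gram-type matrix with `(0,0)` entry `M`, remaining zeroth row/column entries
`(1/2)∂_α M`, and lower-right `4×4` block `E_{αβ}`. -/
def bigMat (M : Sp 3 → ℝ) (E : Fin 4 → Fin 4 → Sp 3 → ℝ) (y : Sp 3) :
    Matrix (Fin 5) (Fin 5) ℝ :=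
  Matrix.of fun i j =>
    if hi : i = 0 then
      (if hj : j = 0 then M y else (1 / 2) * pd (j.pred hj) M y)
    else
      (if hj : j = 0 then (1 / 2) * pd (i.pred hi) M y
       else E (i.pred hi) (j.pred hj) y)

namespace WaveNash

/-! ### Weighted absolutely convergent exponential sums -/

/-- The `ℓ¹` size of a frequency. -/
def fsz (ξ : Sp 3) : ℝ := ∑ i, |ξ i|

lemma fsz_nonneg (ξ : Sp 3) : 0 ≤ fsz ξ := Finset.sum_nonneg fun _ _ => abs_nonneg _

lemma fsz_add_le (ξ ζ : Sp 3) : fsz (ξ + ζ) ≤ fsz ξ + fsz ζ := by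
  unfold fsz
  rw [← Finset.sum_add_distrib]
  exact Finset.sum_le_sum fun i _ => abs_add_le _ _

@[simp] lemma fsz_neg (ξ : Sp 3) : fsz (-ξ) = fsz ξ := by simp [fsz]

lemma abs_apply_le_fsz (ξ : Sp 3) (i : Fin 4) : |ξ i| ≤ fsz ξ :=
  Finset.single_le_sum (f := fun i => |ξ i|) (fun _ _ => abs_nonneg _) (Finset.mem_univ i)

/-- The weight `(1 + |ξ|)² (1 + η|ξ|)^s`. -/
def wt (s : ℕ) (η : ℝ) (ξ : Sp 3) : ℝ := (1 + fsz ξ) ^ 2 * (1 + η * fsz ξ) ^ s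

lemma one_le_wt (s : ℕ) {η : ℝ} (hη : 0 ≤ η) (ξ : Sp 3) : 1 ≤ wt s η ξ := by
  have h := fsz_nonneg ξ
  exact one_le_mul_of_one_le_of_one_le (one_le_pow₀ (by linarith))
    (one_le_pow₀ (by nlinarith))

lemma wt_pos (s : ℕ) {η : ℝ} (hη : 0 ≤ η) (ξ : Sp 3) : 0 < wt s η ξ :=
  lt_of_lt_of_le one_pos (one_le_wt s hη ξ)

lemma one_add_fsz_pow_le_wt (s : ℕ) {η : ℝ} (hη : 0 ≤ η) (ξ : Sp 3) :
    (1 + fsz ξ) ^ 2 ≤ wt s η ξ := by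
  have h := fsz_nonneg ξ
  exact le_mul_of_one_le_right (by positivity) (one_le_pow₀ (by nlinarith))

@[simp] lemma wt_neg (s : ℕ) (η : ℝ) (ξ : Sp 3) : wt s η (-ξ) = wt s η ξ := by simp [wt]

/-- A symbol of bounded bilinear Fourier multipliers on the weighted spaces. -/
def Adm (m : Sp 3 → Sp 3 → ℂ) (β : ℝ) : Prop :=
  ∀ k l, ‖m k l‖ * (1 + fsz (k + l)) ^ 2 ≤ β * ((1 + fsz k) ^ 2 * (1 + fsz l) ^ 2)

lemma Adm.wt_le {m : Sp 3 → Sp 3 → ℂ} {β : ℝ} (hm : Adm m β) (s : ℕ) {η : ℝ} (hη : 0 ≤ η)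
    (k l : Sp 3) : ‖m k l‖ * wt s η (k + l) ≤ β * (wt s η k * wt s η l) := by
  have hk := fsz_nonneg k
  have hl := fsz_nonneg l
  have hkl := fsz_nonneg (k + l)
  have h1 : (1 + η * fsz (k + l)) ^ s ≤ (1 + η * fsz k) ^ s * (1 + η * fsz l) ^ s := by
    rw [← mul_pow]
    refine pow_le_pow_left₀ (by positivity) ?_ s
    nlinarith [mul_le_mul_of_nonneg_left (fsz_add_le k l) hη,
      mul_nonneg (mul_nonneg hη hk) (mul_nonneg hη hl)]
  have h2 := hm k l
  have h3 : 0 ≤ ‖m k l‖ * (1 + fsz (k + l)) ^ 2 := by positivity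
  calc ‖m k l‖ * wt s η (k + l)
      = (‖m k l‖ * (1 + fsz (k + l)) ^ 2) * (1 + η * fsz (k + l)) ^ s := by
        unfold wt; ring
    _ ≤ (β * ((1 + fsz k) ^ 2 * (1 + fsz l) ^ 2)) * ((1 + η * fsz k) ^ s * (1 + η * fsz l) ^ s) :=
        mul_le_mul h2 h1 (by positivity) (h3.trans h2)
    _ = _ := by unfold wt; ring

lemma adm_one : Adm (fun _ _ => 1) 1 := by
  intro k l
  have hk := fsz_nonneg k
  have hl := fsz_nonneg l
  have hkl := fsz_nonneg (k + l)
  rw [norm_one, one_mul, one_mul, ← mul_pow]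
  refine pow_le_pow_left₀ (by positivity) ?_ 2
  nlinarith [fsz_add_le k l, mul_nonneg hk hl]

/-- Absolutely summable families indexed by frequencies. -/
abbrev XX := lp (fun _ : Sp 3 => ℂ) 1

lemma XX.summable (x : XX) : Summable fun ξ => ‖x ξ‖ := by
  have := (lp.memℓp x).summable (by simp)
  simpa using this

lemma XX.norm_eq (x : XX) : ‖x‖ = ∑' ξ, ‖x ξ‖ := by
  rw [lp.norm_eq_tsum_rpow (by simp)]
  simp

/-- Build an element of `ℓ¹`. -/
def mkX (c : Sp 3 → ℂ) (h : Summable fun ξ => ‖c ξ‖) : XX :=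
  ⟨c, memℓp_gen (by simpa using h)⟩

lemma norm_mkX (c : Sp 3 → ℂ) (h : Summable fun ξ => ‖c ξ‖) :
    ‖mkX c h‖ = ∑' ξ, ‖c ξ‖ := by
  rw [XX.norm_eq]; rfl

/-- One term of the bilinear multiplier. -/
def bilTerm (s : ℕ) (η : ℝ) (m : Sp 3 → Sp 3 → ℂ) (x x' : XX) (p : Sp 3 × Sp 3) : XX :=
  lp.single 1 (p.1 + p.2)
    (m p.1 p.2 * ((wt s η (p.1 + p.2) / (wt s η p.1 * wt s η p.2) : ℝ) : ℂ) * (x p.1 * x' p.2))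

lemma norm_bilTerm_le {s : ℕ} {η : ℝ} (hη : 0 ≤ η) {m : Sp 3 → Sp 3 → ℂ} {β : ℝ} (hm : Adm m β)
    (x x' : XX) (p : Sp 3 × Sp 3) :
    ‖bilTerm s η m x x' p‖ ≤ β * (‖x p.1‖ * ‖x' p.2‖) := by
  unfold bilTerm
  rw [lp.norm_single (by simp)]
  rw [norm_mul, norm_mul, norm_mul, Complex.norm_real, Real.norm_eq_abs, abs_div,
    abs_of_pos (wt_pos s hη _), abs_mul, abs_of_pos (wt_pos s hη _), abs_of_pos (wt_pos s hη _)]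
  refine mul_le_mul_of_nonneg_right ?_ (by positivity)
  have h1 := wt_pos s hη p.1
  have h2 := wt_pos s hη p.2
  rw [← mul_div_assoc, div_le_iff₀ (by positivity)]
  exact hm.wt_le s hη p.1 p.2

lemma summable_pair (x x' : XX) : Summable fun p : Sp 3 × Sp 3 => ‖x p.1‖ * ‖x' p.2‖ :=
  (XX.summable x).mul_of_nonneg (XX.summable x') (fun _ => norm_nonneg _) (fun _ => norm_nonneg _)

lemma summable_bilTerm {s : ℕ} {η : ℝ} (hη : 0 ≤ η) {m : Sp 3 → Sp 3 → ℂ} {β : ℝ} (hm : Adm m β)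
    (x x' : XX) : Summable (bilTerm s η m x x') :=
  Summable.of_norm_bounded ((summable_pair x x').mul_left β) (norm_bilTerm_le hη hm x _)

/-- Bilinear Fourier multiplier. -/
def bil (s : ℕ) (η : ℝ) (m : Sp 3 → Sp 3 → ℂ) (x x' : XX) : XX := ∑' p, bilTerm s η m x x' p

section
variable {s : ℕ} {η : ℝ} {m : Sp 3 → Sp 3 → ℂ} {β : ℝ}

lemma norm_bil_le (hη : 0 ≤ η) (hm : Adm m β) (x x' : XX) :
    ‖bil s η m x x'‖ ≤ β * ‖x‖ * ‖x'‖ := by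
  unfold bil
  refine (tsum_of_norm_bounded (((summable_pair x x').mul_left β).hasSum)
    (norm_bilTerm_le hη hm x x')).trans (le_of_eq ?_)
  rw [tsum_mul_left, XX.norm_eq x, XX.norm_eq x', mul_assoc,
    tsum_mul_tsum_of_summable_norm (by simpa using (XX.summable x)) (by simpa using (XX.summable x'))]

lemma bil_add_left (hη : 0 ≤ η) (hm : Adm m β) (x y z : XX) :
    bil s η m (x + y) z = bil s η m x z + bil s η m y z := by
  unfold bil
  rw [← (summable_bilTerm hη hm x z).tsum_add (summable_bilTerm hη hm y z)]
  congr 1; ext1 p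
  simp only [bilTerm, lp.coeFn_add, Pi.add_apply]
  rw [← lp.single_add]; congr 1; ring

lemma bil_add_right (hη : 0 ≤ η) (hm : Adm m β) (x y z : XX) :
    bil s η m x (y + z) = bil s η m x y + bil s η m x z := by
  unfold bil
  rw [← (summable_bilTerm hη hm x y).tsum_add (summable_bilTerm hη hm x z)]
  congr 1; ext1 p
  simp only [bilTerm, lp.coeFn_add, Pi.add_apply]
  rw [← lp.single_add]; congr 1; ring

lemma bil_sub_left (hη : 0 ≤ η) (hm : Adm m β) (x y z : XX) :
    bil s η m (x - y) z = bil s η m x z - bil s η m y z := by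
  rw [eq_sub_iff_add_eq, ← bil_add_left hη hm, sub_add_cancel]

lemma bil_sub_right (hη : 0 ≤ η) (hm : Adm m β) (x y z : XX) :
    bil s η m x (y - z) = bil s η m x y - bil s η m x z := by
  rw [eq_sub_iff_add_eq, ← bil_add_right hη hm, sub_add_cancel]

end

/-- Reflection and conjugation, `c(ξ) ↦ conj c(-ξ)`. -/
def conjX (x : XX) : XX :=
  mkX (fun ξ => (starRingEnd ℂ) (x (-ξ))) (by
    simpa [Function.comp_def] using (Equiv.neg (Sp 3)).summable_iff.mpr (XX.summable x))

@[simp] lemma conjX_apply (x : XX) (ξ : Sp 3) : conjX x ξ = (starRingEnd ℂ) (x (-ξ)) := rfl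

lemma norm_conjX (x : XX) : ‖conjX x‖ = ‖x‖ := by
  rw [XX.norm_eq, XX.norm_eq]
  simpa using (Equiv.neg (Sp 3)).tsum_eq (fun ξ => ‖x ξ‖)

/-- `conjX` as a homomorphism. -/
def conjHom : XX →+ XX where
  toFun := conjX
  map_zero' := by ext ξ; simp
  map_add' x y := by ext ξ; simp

lemma continuous_conjHom : Continuous conjHom :=
  AddMonoidHomClass.continuous_of_bound conjHom 1 fun x => by
    rw [one_mul]; exact (norm_conjX x).le

lemma conjX_single (ξ : Sp 3) (a : ℂ) :
    conjX (lp.single 1 ξ a) = lp.single 1 (-ξ) ((starRingEnd ℂ) a) := by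
  ext ζ
  rw [conjX_apply, lp.coeFn_single, lp.coeFn_single]
  by_cases h : ζ = -ξ
  · subst h; simp
  · have h' : -ζ ≠ ξ := fun h2 => h (by rw [← h2, neg_neg])
    simp [h, h']

lemma conjX_bil {s : ℕ} {η : ℝ} {m : Sp 3 → Sp 3 → ℂ} {β : ℝ} (hη : 0 ≤ η) (hm : Adm m β)
    (hr : ∀ k l, m (-k) (-l) = (starRingEnd ℂ) (m k l)) (x x' : XX) :
    conjX (bil s η m x x') = bil s η m (conjX x) (conjX x') := by
  have h1 : conjX (bil s η m x x') = ∑' p, conjX (bilTerm s η m x x' p) :=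
    (summable_bilTerm hη hm x x').map_tsum conjHom continuous_conjHom
  rw [h1]
  unfold bil
  rw [← ((Equiv.neg (Sp 3)).prodCongr (Equiv.neg (Sp 3))).tsum_eq
    (bilTerm s η m (conjX x) (conjX x'))]
  congr 1; ext1 p
  simp only [bilTerm, conjX_single, Equiv.prodCongr_apply, Prod.map, Equiv.neg_apply, conjX_apply,
    neg_neg, hr, ← neg_add, wt_neg, map_mul, Complex.conj_ofReal]

/-- Change of weights. -/
def incX (s : ℕ) {η : ℝ} (hη : 0 ≤ η) (x : XX) : XX :=
  mkX (fun ξ => ((wt 0 0 ξ / wt s η ξ : ℝ) : ℂ) * x ξ) (by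
    refine Summable.of_nonneg_of_le (fun _ => norm_nonneg _) (fun ξ => ?_) (XX.summable x)
    rw [norm_mul, Complex.norm_real, Real.norm_eq_abs, abs_of_nonneg
      (div_nonneg (wt_pos 0 le_rfl ξ).le (wt_pos s hη ξ).le)]
    refine mul_le_of_le_one_left (norm_nonneg _) ?_
    rw [div_le_one (wt_pos s hη ξ)]
    simpa [wt] using one_add_fsz_pow_le_wt s hη ξ)

lemma incX_apply (s : ℕ) {η : ℝ} (hη : 0 ≤ η) (x : XX) (ξ : Sp 3) :
    incX s hη x ξ = ((wt 0 0 ξ / wt s η ξ : ℝ) : ℂ) * x ξ := rfl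

lemma norm_incX_le (s : ℕ) {η : ℝ} (hη : 0 ≤ η) (x : XX) : ‖incX s hη x‖ ≤ ‖x‖ := by
  rw [XX.norm_eq, XX.norm_eq]
  refine Summable.tsum_le_tsum (fun ξ => ?_) (XX.summable _) (XX.summable x)
  rw [incX_apply, norm_mul, Complex.norm_real, Real.norm_eq_abs, abs_of_nonneg
      (div_nonneg (wt_pos 0 le_rfl ξ).le (wt_pos s hη ξ).le)]
  refine mul_le_of_le_one_left (norm_nonneg _) ?_
  rw [div_le_one (wt_pos s hη ξ)]
  simpa [wt] using one_add_fsz_pow_le_wt s hη ξ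

/-- `incX` as a homomorphism. -/
def incHom (s : ℕ) {η : ℝ} (hη : 0 ≤ η) : XX →+ XX where
  toFun := incX s hη
  map_zero' := by ext ξ; simp [incX_apply]
  map_add' x y := by ext ξ; simp [incX_apply, mul_add]

lemma continuous_incHom (s : ℕ) {η : ℝ} (hη : 0 ≤ η) : Continuous (incHom s hη) :=
  AddMonoidHomClass.continuous_of_bound (incHom s hη) 1 fun x => by
    rw [one_mul]; exact norm_incX_le s hη x

lemma incX_bil {s : ℕ} {η : ℝ} {m : Sp 3 → Sp 3 → ℂ} {β : ℝ} (hη : 0 ≤ η) (hm : Adm m β)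
    (x x' : XX) :
    incX s hη (bil s η m x x') = bil 0 0 m (incX s hη x) (incX s hη x') := by
  have h1 : incX s hη (bil s η m x x') = ∑' p, incX s hη (bilTerm s η m x x' p) :=
    (summable_bilTerm hη hm x x').map_tsum (incHom s hη) (continuous_incHom s hη)
  rw [h1]
  unfold bil
  congr 1; ext1 p
  ext ζ
  rw [incX_apply]
  unfold bilTerm
  rw [lp.coeFn_single, lp.coeFn_single]
  by_cases h : ζ = p.1 + p.2
  · subst h
    have h0 := (wt_pos 0 (le_refl (0:ℝ)) p.1).ne'
    have h1 := (wt_pos 0 (le_refl (0:ℝ)) p.2).ne'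
    have h2 := (wt_pos s hη p.1).ne'
    have h3 := (wt_pos s hη p.2).ne'
    have h4 := (wt_pos s hη (p.1 + p.2)).ne'
    simp only [Pi.single_eq_same, incX_apply]
    push_cast
    have h0' : ((wt 0 0 p.1 : ℝ) : ℂ) ≠ 0 := by exact_mod_cast h0
    have h1' : ((wt 0 0 p.2 : ℝ) : ℂ) ≠ 0 := by exact_mod_cast h1
    have h2' : ((wt s η p.1 : ℝ) : ℂ) ≠ 0 := by exact_mod_cast h2
    have h3' : ((wt s η p.2 : ℝ) : ℂ) ≠ 0 := by exact_mod_cast h3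
    have h4' : ((wt s η (p.1 + p.2) : ℝ) : ℂ) ≠ 0 := by exact_mod_cast h4
    field_simp
  · simp [h]

/-! ### The quadratic fixed point problem -/

lemma exists_unique_fixedPoint_ball {Y : Type*} [NormedAddCommGroup Y] [CompleteSpace Y]
    (Φ : Y → Y) {ρ : ℝ} (hρ : 0 ≤ ρ) (h0 : ‖Φ 0‖ ≤ ρ / 2)
    (hl : ∀ z z', ‖z‖ ≤ ρ → ‖z'‖ ≤ ρ → ‖Φ z - Φ z'‖ ≤ 1 / 2 * ‖z - z'‖) :
    ∃ z, ‖z‖ ≤ ρ ∧ Φ z = z ∧ ∀ z', ‖z'‖ ≤ ρ → Φ z' = z' → z' = z := by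
  have hmaps : Set.MapsTo Φ (Metric.closedBall 0 ρ) (Metric.closedBall 0 ρ) := by
    intro z hz
    rw [mem_closedBall_zero_iff] at hz ⊢
    have h1 := hl z 0 hz (by simpa using hρ)
    rw [sub_zero] at h1
    have h2 := norm_add_le (Φ z - Φ 0) (Φ 0)
    rw [sub_add_cancel] at h2
    linarith
  have hc : ContractingWith (1 / 2) (hmaps.restrict Φ _ _) := by
    refine ⟨by norm_num, LipschitzWith.of_dist_le_mul fun z z' => ?_⟩
    have := hl z z' (mem_closedBall_zero_iff.mp z.2) (mem_closedBall_zero_iff.mp z'.2)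
    simpa [Subtype.dist_eq, dist_eq_norm] using this
  obtain ⟨z, hz, hfix, -⟩ := hc.exists_fixedPoint' Metric.isClosed_closedBall.isComplete hmaps
    (x := 0) (by simpa using hρ) (edist_ne_top _ _)
  refine ⟨z, by simpa using hz, hfix, fun z' hz' hfix' => ?_⟩
  have := hl z' z hz' (by simpa using hz)
  rw [hfix', hfix.eq] at this
  have h3 : ‖z' - z‖ = 0 := le_antisymm (by linarith) (norm_nonneg _)
  exact sub_eq_zero.mp (norm_eq_zero.mp h3)

section
variable {A I : Type*} [Fintype I]

/-- The linear substitution `V_a = ∑ j, E_{aj} z_j`. -/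
def vv (s : ℕ) (η : ℝ) (E : A → I → XX) (z : I → XX) (a : A) : XX :=
  ∑ j, bil s η (fun _ _ => 1) (E a j) (z j)

lemma vv_sub {s : ℕ} {η : ℝ} {E : A → I → XX} (hη : 0 ≤ η) (z z' : I → XX) (a : A) :
    vv s η E z a - vv s η E z' a = vv s η E (z - z') a := by
  simp only [vv, ← Finset.sum_sub_distrib, Pi.sub_apply, bil_sub_right hη adm_one]

variable [Fintype A]

/-- The map whose fixed points solve the quadratic system. -/
def quadMap (s : ℕ) (η : ℝ) (m : I → Sp 3 → Sp 3 → ℂ) (E : A → I → XX) (D : I → I → XX)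
    (e : I → XX) (z : I → XX) (i : I) : XX :=
  e i - ∑ j, bil s η (fun _ _ => 1) (D i j) (z j)
    + ∑ a, bil s η (m i) (vv s η E z a) (vv s η E z a)

variable {s : ℕ} {η : ℝ} {m : I → Sp 3 → Sp 3 → ℂ} {β C ε : ℝ}
  {E : A → I → XX} {D : I → I → XX} {e : I → XX}

lemma norm_sum_bil_le (hη : 0 ≤ η) (E : I → XX) (hE : ∀ j, ‖E j‖ ≤ C) (z : I → XX) :
    ‖∑ j, bil s η (fun _ _ => 1) (E j) (z j)‖ ≤ Fintype.card I * C * ‖z‖ := by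
  refine (norm_sum_le _ _).trans ?_
  have : ∀ j ∈ Finset.univ, ‖bil s η (fun _ _ => 1) (E j) (z j)‖ ≤ C * ‖z‖ := fun j _ => by
    refine (norm_bil_le hη adm_one _ _).trans ?_
    rw [one_mul]
    exact mul_le_mul (hE j) (norm_le_pi_norm z j) (norm_nonneg _) ((norm_nonneg _).trans (hE j))
  refine (Finset.sum_le_card_nsmul _ _ _ this).trans (le_of_eq ?_)
  rw [nsmul_eq_mul, Finset.card_univ]; ring

lemma norm_quadMap_sub_le (hη : 0 ≤ η) (hβ : 0 ≤ β) (hm : ∀ i, Adm (m i) β) (hC : 0 ≤ C)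
    (hE : ∀ a j, ‖E a j‖ ≤ C) (hε : 0 ≤ ε) (hD : ∀ i j, ‖D i j‖ ≤ ε) {ρ : ℝ} (hρ : 0 ≤ ρ)
    (z z' : I → XX) (hz : ‖z‖ ≤ ρ) (hz' : ‖z'‖ ≤ ρ) :
    ‖quadMap s η m E D e z - quadMap s η m E D e z'‖ ≤
      (Fintype.card I * ε + Fintype.card A * β * (Fintype.card I * C) ^ 2 * (2 * ρ)) * ‖z - z'‖ := by
  refine (pi_norm_le_iff_of_nonneg (by positivity)).mpr fun i => ?_
  set w := z - z' with hw
  have hq : ∀ a, bil s η (m i) (vv s η E z a) (vv s η E z a)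
      - bil s η (m i) (vv s η E z' a) (vv s η E z' a)
      = bil s η (m i) (vv s η E z a) (vv s η E w a) + bil s η (m i) (vv s η E w a) (vv s η E z' a) := by
    intro a
    rw [hw, ← vv_sub hη, bil_sub_left hη (hm i), bil_sub_right hη (hm i)]
    abel
  have key : (quadMap s η m E D e z - quadMap s η m E D e z') i
      = -(∑ j, bil s η (fun _ _ => 1) (D i j) (w j))
        + ∑ a, (bil s η (m i) (vv s η E z a) (vv s η E w a)
          + bil s η (m i) (vv s η E w a) (vv s η E z' a)) := by
    have hwj : ∀ j, w j = z j - z' j := fun _ => rfl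
    simp only [← hq, Finset.sum_sub_distrib, Pi.sub_apply, quadMap, hwj,
      bil_sub_right hη adm_one]
    abel
  rw [key]
  have hv : ∀ (x : I → XX) a, ‖vv s η E x a‖ ≤ Fintype.card I * C * ‖x‖ := fun x a =>
    norm_sum_bil_le hη (E a) (hE a) x
  have h1 := norm_sum_bil_le (s := s) hη (D i) (hD i) w
  have h2 : ‖∑ a, (bil s η (m i) (vv s η E z a) (vv s η E w a)
          + bil s η (m i) (vv s η E w a) (vv s η E z' a))‖
      ≤ Fintype.card A * (β * (Fintype.card I * C) ^ 2 * (2 * ρ) * ‖w‖) := by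
    refine (norm_sum_le _ _).trans ?_
    rw [← nsmul_eq_mul, ← Finset.card_univ]
    refine Finset.sum_le_card_nsmul _ _ _ fun a _ => ?_
    refine (norm_add_le _ _).trans ?_
    have a1 := norm_bil_le (s := s) hη (hm i) (vv s η E z a) (vv s η E w a)
    have a2 := norm_bil_le (s := s) hη (hm i) (vv s η E w a) (vv s η E z' a)
    have b1 : ‖vv s η E z a‖ ≤ Fintype.card I * C * ρ := (hv z a).trans (by gcongr)
    have b2 : ‖vv s η E z' a‖ ≤ Fintype.card I * C * ρ := (hv z' a).trans (by gcongr)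
    have b3 := hv w a
    have c1 : β * ‖vv s η E z a‖ * ‖vv s η E w a‖
        ≤ β * (Fintype.card I * C * ρ) * (Fintype.card I * C * ‖w‖) := by gcongr
    have c2 : β * ‖vv s η E w a‖ * ‖vv s η E z' a‖
        ≤ β * (Fintype.card I * C * ‖w‖) * (Fintype.card I * C * ρ) := by gcongr
    nlinarith
  refine (norm_add_le _ _).trans ?_
  rw [norm_neg]
  nlinarith

/-- Smallness thresholds that make `quadMap` a contraction. -/
lemma exists_quadMap_fixedPoint (A I : Type*) [Fintype A] [Fintype I] (β C : ℝ) (hβ : 0 ≤ β)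
    (hC : 0 ≤ C) :
    ∃ ε > 0, ∃ ρ ≥ 0, ∀ (s : ℕ) (η : ℝ) (m : I → Sp 3 → Sp 3 → ℂ) (E : A → I → XX)
      (D : I → I → XX) (e : I → XX), 0 ≤ η → (∀ i, Adm (m i) β) → (∀ a j, ‖E a j‖ ≤ C) →
      (∀ i j, ‖D i j‖ ≤ ε) → (∀ i, ‖e i‖ ≤ ε) →
      ∃ z, ‖z‖ ≤ ρ ∧ quadMap s η m E D e z = z ∧
        ∀ z', ‖z'‖ ≤ ρ → quadMap s η m E D e z' = z' → z' = z := by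
  set q : ℝ := Fintype.card A * β * (Fintype.card I * C) ^ 2 with hq
  have hq0 : 0 ≤ q := by positivity
  set ρ : ℝ := 1 / (8 * (q + 1)) with hρdef
  have hρ : 0 < ρ := by positivity
  have hqρ : q * (2 * ρ) ≤ 1 / 4 := by
    rw [hρdef, mul_one_div, mul_div_assoc', div_le_iff₀ (by positivity)]
    linarith
  set ε : ℝ := min (ρ / 2) (1 / (4 * (Fintype.card I + 1))) with hε
  have hε0 : 0 < ε := lt_min (by positivity) (by positivity)
  have hIε : Fintype.card I * ε ≤ 1 / 4 := by
    have h1 : ε ≤ 1 / (4 * (Fintype.card I + 1)) := min_le_right _ _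
    rw [le_div_iff₀ (by positivity)] at h1
    nlinarith
  refine ⟨ε, hε0, ρ, hρ.le, fun s η m E D e hη hm hE hD he =>
    exists_unique_fixedPoint_ball _ hρ.le ?_ fun z z' hz hz' => ?_⟩
  · refine (pi_norm_le_iff_of_nonneg (by positivity)).mpr fun i => ?_
    have hb : ∀ (n : Sp 3 → Sp 3 → ℂ) (x : XX), bil s η n x 0 = 0 := fun n x => by
      simp [bil, bilTerm]
    have : quadMap s η m E D e 0 i = e i := by
      simp [quadMap, vv, hb]
    rw [this]
    exact (he i).trans (min_le_left _ _)
  · refine (norm_quadMap_sub_le hη hβ hm hC hE hε0.le hD hρ.le z z' hz hz').trans ?_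
    refine mul_le_mul_of_nonneg_right ?_ (norm_nonneg _)
    linarith

lemma incX_sum {ι : Type*} (s : ℕ) {η : ℝ} (hη : 0 ≤ η) (t : Finset ι) (f : ι → XX) :
    incX s hη (∑ j ∈ t, f j) = ∑ j ∈ t, incX s hη (f j) := map_sum (incHom s hη) f t

lemma conjX_sum {ι : Type*} (t : Finset ι) (f : ι → XX) :
    conjX (∑ j ∈ t, f j) = ∑ j ∈ t, conjX (f j) := map_sum conjHom f t

lemma incX_quadMap (hη : 0 ≤ η) (hm : ∀ i, Adm (m i) β) (z : I → XX) (i : I) :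
    incX s hη (quadMap s η m E D e z i)
      = quadMap 0 0 m (fun a j => incX s hη (E a j)) (fun i j => incX s hη (D i j))
          (fun i => incX s hη (e i)) (fun i => incX s hη (z i)) i := by
  have hv : ∀ a, incX s hη (vv s η E z a)
      = vv 0 0 (fun a j => incX s hη (E a j)) (fun i => incX s hη (z i)) a := fun a => by
    simp only [vv, incX_sum, incX_bil hη adm_one]
  have hadd : ∀ x y : XX, incX s hη (x + y) = incX s hη x + incX s hη y :=
    map_add (incHom s hη)
  have hsub : ∀ x y : XX, incX s hη (x - y) = incX s hη x - incX s hη y :=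
    map_sub (incHom s hη)
  simp only [quadMap, hadd, hsub, incX_sum, incX_bil hη (hm i), incX_bil hη adm_one, hv]

lemma conjX_quadMap (hη : 0 ≤ η) (hm : ∀ i, Adm (m i) β)
    (hr : ∀ i k l, m i (-k) (-l) = (starRingEnd ℂ) (m i k l)) (z : I → XX) (i : I) :
    conjX (quadMap s η m E D e z i)
      = quadMap s η m (fun a j => conjX (E a j)) (fun i j => conjX (D i j))
          (fun i => conjX (e i)) (fun i => conjX (z i)) i := by
  have h1 : ∀ x x' : XX, conjX (bil s η (fun _ _ => 1) x x')
      = bil s η (fun _ _ => 1) (conjX x) (conjX x') := conjX_bil hη adm_one (by simp)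
  have hv : ∀ a, conjX (vv s η E z a)
      = vv s η (fun a j => conjX (E a j)) (fun i => conjX (z i)) a := fun a => by
    simp only [vv, conjX_sum, h1]
  have hadd : ∀ x y : XX, conjX (x + y) = conjX x + conjX y := map_add conjHom
  have hsub : ∀ x y : XX, conjX (x - y) = conjX x - conjX y := map_sub conjHom
  simp only [quadMap, hadd, hsub, conjX_sum, conjX_bil hη (hm i) (hr i), h1, hv]

end

/-! ### Exponential sums with rapidly decreasing coefficients -/

/-- Rapidly decreasing coefficients. -/
def Rapid (c : Sp 3 → ℂ) : Prop := ∀ s : ℕ, Summable fun ξ => (1 + fsz ξ) ^ s * ‖c ξ‖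

/-- Coefficients of a real exponential sum. -/
def RealC (c : Sp 3 → ℂ) : Prop := ∀ ξ, c (-ξ) = (starRingEnd ℂ) (c ξ)

/-- The base weighted norm. -/
def wnorm (c : Sp 3 → ℂ) : ℝ := ∑' ξ, (1 + fsz ξ) ^ 2 * ‖c ξ‖

lemma Rapid.summable_wt {c : Sp 3 → ℂ} (hc : Rapid c) (s : ℕ) {η : ℝ} (hη : 0 ≤ η) :
    Summable fun ξ => ‖((wt s η ξ : ℝ) : ℂ) * c ξ‖ := by
  refine Summable.of_nonneg_of_le (fun _ => norm_nonneg _) (fun ξ => ?_)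
    ((hc (s + 2)).mul_left ((1 + η) ^ s))
  have h := fsz_nonneg ξ
  rw [norm_mul, Complex.norm_real, Real.norm_eq_abs, abs_of_pos (wt_pos s hη ξ), ← mul_assoc]
  refine mul_le_mul_of_nonneg_right ?_ (norm_nonneg _)
  have h1 : (1 + η * fsz ξ) ^ s ≤ ((1 + η) * (1 + fsz ξ)) ^ s :=
    pow_le_pow_left₀ (by positivity) (by nlinarith) s
  calc wt s η ξ ≤ (1 + fsz ξ) ^ 2 * ((1 + η) * (1 + fsz ξ)) ^ s := by
        unfold wt; gcongr
    _ = _ := by rw [mul_pow]; ring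

/-- The element of the weighted space with the given coefficients. -/
def toX (s : ℕ) {η : ℝ} (hη : 0 ≤ η) {c : Sp 3 → ℂ} (hc : Rapid c) : XX :=
  mkX (fun ξ => ((wt s η ξ : ℝ) : ℂ) * c ξ) (hc.summable_wt s hη)

lemma toX_apply (s : ℕ) {η : ℝ} (hη : 0 ≤ η) {c : Sp 3 → ℂ} (hc : Rapid c) (ξ : Sp 3) :
    toX s hη hc ξ = ((wt s η ξ : ℝ) : ℂ) * c ξ := rfl

lemma norm_toX (s : ℕ) {η : ℝ} (hη : 0 ≤ η) {c : Sp 3 → ℂ} (hc : Rapid c) :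
    ‖toX s hη hc‖ = ∑' ξ, wt s η ξ * ‖c ξ‖ := by
  unfold toX
  rw [norm_mkX]
  congr 1; ext ξ
  rw [norm_mul, Complex.norm_real, Real.norm_eq_abs, abs_of_pos (wt_pos s hη ξ)]

lemma norm_toX_zero {c : Sp 3 → ℂ} (hc : Rapid c) : ‖toX 0 le_rfl hc‖ = wnorm c := by
  rw [norm_toX]; simp [wt, wnorm]

lemma incX_toX (s : ℕ) {η : ℝ} (hη : 0 ≤ η) {c : Sp 3 → ℂ} (hc : Rapid c) :
    incX s hη (toX s hη hc) = toX 0 le_rfl hc := by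
  ext ξ
  have h : ((wt s η ξ : ℝ) : ℂ) ≠ 0 := by exact_mod_cast (wt_pos s hη ξ).ne'
  rw [incX_apply, toX_apply, toX_apply]
  push_cast
  field_simp

lemma conjX_toX (s : ℕ) {η : ℝ} (hη : 0 ≤ η) {c : Sp 3 → ℂ} (hc : Rapid c) (hr : RealC c) :
    conjX (toX s hη hc) = toX s hη hc := by
  ext ξ
  rw [conjX_apply, toX_apply, toX_apply, hr ξ, wt_neg]
  simp

lemma eventually_norm_toX_le {c : Sp 3 → ℂ} (hc : Rapid c) (s : ℕ) {C : ℝ} (hC : wnorm c < C) :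
    ∀ᶠ η in nhdsWithin (0 : ℝ) (Set.Ioc 0 1), ∀ hη : 0 ≤ η, ‖toX s hη hc‖ ≤ C := by
  have h : Filter.Tendsto (fun η => ∑' ξ, wt s η ξ * ‖c ξ‖) (nhdsWithin (0 : ℝ) (Set.Ioc 0 1))
      (nhds (∑' ξ, wt s 0 ξ * ‖c ξ‖)) := by
    refine tendsto_tsum_of_dominated_convergence (hc (s + 2)) (fun ξ => ?_) ?_
    · have : Continuous fun η : ℝ => wt s η ξ * ‖c ξ‖ := by unfold wt; fun_prop
      exact (this.tendsto 0).mono_left nhdsWithin_le_nhds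
    · filter_upwards [self_mem_nhdsWithin] with η hη ξ
      have h := fsz_nonneg ξ
      rw [norm_mul, norm_norm, Real.norm_eq_abs, abs_of_pos (wt_pos s hη.1.le ξ), pow_add, mul_comm
        ((1 + fsz ξ) ^ s)]
      refine mul_le_mul_of_nonneg_right ?_ (norm_nonneg _)
      refine mul_le_mul_of_nonneg_left ?_ (by positivity)
      exact pow_le_pow_left₀ (by have := hη.1; positivity) (by nlinarith [hη.2]) s
  have h0 : (∑' ξ, wt s 0 ξ * ‖c ξ‖) < C := by simpa [wt, wnorm] using hC
  filter_upwards [h.eventually_lt_const h0] with η hη h1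
  rw [norm_toX]; exact hη.le

/-- The coefficients of an element of the base space. -/
def coef (x : XX) (ξ : Sp 3) : ℂ := x ξ / ((wt 0 0 ξ : ℝ) : ℂ)

lemma wt_zero_ne (ξ : Sp 3) : ((wt 0 0 ξ : ℝ) : ℂ) ≠ 0 := by
  exact_mod_cast (wt_pos 0 le_rfl ξ).ne'

lemma coef_toX {c : Sp 3 → ℂ} (hc : Rapid c) : coef (toX 0 le_rfl hc) = c := by
  ext ξ
  rw [coef, toX_apply, mul_div_cancel_left₀ _ (wt_zero_ne ξ)]

lemma realC_coef {x : XX} (h : conjX x = x) : RealC (coef x) := by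
  intro ξ
  conv_rhs => rw [← h]
  simp [coef]

lemma rapid_coef (x : XX)
    (h : ∀ s : ℕ, ∃ (η : ℝ) (h0 : 0 < η) (_ : η ≤ 1) (x' : XX), incX s h0.le x' = x) :
    Rapid (coef x) := by
  intro s
  obtain ⟨η, h0, h1, x', rfl⟩ := h s
  refine Summable.of_nonneg_of_le (fun ξ => ?_) (fun ξ => ?_)
    ((XX.summable x').mul_left ((η ^ s)⁻¹))
  · have := fsz_nonneg ξ; positivity
  · have hf := fsz_nonneg ξ
    have e : coef (incX s h0.le x') ξ = x' ξ / ((wt s η ξ : ℝ) : ℂ) := by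
      have := wt_zero_ne ξ
      rw [coef, incX_apply]; push_cast; field_simp
    rw [e, norm_div, Complex.norm_real, Real.norm_eq_abs, abs_of_pos (wt_pos s h0.le ξ)]
    rw [← mul_div_assoc, div_le_iff₀ (wt_pos s h0.le ξ), mul_assoc, mul_comm ‖x' ξ‖, ← mul_assoc]
    refine mul_le_mul_of_nonneg_right ?_ (norm_nonneg _)
    rw [inv_mul_eq_div, le_div_iff₀ (by positivity), ← mul_pow]
    unfold wt
    refine le_trans ?_ (le_mul_of_one_le_left (by positivity) (one_le_pow₀ (by linarith)))
    exact pow_le_pow_left₀ (by positivity) (by nlinarith) s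

/-- The exponential `e^{i ξ·y}`. -/
def ech (ξ y : Sp 3) : ℂ := Complex.exp (Complex.I * ((∑ i, ξ i * y i : ℝ) : ℂ))

lemma ech_add (ξ ζ y : Sp 3) : ech (ξ + ζ) y = ech ξ y * ech ζ y := by
  unfold ech
  rw [← Complex.exp_add, ← mul_add, ← Complex.ofReal_add, ← Finset.sum_add_distrib]
  simp only [Pi.add_apply, add_mul]

@[simp] lemma norm_ech (ξ y : Sp 3) : ‖ech ξ y‖ = 1 := by
  rw [ech, mul_comm, Complex.norm_exp_ofReal_mul_I]

@[simp] lemma ech_zero (y : Sp 3) : ech 0 y = 1 := by simp [ech]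

lemma ech_neg (ξ y : Sp 3) : ech (-ξ) y = (starRingEnd ℂ) (ech ξ y) := by
  unfold ech
  rw [← Complex.exp_conj]
  simp

lemma norm_coef_le (x : XX) (ξ : Sp 3) : ‖coef x ξ‖ ≤ ‖x ξ‖ := by
  rw [coef, norm_div, Complex.norm_real, Real.norm_eq_abs, abs_of_pos (wt_pos 0 le_rfl ξ)]
  exact div_le_self (norm_nonneg _) (one_le_wt 0 le_rfl ξ)

lemma summable_ev (y : Sp 3) (x : XX) : Summable fun ξ => coef x ξ * ech ξ y := by
  refine Summable.of_norm_bounded (XX.summable x) fun ξ => ?_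
  rw [norm_mul, norm_ech, mul_one]
  exact norm_coef_le x ξ

/-- Evaluation of the exponential sum at a point. -/
def ev (y : Sp 3) : XX →+ ℂ where
  toFun x := ∑' ξ, coef x ξ * ech ξ y
  map_zero' := by simp [coef]
  map_add' x x' := by
    rw [← (summable_ev y x).tsum_add (summable_ev y x')]
    congr 1; ext ξ
    simp only [coef, lp.coeFn_add, Pi.add_apply]; ring

lemma ev_apply (y : Sp 3) (x : XX) : ev y x = ∑' ξ, coef x ξ * ech ξ y := rfl

lemma continuous_ev (y : Sp 3) : Continuous (ev y) :=
  AddMonoidHomClass.continuous_of_bound (ev y) 1 fun x => by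
    rw [one_mul, XX.norm_eq, ev_apply]
    refine tsum_of_norm_bounded (XX.summable x).hasSum fun ξ => ?_
    rw [norm_mul, norm_ech, mul_one]
    exact norm_coef_le x ξ

lemma ev_single (y ξ : Sp 3) (a : ℂ) :
    ev y (lp.single 1 ξ a) = a / ((wt 0 0 ξ : ℝ) : ℂ) * ech ξ y := by
  rw [ev_apply, tsum_eq_single ξ]
  · simp [coef]
  · intro ζ h; simp [coef, h]

lemma ev_bilTerm (y : Sp 3) (m : Sp 3 → Sp 3 → ℂ) (x x' : XX) (p : Sp 3 × Sp 3) :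
    ev y (bilTerm 0 0 m x x' p)
      = m p.1 p.2 * coef x p.1 * coef x' p.2 * ech (p.1 + p.2) y := by
  rw [bilTerm, ev_single]
  have h1 := wt_zero_ne p.1
  have h2 := wt_zero_ne p.2
  have h3 := wt_zero_ne (p.1 + p.2)
  unfold coef
  push_cast
  field_simp

lemma hasSum_ev_bil (y : Sp 3) {m : Sp 3 → Sp 3 → ℂ} {β : ℝ} (hm : Adm m β) (x x' : XX) :
    HasSum (fun p : Sp 3 × Sp 3 => m p.1 p.2 * coef x p.1 * coef x' p.2 * ech (p.1 + p.2) y)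
      (ev y (bil 0 0 m x x')) := by
  have := (summable_bilTerm (s := 0) le_rfl hm x x').hasSum.map (ev y) (continuous_ev y)
  simpa only [Function.comp_def, ev_bilTerm, bil] using this

lemma ev_bil_one (y : Sp 3) (x x' : XX) :
    ev y (bil 0 0 (fun _ _ => 1) x x') = ev y x * ev y x' := by
  rw [← (hasSum_ev_bil y adm_one x x').tsum_eq, ev_apply, ev_apply, tsum_mul_tsum_of_summable_norm
    (summable_ev y x).norm (summable_ev y x').norm]
  congr 1; ext p
  rw [ech_add]; ring

/-- Smooth solutions of small quadratic systems in the Wiener algebra. -/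
theorem wiener_quadratic_solve (A I : Type*) [Fintype A] [Fintype I] (β C : ℝ) (hβ : 0 ≤ β)
    (hC : 0 < C) :
    ∃ ε > 0, ∀ (m : I → Sp 3 → Sp 3 → ℂ) (E : A → I → Sp 3 → ℂ) (D : I → I → Sp 3 → ℂ)
      (e : I → Sp 3 → ℂ), (∀ i, Adm (m i) β) →
      (∀ i k l, m i (-k) (-l) = (starRingEnd ℂ) (m i k l)) →
      ∀ (hE : ∀ a j, Rapid (E a j)) (hD : ∀ i j, Rapid (D i j)) (he : ∀ i, Rapid (e i)),
      (∀ a j, RealC (E a j)) → (∀ i j, RealC (D i j)) → (∀ i, RealC (e i)) →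
      (∀ a j, wnorm (E a j) ≤ C) → (∀ i j, wnorm (D i j) ≤ ε) → (∀ i, wnorm (e i) ≤ ε) →
      ∃ z : I → XX, (∀ i, Rapid (coef (z i))) ∧ (∀ i, RealC (coef (z i))) ∧
        (∀ a, Rapid (coef (vv 0 0 (fun a j => toX 0 le_rfl (hE a j)) z a))) ∧
        (∀ a, RealC (coef (vv 0 0 (fun a j => toX 0 le_rfl (hE a j)) z a))) ∧
        quadMap 0 0 m (fun a j => toX 0 le_rfl (hE a j)) (fun i j => toX 0 le_rfl (hD i j))
          (fun i => toX 0 le_rfl (he i)) z = z := by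
  obtain ⟨ε, hε, ρ, hρ, H⟩ := exists_quadMap_fixedPoint A I β (2 * C) hβ (by positivity)
  refine ⟨ε / 2, by positivity, fun m E D e hm hr hE hD he rE rD re nE nD ne => ?_⟩
  obtain ⟨z, hz, hfix, huniq⟩ := H 0 0 m (fun a j => toX 0 le_rfl (hE a j))
    (fun i j => toX 0 le_rfl (hD i j)) (fun i => toX 0 le_rfl (he i)) le_rfl hm
    (fun a j => by rw [norm_toX_zero]; linarith [nE a j])
    (fun i j => by rw [norm_toX_zero]; linarith [nD i j])
    (fun i => by rw [norm_toX_zero]; linarith [ne i])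
  have hconj : (fun i => conjX (z i)) = z := by
    refine huniq _ ?_ ?_
    · refine (pi_norm_le_iff_of_nonneg hρ).mpr fun i => ?_
      rw [norm_conjX]; exact (norm_le_pi_norm z i).trans hz
    · ext1 i
      have := conjX_quadMap le_rfl hm hr z i (s := 0) (E := fun a j => toX 0 le_rfl (hE a j))
        (D := fun i j => toX 0 le_rfl (hD i j)) (e := fun i => toX 0 le_rfl (he i))
      simp only [conjX_toX _ _ _ (rE _ _), conjX_toX _ _ _ (rD _ _), conjX_toX _ _ _ (re _)] at this
      rw [← this, hfix]
  have hlift : ∀ s : ℕ, ∃ (η : ℝ) (h0 : 0 < η) (_ : η ≤ 1) (w : I → XX),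
      (fun i => incX s h0.le (w i)) = z := by
    intro s
    have e1 : ∀ᶠ η in nhdsWithin (0 : ℝ) (Set.Ioc 0 1), ∀ a j, ∀ hη : 0 ≤ η,
        ‖toX s hη (hE a j)‖ ≤ 2 * C := by
      rw [Filter.eventually_all]; intro a; rw [Filter.eventually_all]; intro j
      exact eventually_norm_toX_le _ s (by linarith [nE a j])
    have e2 : ∀ᶠ η in nhdsWithin (0 : ℝ) (Set.Ioc 0 1), ∀ i j, ∀ hη : 0 ≤ η,
        ‖toX s hη (hD i j)‖ ≤ ε := by
      rw [Filter.eventually_all]; intro a; rw [Filter.eventually_all]; intro j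
      exact eventually_norm_toX_le _ s (by linarith [nD a j])
    have e3 : ∀ᶠ η in nhdsWithin (0 : ℝ) (Set.Ioc 0 1), ∀ i, ∀ hη : 0 ≤ η,
        ‖toX s hη (he i)‖ ≤ ε := by
      rw [Filter.eventually_all]; intro a
      exact eventually_norm_toX_le _ s (by linarith [ne a])
    have : (nhdsWithin (0 : ℝ) (Set.Ioc 0 1)).NeBot := by
      rw [← mem_closure_iff_nhdsWithin_neBot, closure_Ioc (by norm_num)]
      exact ⟨le_rfl, zero_le_one⟩
    obtain ⟨η, ⟨h1, h2, h3⟩, h0, h01⟩ :=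
      ((e1.and (e2.and e3)).and self_mem_nhdsWithin).exists
    obtain ⟨w, hw, hwfix, -⟩ := H s η m (fun a j => toX s h0.le (hE a j))
      (fun i j => toX s h0.le (hD i j)) (fun i => toX s h0.le (he i)) h0.le hm
      (fun a j => h1 a j _) (fun i j => h2 i j _) (fun i => h3 i _)
    refine ⟨η, h0, h01, w, huniq _ ?_ ?_⟩
    · refine (pi_norm_le_iff_of_nonneg hρ).mpr fun i => ?_
      exact (norm_incX_le s h0.le _).trans ((norm_le_pi_norm w i).trans hw)
    · ext1 i
      have := incX_quadMap h0.le hm w i (s := s) (E := fun a j => toX s h0.le (hE a j))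
        (D := fun i j => toX s h0.le (hD i j)) (e := fun i => toX s h0.le (he i))
      simp only [incX_toX] at this
      rw [← this, hwfix]
  refine ⟨z, fun i => rapid_coef _ fun s => ?_, fun i => realC_coef (congrFun hconj i),
    fun a => rapid_coef _ fun s => ?_, fun a => realC_coef ?_, hfix⟩
  · obtain ⟨η, h0, h1, w, hw⟩ := hlift s
    exact ⟨η, h0, h1, w i, congrFun hw i⟩
  · obtain ⟨η, h0, h1, w, hw⟩ := hlift s
    refine ⟨η, h0, h1, vv s η (fun a j => toX s h0.le (hE a j)) w a, ?_⟩
    rw [← hw]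
    simp only [vv, incX_sum, incX_bil h0.le adm_one, incX_toX]
  · have h1 : ∀ x x' : XX, conjX (bil 0 0 (fun _ _ => 1) x x')
      = bil 0 0 (fun _ _ => 1) (conjX x) (conjX x') := conjX_bil le_rfl adm_one (by simp)
    have h2 : ∀ i, conjX (z i) = z i := congrFun hconj
    simp only [vv, conjX_sum, h1, h2, conjX_toX _ _ _ (rE _ _)]

/-! ### Smoothness of exponential sums -/

section
variable {T : Type*}

/-- Rapid decrease of a family of coefficients with respect to its frequencies. -/
def RapidT (φ : T → Sp 3) (c : T → ℂ) : Prop :=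
  ∀ s : ℕ, Summable fun t => (1 + fsz (φ t)) ^ s * ‖c t‖

/-- The exponential sum with frequencies `φ` and coefficients `c`. -/
def esum (φ : T → Sp 3) (c : T → ℂ) (y : Sp 3) : ℂ := ∑' t, c t * ech (φ t) y

/-- The coefficients of the `i`-th derivative. -/
def dcoef (φ : T → Sp 3) (i : Fin 4) (c : T → ℂ) (t : T) : ℂ := Complex.I * (φ t i : ℂ) * c t

variable {φ : T → Sp 3} {c : T → ℂ}

lemma RapidT.dcoef (hc : RapidT φ c) (i : Fin 4) : RapidT φ (dcoef φ i c) := by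
  intro s
  refine Summable.of_nonneg_of_le (fun t => ?_) (fun t => ?_) (hc (s + 1))
  · have := fsz_nonneg (φ t); positivity
  · have h := fsz_nonneg (φ t)
    have h1 := abs_apply_le_fsz (φ t) i
    rw [WaveNash.dcoef, norm_mul, norm_mul, Complex.norm_I, one_mul, Complex.norm_real,
      Real.norm_eq_abs, ← mul_assoc, pow_succ]
    gcongr
    linarith

lemma RapidT.summable_norm (hc : RapidT φ c) : Summable fun t => ‖c t‖ := by simpa using hc 0

lemma RapidT.summable (hc : RapidT φ c) (y : Sp 3) : Summable fun t => c t * ech (φ t) y :=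
  Summable.of_norm_bounded hc.summable_norm fun t => by simp

/-- The derivative of an exponential. -/
def echD (ξ y : Sp 3) : Sp 3 →L[ℝ] ℂ :=
  ∑ i, (ContinuousLinearMap.proj (R := ℝ) (φ := fun _ : Fin 4 => ℝ) i).smulRight
    (Complex.I * (ξ i : ℂ) * ech ξ y)

lemma hasFDerivAt_ech (ξ y : Sp 3) : HasFDerivAt (ech ξ) (echD ξ y) y := by
  have h1 : HasFDerivAt (fun y : Sp 3 => ∑ i, ξ i * y i)
      (∑ i, ξ i • (ContinuousLinearMap.proj (R := ℝ) (φ := fun _ : Fin 4 => ℝ) i)) y := by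
    refine HasFDerivAt.fun_sum fun i _ => ?_
    exact (ContinuousLinearMap.proj (R := ℝ) (φ := fun _ : Fin 4 => ℝ) i).hasFDerivAt.const_mul _
  have h2 := (Complex.ofRealCLM.hasFDerivAt.comp y h1).const_mul Complex.I
  have h3 := h2.cexp
  refine h3.congr_fderiv ?_
  ext v
  simp only [_root_.smul_apply, ContinuousLinearMap.comp_apply,
    _root_.sum_apply, echD, ContinuousLinearMap.smulRight_apply,
    ContinuousLinearMap.proj_apply, Complex.ofRealCLM_apply, smul_eq_mul, Function.comp_def,
    Complex.ofReal_sum, Complex.ofReal_mul, Finset.mul_sum, Complex.real_smul, ech]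
  refine Finset.sum_congr rfl fun i _ => ?_
  ring

lemma norm_echD_le (ξ y : Sp 3) : ‖echD ξ y‖ ≤ fsz ξ := by
  unfold echD fsz
  refine (norm_sum_le _ _).trans (Finset.sum_le_sum fun i _ => ?_)
  refine ContinuousLinearMap.opNorm_le_bound _ (abs_nonneg _) fun v => ?_
  simp only [ContinuousLinearMap.smulRight_apply, ContinuousLinearMap.proj_apply, norm_smul,
    norm_mul, Complex.norm_I, norm_ech, Complex.norm_real, one_mul, mul_one]
  rw [mul_comm]
  exact mul_le_mul_of_nonneg_left (norm_le_pi_norm v i) (abs_nonneg _)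

lemma hasFDerivAt_esum (hc : RapidT φ c) (y : Sp 3) :
    HasFDerivAt (esum φ c)
      (∑ i, (ContinuousLinearMap.proj (R := ℝ) (φ := fun _ : Fin 4 => ℝ) i).smulRight
        (esum φ (dcoef φ i c) y)) y := by
  have hb : ∀ t (x : Sp 3), ‖c t • echD (φ t) x‖ ≤ (1 + fsz (φ t)) ^ 1 * ‖c t‖ := fun t x => by
    rw [norm_smul, mul_comm, pow_one]
    refine mul_le_mul_of_nonneg_right ?_ (norm_nonneg _)
    have := norm_echD_le (φ t) x
    linarith
  have h := hasFDerivAt_tsum (𝕜 := ℝ) (f := fun t x => c t * ech (φ t) x)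
    (f' := fun t x => c t • echD (φ t) x) (hc 1)
    (fun t x => (hasFDerivAt_ech (φ t) x).const_mul (c t)) hb (hc.summable 0) y
  refine h.congr_fderiv ?_
  have hs : Summable fun t => c t • echD (φ t) y := Summable.of_norm_bounded (hc 1) fun t => hb t y
  ext v
  have e1 : (∑' t, c t • echD (φ t) y) v = ∑' t, (c t • echD (φ t) y) v :=
    (ContinuousLinearMap.apply ℝ ℂ v).map_tsum hs
  rw [e1, _root_.sum_apply]
  simp only [ContinuousLinearMap.smulRight_apply, ContinuousLinearMap.proj_apply, echD,
    _root_.smul_apply, _root_.sum_apply, esum, smul_eq_mul,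
    Complex.real_smul, ← tsum_mul_left, Finset.mul_sum]
  rw [Summable.tsum_finsetSum]
  · refine Finset.sum_congr rfl fun i _ => ?_
    congr 1; ext t; unfold dcoef; ring
  · intro i _
    have := ((hc.dcoef i).summable y).mul_left ((v i : ℝ) : ℂ)
    refine this.congr fun t => ?_
    unfold dcoef; ring

lemma contDiff_esum (hc : RapidT φ c) : ContDiff ℝ (⊤ : ℕ∞) (esum φ c) := by
  rw [contDiff_infty]
  intro n
  induction n generalizing c with
  | zero => exact contDiff_zero.mpr (continuous_iff_continuousAt.mpr fun y =>
      (hasFDerivAt_esum hc y).continuousAt)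
  | succ n ih =>
    push_cast
    rw [contDiff_succ_iff_hasFDerivAt]
    refine ⟨_, ?_, hasFDerivAt_esum hc⟩
    refine ContDiff.sum fun i _ => ?_
    exact contDiff_const.smulRight (ih (hc.dcoef i))

lemma contDiff_re_esum (hc : RapidT φ c) : ContDiff ℝ (⊤ : ℕ∞) fun y => (esum φ c y).re :=
  Complex.reCLM.contDiff.comp (contDiff_esum hc)

lemma pd_re_esum (hc : RapidT φ c) (i : Fin 4) (y : Sp 3) :
    pd i (fun y => (esum φ c y).re) y = (esum φ (dcoef φ i c) y).re := by
  have h := Complex.reCLM.hasFDerivAt.comp y (hasFDerivAt_esum hc y)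
  unfold pd
  have h2 : fderiv ℝ (fun y => (esum φ c y).re) y = _ := h.fderiv
  rw [h2]
  simp only [ContinuousLinearMap.comp_apply, _root_.sum_apply,
    ContinuousLinearMap.smulRight_apply, ContinuousLinearMap.proj_apply]
  rw [Finset.sum_eq_single i]
  · simp
  · intro j _ hj; simp [hj]
  · simp

end

lemma RealC.dcoef {c : Sp 3 → ℂ} (hr : RealC c) (i : Fin 4) : RealC (dcoef id i c) := by
  intro ξ
  simp [WaveNash.dcoef, hr ξ]

lemma esum_im {c : Sp 3 → ℂ} (hr : RealC c) (y : Sp 3) : (esum id c y).im = 0 := by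
  rw [← Complex.conj_eq_iff_im]
  unfold esum
  rw [Complex.conj_tsum, ← (Equiv.neg (Sp 3)).tsum_eq]
  congr 1; ext ξ
  simp only [map_mul, Equiv.neg_apply, id, ech_neg, hr ξ, Complex.conj_conj]

lemma esum_eq_re {c : Sp 3 → ℂ} (hr : RealC c) (y : Sp 3) :
    esum id c y = ((esum id c y).re : ℂ) := by
  apply Complex.ext <;> simp [esum_im hr y]

lemma esum_coef (x : XX) (y : Sp 3) : esum id (coef x) y = ev y x := rfl

lemma Rapid.rapidT {c : Sp 3 → ℂ} (hc : Rapid c) : RapidT id c := hc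

lemma rapidT_pair {c c' : Sp 3 → ℂ} (hc : Rapid c) (hc' : Rapid c') {m : Sp 3 → Sp 3 → ℂ} {β : ℝ}
    (hm : Adm m β) :
    RapidT (fun p : Sp 3 × Sp 3 => p.1 + p.2) (fun p => m p.1 p.2 * c p.1 * c' p.2) := by
  intro s
  have h := ((hc (s + 2)).mul_of_nonneg (hc' (s + 2))
    (fun ξ => by have := fsz_nonneg ξ; positivity)
    (fun ξ => by have := fsz_nonneg ξ; positivity)).mul_left β
  refine Summable.of_nonneg_of_le (fun p => ?_) (fun p => ?_) h
  · have := fsz_nonneg (p.1 + p.2); positivity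
  · have h1 := fsz_nonneg p.1
    have h2 := fsz_nonneg p.2
    have h3 := fsz_nonneg (p.1 + p.2)
    have hmm : ‖m p.1 p.2‖ ≤ β * ((1 + fsz p.1) ^ 2 * (1 + fsz p.2) ^ 2) := by
      refine le_trans ?_ (hm p.1 p.2)
      exact le_mul_of_one_le_right (norm_nonneg _) (one_le_pow₀ (by linarith))
    have hp : (1 + fsz (p.1 + p.2)) ^ s ≤ (1 + fsz p.1) ^ s * (1 + fsz p.2) ^ s := by
      rw [← mul_pow]
      refine pow_le_pow_left₀ (by positivity) ?_ s
      nlinarith [fsz_add_le p.1 p.2, mul_nonneg h1 h2]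
    rw [norm_mul, norm_mul]
    calc (1 + fsz (p.1 + p.2)) ^ s * (‖m p.1 p.2‖ * ‖c p.1‖ * ‖c' p.2‖)
        ≤ ((1 + fsz p.1) ^ s * (1 + fsz p.2) ^ s)
          * (β * ((1 + fsz p.1) ^ 2 * (1 + fsz p.2) ^ 2) * ‖c p.1‖ * ‖c' p.2‖) := by
          gcongr
      _ = _ := by ring

lemma esum_mul_esum {c c' : Sp 3 → ℂ} (hc : Rapid c) (hc' : Rapid c') (y : Sp 3) :
    esum id c y * esum id c' y
      = esum (fun p : Sp 3 × Sp 3 => p.1 + p.2) (fun p => c p.1 * c' p.2) y := by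
  unfold esum
  rw [tsum_mul_tsum_of_summable_norm ((hc.rapidT.summable y).norm) ((hc'.rapidT.summable y).norm)]
  congr 1; ext p
  rw [ech_add]; simp only [id]; ring

/-! ### Günther's quadratic symbols and the perturbation theorem -/

/-- The squared Euclidean length of a frequency. -/
def esq (ξ : Sp 3) : ℝ := ∑ i, ξ i ^ 2

/-- Symbol of `N_j`. -/
def nR (j : Fin 4) (k l : Sp 3) : ℝ := (esq k * l j + esq l * k j) / (1 + esq (k + l)) / 2

/-- Symbol of `M_ij`. -/
def mR (i j : Fin 4) (k l : Sp 3) : ℝ :=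
  (l i * l j * esq k + k i * k j * esq l
    - (k i * l j + k j * l i) * (2 * (∑ r, k r * l r) + 1) / 2) / (1 + esq (k + l))

lemma esq_nonneg (ξ : Sp 3) : 0 ≤ esq ξ := Finset.sum_nonneg fun _ _ => sq_nonneg _

lemma esq_le (ξ : Sp 3) : esq ξ ≤ fsz ξ ^ 2 := by
  unfold esq fsz
  have := Finset.sum_sq_le_sq_sum_of_nonneg (s := Finset.univ) (f := fun i => |ξ i|)
    (fun i _ => abs_nonneg (ξ i))
  simpa using this

lemma fsz_sq_le (ξ : Sp 3) : (1 + fsz ξ) ^ 2 ≤ 8 * (1 + esq ξ) := by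
  have h := sq_sum_le_card_mul_sum_sq (s := (Finset.univ : Finset (Fin 4))) (f := fun i => |ξ i|)
  simp only [sq_abs, Finset.card_univ, Fintype.card_fin] at h
  have h' : fsz ξ ^ 2 ≤ 4 * esq ξ := by simpa [fsz, esq] using h
  nlinarith [sq_nonneg (fsz ξ - 1), esq_nonneg ξ]

lemma adm_of_bound {f : Sp 3 → Sp 3 → ℝ} {B : ℝ}
    (hf : ∀ k l, |f k l| ≤ B * ((1 + fsz k) ^ 2 * (1 + fsz l) ^ 2)) {w : ℂ} (hw : ‖w‖ ≤ 1) :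
    Adm (fun k l => w * ((f k l / (1 + esq (k + l)) : ℝ) : ℂ)) (8 * B) := by
  intro k l
  have hp : 0 < 1 + esq (k + l) := by have := esq_nonneg (k + l); linarith
  rw [norm_mul, Complex.norm_real, Real.norm_eq_abs, abs_div, abs_of_pos hp]
  have h1 := fsz_sq_le (k + l)
  calc ‖w‖ * (|f k l| / (1 + esq (k + l))) * (1 + fsz (k + l)) ^ 2
      ≤ 1 * (|f k l| / (1 + esq (k + l))) * (8 * (1 + esq (k + l))) := by gcongr
    _ = 8 * |f k l| := by field_simp
    _ ≤ 8 * (B * ((1 + fsz k) ^ 2 * (1 + fsz l) ^ 2)) := by linarith [hf k l]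
    _ = _ := by ring

lemma abs_sum_mul_le (k l : Sp 3) : |∑ r, k r * l r| ≤ fsz k * fsz l := by
  refine (Finset.abs_sum_le_sum_abs _ _).trans ?_
  unfold fsz
  rw [Finset.sum_mul]
  refine Finset.sum_le_sum fun i _ => ?_
  rw [abs_mul]
  exact mul_le_mul_of_nonneg_left (abs_apply_le_fsz l i) (abs_nonneg _)

lemma nR_bound (j : Fin 4) (k l : Sp 3) :
    |(esq k * l j + esq l * k j) / 2| ≤ 5 * ((1 + fsz k) ^ 2 * (1 + fsz l) ^ 2) := by
  have h1 := esq_le k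
  have h2 := esq_le l
  have h3 := esq_nonneg k
  have h4 := esq_nonneg l
  have h5 := fsz_nonneg k
  have h6 := fsz_nonneg l
  have h7 := abs_apply_le_fsz k j
  have h8 := abs_apply_le_fsz l j
  have a1 : |esq k * l j| ≤ (1 + fsz k) ^ 2 * (1 + fsz l) ^ 2 := by
    rw [abs_mul, abs_of_nonneg h3]
    refine mul_le_mul (by nlinarith) (by nlinarith) (abs_nonneg _) (by positivity)
  have a2 : |esq l * k j| ≤ (1 + fsz k) ^ 2 * (1 + fsz l) ^ 2 := by
    rw [abs_mul, abs_of_nonneg h4, mul_comm]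
    refine mul_le_mul (by nlinarith) (by nlinarith) h4 (by positivity)
  rw [abs_div, abs_two]
  have := abs_add_le (esq k * l j) (esq l * k j)
  have : 0 ≤ (1 + fsz k) ^ 2 * (1 + fsz l) ^ 2 := by positivity
  linarith

lemma mR_bound (i j : Fin 4) (k l : Sp 3) :
    |l i * l j * esq k + k i * k j * esq l
      - (k i * l j + k j * l i) * (2 * (∑ r, k r * l r) + 1) / 2|
      ≤ 5 * ((1 + fsz k) ^ 2 * (1 + fsz l) ^ 2) := by
  have h1 := esq_le k
  have h2 := esq_le l
  have h3 := esq_nonneg k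
  have h4 := esq_nonneg l
  have h5 := fsz_nonneg k
  have h6 := fsz_nonneg l
  set K := fsz k
  set L := fsz l
  have hk := abs_apply_le_fsz k
  have hl := abs_apply_le_fsz l
  have a1 : |l i * l j * esq k| ≤ L * L * K ^ 2 := by
    rw [abs_mul, abs_mul, abs_of_nonneg h3]
    have := hl i; have := hl j
    gcongr
  have a2 : |k i * k j * esq l| ≤ K * K * L ^ 2 := by
    rw [abs_mul, abs_mul, abs_of_nonneg h4]
    have := hk i; have := hk j
    gcongr
  have a3 : |(k i * l j + k j * l i) * (2 * (∑ r, k r * l r) + 1) / 2|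
      ≤ (K * L + K * L) * (2 * (K * L) + 1) / 2 := by
    rw [abs_div, abs_mul, abs_two]
    have b1 : |k i * l j + k j * l i| ≤ K * L + K * L := by
      refine (abs_add_le _ _).trans ?_
      rw [abs_mul, abs_mul]
      have := hl i; have := hl j; have := hk i; have := hk j
      gcongr
    have b2 : |2 * (∑ r, k r * l r) + 1| ≤ 2 * (K * L) + 1 := by
      refine (abs_add_le _ _).trans ?_
      rw [abs_mul, abs_two, abs_one]
      have := abs_sum_mul_le k l
      linarith
    gcongr
  have h7 := abs_sub (l i * l j * esq k + k i * k j * esq l)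
    ((k i * l j + k j * l i) * (2 * (∑ r, k r * l r) + 1) / 2)
  have h8 := abs_add_le (l i * l j * esq k) (k i * k j * esq l)
  refine h7.trans ?_
  have hKL : 0 ≤ K * L := mul_nonneg h5 h6
  have : (1 + K) ^ 2 * (1 + L) ^ 2 = ((1 + K) * (1 + L)) ^ 2 := by ring
  have h9 : K * L + 1 ≤ (1 + K) * (1 + L) := by nlinarith
  nlinarith [mul_self_nonneg (K * L), pow_le_pow_left₀ (by positivity) h9 2]

lemma nR_adm (j : Fin 4) {w : ℂ} (hw : ‖w‖ ≤ 1) :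
    Adm (fun k l => w * ((nR j k l : ℝ) : ℂ)) 40 := by
  have h := adm_of_bound (nR_bound j) hw
  have e : ∀ k l, nR j k l = (esq k * l j + esq l * k j) / 2 / (1 + esq (k + l)) := fun k l => by
    unfold nR; ring
  rw [show (8 * 5 : ℝ) = 40 by norm_num] at h
  simpa only [e] using h

lemma mR_adm (i j : Fin 4) {w : ℂ} (hw : ‖w‖ ≤ 1) :
    Adm (fun k l => w * ((mR i j k l : ℝ) : ℂ)) 40 := by
  have h := adm_of_bound (mR_bound i j) hw
  rwa [show (8 * 5 : ℝ) = 40 by norm_num] at h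

lemma esq_neg (ξ : Sp 3) : esq (-ξ) = esq ξ := by simp [esq]

lemma nR_neg (j : Fin 4) (k l : Sp 3) : nR j (-k) (-l) = -nR j k l := by
  unfold nR
  rw [← neg_add, esq_neg, esq_neg, esq_neg]
  simp only [Pi.neg_apply]; ring

lemma mR_neg (i j : Fin 4) (k l : Sp 3) : mR i j (-k) (-l) = mR i j k l := by
  unfold mR
  rw [← neg_add, esq_neg, esq_neg, esq_neg]
  simp only [Pi.neg_apply, neg_mul_neg]

lemma esq_add (k l : Sp 3) : esq (k + l) = esq k + esq l + 2 * ∑ r, k r * l r := by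
  simp only [esq, Pi.add_apply, Finset.mul_sum, ← Finset.sum_add_distrib]
  exact Finset.sum_congr rfl fun i _ => by ring

/-- Günther's identity on the level of symbols. -/
lemma symbol_identity (i j : Fin 4) (k l : Sp 3) :
    -((k + l) i * nR j k l) - (k + l) j * nR i k l + mR i j k l
      = -(k i * l j + l i * k j) / 2 := by
  have hp : 0 < 1 + esq (k + l) := by have := esq_nonneg (k + l); linarith
  unfold nR mR
  simp only [Pi.add_apply]
  field_simp
  rw [esq_add]
  ring

/-- Real functions which are exponential sums with rapidly decreasing coefficients of base norm at
most `C`. -/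
def Wien (f : Sp 3 → ℝ) (C : ℝ) : Prop :=
  ∃ c, Rapid c ∧ RealC c ∧ wnorm c ≤ C ∧ ∀ y, (f y : ℂ) = esum id c y

/-- Index set for the unknowns and the equations: zeroth, first and second order rows. -/
abbrev Idx := Unit ⊕ Fin 4 ⊕ Fin 4 × Fin 4

/-- The symbols of the quadratic terms. -/
def gsym (κ : ℝ) : Idx → Sp 3 → Sp 3 → ℂ
  | .inl _ => fun _ _ => ((-κ / 2 : ℝ) : ℂ)
  | .inr (.inl j) => fun k l => -Complex.I * ((nR j k l : ℝ) : ℂ)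
  | .inr (.inr p) => fun k l => (1 / 2 : ℂ) * ((mR p.1 p.2 k l : ℝ) : ℂ)

lemma gsym_adm {κ : ℝ} (h0 : 0 ≤ κ) (h1 : κ ≤ 1) (i : Idx) : Adm (gsym κ i) 40 := by
  rcases i with _ | j | p
  · intro k l
    have := adm_one k l
    rw [norm_one, one_mul, one_mul] at this
    have hk : ‖((-κ / 2 : ℝ) : ℂ)‖ ≤ 1 := by
      rw [Complex.norm_real, Real.norm_eq_abs, abs_le]; constructor <;> linarith
    have h2 : 0 ≤ (1 + fsz (k + l)) ^ 2 := sq_nonneg _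
    calc _ ≤ 1 * (1 + fsz (k + l)) ^ 2 := mul_le_mul_of_nonneg_right hk h2
      _ ≤ _ := by linarith
  · exact nR_adm j (by simp)
  · exact mR_adm p.1 p.2 (by norm_num)

lemma gsym_conj (κ : ℝ) (i : Idx) (k l : Sp 3) :
    gsym κ i (-k) (-l) = (starRingEnd ℂ) (gsym κ i k l) := by
  rcases i with _ | j | p
  · exact (Complex.conj_ofReal _).symm
  · simp [gsym, nR_neg]
  · simp [gsym, mR_neg, map_ofNat (starRingEnd ℂ) 2]

lemma re_mul_re_of_real {c c' : Sp 3 → ℂ} (hr : RealC c) (hr' : RealC c') (y : Sp 3) :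
    (esum id c y).re * (esum id c' y).re = (esum id c y * esum id c' y).re := by
  rw [esum_eq_re hr, esum_eq_re hr', ← Complex.ofReal_mul]; simp only [Complex.ofReal_re]

/-- Coefficients of the quadratic expression with symbol `m`. -/
def qcoef (m : Sp 3 → Sp 3 → ℂ) (c : Sp 3 → ℂ) (p : Sp 3 × Sp 3) : ℂ :=
  m p.1 p.2 * c p.1 * c p.2

/-- The sum map of pairs of frequencies. -/
def psum (p : Sp 3 × Sp 3) : Sp 3 := p.1 + p.2

lemma rapidT_qcoef {c : Sp 3 → ℂ} (hc : Rapid c) {m : Sp 3 → Sp 3 → ℂ} {β : ℝ}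
    (hm : Adm m β) : RapidT psum (qcoef m c) := rapidT_pair hc hc hm

/-- Günther's identity for a single function. -/
lemma deriv_mul_deriv_eq {c : Sp 3 → ℂ} (hc : Rapid c) (hr : RealC c) (i j : Fin 4) (y : Sp 3) :
    (esum id (dcoef id i c) y).re * (esum id (dcoef id j c) y).re
      = (esum psum (dcoef psum i (qcoef (fun k l => Complex.I * (nR j k l : ℂ)) c)) y).re
        + (esum psum (dcoef psum j (qcoef (fun k l => Complex.I * (nR i k l : ℂ)) c)) y).re
        + (esum psum (qcoef (fun k l => 1 * (mR i j k l : ℂ)) c) y).re := by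
  rw [re_mul_re_of_real (hr.dcoef i) (hr.dcoef j), ← Complex.add_re, ← Complex.add_re]
  congr 1
  have hd : ∀ i, Rapid (dcoef id i c) := fun i => hc.rapidT.dcoef i
  have r1 := ((rapidT_qcoef hc (nR_adm j (w := Complex.I) (by simp))).dcoef i).summable y
  have r2 := ((rapidT_qcoef hc (nR_adm i (w := Complex.I) (by simp))).dcoef j).summable y
  have r3 := (rapidT_qcoef hc (mR_adm i j (w := 1) (by simp))).summable y
  have hs := (rapidT_pair (hd i) (hd j) adm_one).summable y
  simp only [one_mul] at hs
  have hswap := (Equiv.prodComm (Sp 3) (Sp 3)).summable_iff.mpr hs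
  rw [esum_mul_esum (hd i) (hd j)]
  unfold esum
  rw [← r1.tsum_add r2, ← (r1.add r2).tsum_add r3]
  have e1 : ∑' p : Sp 3 × Sp 3, dcoef id i c p.1 * dcoef id j c p.2 * ech (p.1 + p.2) y
      = ∑' p : Sp 3 × Sp 3, (dcoef id i c p.1 * dcoef id j c p.2 * ech (p.1 + p.2) y
        + dcoef id i c p.2 * dcoef id j c p.1 * ech (p.2 + p.1) y) / 2 := by
    have e2 := (Equiv.prodComm (Sp 3) (Sp 3)).tsum_eq
      (fun p : Sp 3 × Sp 3 => dcoef id i c p.1 * dcoef id j c p.2 * ech (p.1 + p.2) y)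
    have e3 := hs.tsum_add hswap
    simp only [Function.comp_def, Equiv.prodComm_apply, Prod.fst_swap, Prod.snd_swap] at e2 e3
    rw [tsum_div_const, e3, e2]; ring
  rw [e1]
  refine tsum_congr fun p => ?_
  have hsym : ((-((p.1 + p.2) i * nR j p.1 p.2) - (p.1 + p.2) j * nR i p.1 p.2
      + mR i j p.1 p.2 : ℝ) : ℂ) = ((-(p.1 i * p.2 j + p.2 i * p.1 j) / 2 : ℝ) : ℂ) := by
    rw [symbol_identity]
  push_cast at hsym
  rw [add_comm p.2 p.1]
  simp only [dcoef, qcoef, psum, id]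
  linear_combination -(c p.1 * c p.2 * ech (p.1 + p.2) y) * hsym
    + (c p.1 * c p.2 * ech (p.1 + p.2) y) * ((p.1 i * p.2 j + p.2 i * p.1 j) / 2
      - (p.1 + p.2) i * nR j p.1 p.2 - (p.1 + p.2) j * nR i p.1 p.2) * Complex.I_sq

/-- Günther's perturbation theorem in the Wiener algebra. -/
theorem gunther (A : Type*) [Fintype A] (C : ℝ) (hC : 0 < C) :
    ∃ ε > 0, ∀ (κ : ℝ) (E : A → Idx → Sp 3 → ℝ) (D : Idx → Idx → Sp 3 → ℝ) (e : Idx → Sp 3 → ℝ),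
      0 ≤ κ → κ ≤ 1 → (∀ a j, Wien (E a j) C) → (∀ i j, Wien (D i j) ε) → (∀ i, Wien (e i) ε) →
      ∃ (z : Idx → Sp 3 → ℝ) (v : A → Sp 3 → ℝ) (N : Fin 4 → Sp 3 → ℝ)
        (Q : Fin 4 → Fin 4 → Sp 3 → ℝ),
        (∀ i, ContDiff ℝ (⊤ : ℕ∞) (z i)) ∧ (∀ a, ContDiff ℝ (⊤ : ℕ∞) (v a)) ∧
        (∀ j, ContDiff ℝ (⊤ : ℕ∞) (N j)) ∧
        (∀ a y, v a y = ∑ j, E a j y * z j y) ∧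
        (∀ y, z (.inl ()) y + ∑ j, D (.inl ()) j y * z j y
          = e (.inl ()) y - κ / 2 * ∑ a, v a y ^ 2) ∧
        (∀ i y, z (.inr (.inl i)) y + ∑ j, D (.inr (.inl i)) j y * z j y
          = e (.inr (.inl i)) y - N i y) ∧
        (∀ i j y, z (.inr (.inr (i, j))) y + ∑ r, D (.inr (.inr (i, j))) r y * z r y
          = e (.inr (.inr (i, j))) y + 1 / 2 * Q i j y) ∧
        (∀ i j y, ∑ a, pd i (v a) y * pd j (v a) y
          = pd i (N j) y + pd j (N i) y + Q i j y) := by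
  obtain ⟨ε, hε, H⟩ := wiener_quadratic_solve A Idx 40 C (by norm_num) hC
  refine ⟨ε, hε, fun κ E D e hκ0 hκ1 hE hD he => ?_⟩
  choose cE qE rE nE sE using hE
  choose cD qD rD nD sD using hD
  choose ce qe re ne se using he
  obtain ⟨z, qz, rz, qv, rv, hfix⟩ := H (gsym κ) cE cD ce (gsym_adm hκ0 hκ1) (gsym_conj κ)
    qE qD qe rE rD re nE nD ne
  set w := vv 0 0 (fun a j => toX 0 le_rfl (qE a j)) z with hw
  have evX : ∀ {c : Sp 3 → ℂ} (hc : Rapid c) (y : Sp 3), ev y (toX 0 le_rfl hc) = esum id c y :=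
    fun hc y => by rw [← esum_coef, coef_toX]
  have sz : ∀ i y, ev y (z i) = ((esum id (coef (z i)) y).re : ℂ) := fun i y =>
    esum_eq_re (rz i) y
  have sv : ∀ a y, esum id (coef (w a)) y = ∑ j, (E a j y : ℂ) * ((esum id (coef (z j)) y).re : ℂ) := by
    intro a y
    rw [esum_coef, hw, vv, map_sum]
    refine Finset.sum_congr rfl fun j _ => ?_
    rw [ev_bil_one, evX, sE, sz]
  have hqs : ∀ i a y, ev y (bil 0 0 (gsym κ i) (w a) (w a))
      = esum psum (qcoef (gsym κ i) (coef (w a))) y := fun i a y =>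
    (hasSum_ev_bil y (gsym_adm hκ0 hκ1 i) (w a) (w a)).tsum_eq.symm
  have row : ∀ i y, (esum id (coef (z i)) y).re + ∑ j, D i j y * (esum id (coef (z j)) y).re
      = e i y + ∑ a, (esum psum (qcoef (gsym κ i) (coef (w a))) y).re := by
    intro i y
    have h1 := congrArg (ev y) (congrFun hfix i)
    rw [quadMap, map_add, map_sub, map_sum, map_sum, evX, ← se] at h1
    simp only [ev_bil_one, evX, ← sD, sz, ← hw, hqs] at h1
    have h2 := congrArg Complex.re h1
    simp only [Complex.add_re, Complex.sub_re, Complex.re_sum, Complex.re_ofReal_mul,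
      Complex.ofReal_re] at h2
    linarith
  have hre : ∀ (m : Sp 3 → Sp 3 → ℂ) (t : ℝ) (a : A) (y : Sp 3),
      (esum psum (qcoef (fun k l => (t : ℂ) * m k l) (coef (w a))) y).re
        = t * (esum psum (qcoef m (coef (w a))) y).re := by
    intro m t a y
    rw [← Complex.re_ofReal_mul]
    unfold esum
    rw [← tsum_mul_left]
    congr 2; ext p; unfold qcoef; ring
  set N : Fin 4 → Sp 3 → ℝ := fun j y =>
    ∑ a, (esum psum (qcoef (fun k l => Complex.I * (nR j k l : ℂ)) (coef (w a))) y).re with hN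
  set Q : Fin 4 → Fin 4 → Sp 3 → ℝ := fun i j y =>
    ∑ a, (esum psum (qcoef (fun k l => 1 * (mR i j k l : ℂ)) (coef (w a))) y).re with hQ
  have rN : ∀ j a, RapidT psum (qcoef (fun k l => Complex.I * (nR j k l : ℂ)) (coef (w a))) :=
    fun j a => rapidT_qcoef (qv a) (nR_adm j (w := Complex.I) (by simp))
  refine ⟨fun i y => (esum id (coef (z i)) y).re, fun a y => (esum id (coef (w a)) y).re, N, Q,
    fun i => contDiff_re_esum (qz i).rapidT, fun a => contDiff_re_esum (qv a).rapidT, fun j => ?_,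
    fun a y => ?_, fun y => ?_, fun i y => ?_, fun i j y => ?_, fun i j y => ?_⟩
  · exact ContDiff.sum fun a _ => contDiff_re_esum (rN j a)
  · simp only [sv, Complex.re_sum, Complex.re_ofReal_mul, Complex.ofReal_re]
  · rw [row, sub_eq_add_neg, Finset.mul_sum, ← Finset.sum_neg_distrib]
    congr 1
    refine Finset.sum_congr rfl fun a _ => ?_
    have : gsym κ (.inl ()) = fun _ _ => ((-κ / 2 : ℝ) : ℂ) * (fun _ _ => 1 : Sp 3 → Sp 3 → ℂ) 0 0 := by
      ext; simp [gsym]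
    rw [this, hre (fun _ _ => 1), sq, re_mul_re_of_real (rv a) (rv a), esum_mul_esum (qv a) (qv a)]
    have hq : qcoef (fun _ _ => 1) (coef (w a)) = fun p => coef (w a) p.1 * coef (w a) p.2 := by
      ext p; simp [qcoef]
    have hp : psum = fun p => p.1 + p.2 := rfl
    rw [hq, hp]
    ring
  · rw [row, sub_eq_add_neg, hN, ← Finset.sum_neg_distrib]
    congr 1
    refine Finset.sum_congr rfl fun a _ => ?_
    have := hre (fun k l => Complex.I * (nR i k l : ℂ)) (-1) a y
    rw [neg_one_mul] at this
    rw [← this]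
    simp [gsym]
  · rw [row, hQ, Finset.mul_sum]
    congr 1
    refine Finset.sum_congr rfl fun a _ => ?_
    have := hre (fun k l => 1 * (mR i j k l : ℂ)) (1 / 2) a y
    rw [← this]
    simp [gsym]
  · have pN : ∀ i j, pd i (N j) y = ∑ a, (esum psum (dcoef psum i
        (qcoef (fun k l => Complex.I * (nR j k l : ℂ)) (coef (w a)))) y).re := fun i j => by
      have h : ∀ a ∈ Finset.univ, DifferentiableAt ℝ (fun y => (esum psum
          (qcoef (fun k l => Complex.I * (nR j k l : ℂ)) (coef (w a))) y).re) y := fun a _ =>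
        ((contDiff_re_esum (rN j a)).differentiable (by simp)).differentiableAt
      simp only [← pd_re_esum (rN j _), hN]
      unfold pd
      rw [fderiv_fun_sum h, _root_.sum_apply]
    rw [pN, pN, hQ, ← Finset.sum_add_distrib, ← Finset.sum_add_distrib]
    refine Finset.sum_congr rfl fun a _ => ?_
    rw [pd_re_esum (qv a).rapidT, pd_re_esum (qv a).rapidT]
    exact deriv_mul_deriv_eq (qv a) (rv a) i j y

/-! ### Closure properties of the Wiener class -/

lemma wnorm_nonneg {c : Sp 3 → ℂ} : 0 ≤ wnorm c :=
  tsum_nonneg fun ξ => by have := fsz_nonneg ξ; positivity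

lemma Wien.nonneg {f : Sp 3 → ℝ} {C : ℝ} (h : Wien f C) : 0 ≤ C := by
  obtain ⟨c, -, -, hn, -⟩ := h
  exact wnorm_nonneg.trans hn

lemma Wien.mono {f : Sp 3 → ℝ} {C C' : ℝ} (h : Wien f C) (hC : C ≤ C') : Wien f C' := by
  obtain ⟨c, h1, h2, h3, h4⟩ := h
  exact ⟨c, h1, h2, h3.trans hC, h4⟩

lemma Wien.add {f g : Sp 3 → ℝ} {C C' : ℝ} (hf : Wien f C) (hg : Wien g C') :
    Wien (fun y => f y + g y) (C + C') := by
  obtain ⟨c, q, r, n, s⟩ := hf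
  obtain ⟨c', q', r', n', s'⟩ := hg
  have hb : ∀ (t : ℕ) (ξ : Sp 3), (1 + fsz ξ) ^ t * ‖(c + c') ξ‖
      ≤ (1 + fsz ξ) ^ t * ‖c ξ‖ + (1 + fsz ξ) ^ t * ‖c' ξ‖ := fun t ξ => by
    have := fsz_nonneg ξ
    rw [← mul_add]
    exact mul_le_mul_of_nonneg_left (norm_add_le _ _) (by positivity)
  have hq : Rapid (c + c') := fun t =>
    Summable.of_nonneg_of_le (fun ξ => by have := fsz_nonneg ξ; positivity) (hb t)
      ((q t).add (q' t))
  refine ⟨c + c', hq, fun ξ => ?_, ?_, fun y => ?_⟩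
  · simp [r ξ, r' ξ]
  · refine le_trans ?_ (add_le_add n n')
    unfold wnorm
    rw [← (q 2).tsum_add (q' 2)]
    exact (hq 2).tsum_le_tsum (hb 2) ((q 2).add (q' 2))
  · rw [Complex.ofReal_add, s, s']
    unfold esum
    rw [← (q.rapidT.summable y).tsum_add (q'.rapidT.summable y)]
    congr 1; ext ξ; simp only [Pi.add_apply, id]; ring

lemma wnorm_coef (x : XX) : wnorm (coef x) = ‖x‖ := by
  rw [XX.norm_eq, wnorm]
  congr 1; ext ξ
  have h := wt_pos 0 (le_refl (0 : ℝ)) ξ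
  rw [coef, norm_div, Complex.norm_real, Real.norm_eq_abs, abs_of_pos h]
  have : wt 0 0 ξ = (1 + fsz ξ) ^ 2 := by simp [wt]
  rw [← this]; field_simp

lemma Wien.mul {f g : Sp 3 → ℝ} {C C' : ℝ} (hf : Wien f C) (hg : Wien g C') :
    Wien (fun y => f y * g y) (C * C') := by
  have hC := hf.nonneg
  obtain ⟨c, q, r, n, s⟩ := hf
  obtain ⟨c', q', r', n', s'⟩ := hg
  refine ⟨coef (bil 0 0 (fun _ _ => 1) (toX 0 le_rfl q) (toX 0 le_rfl q')),
    rapid_coef _ fun t => ?_, realC_coef ?_, ?_, fun y => ?_⟩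
  · refine ⟨1, one_pos, le_rfl, bil t 1 (fun _ _ => 1) (toX t zero_le_one q) (toX t zero_le_one q'), ?_⟩
    rw [incX_bil _ adm_one, incX_toX, incX_toX]
  · rw [conjX_bil le_rfl adm_one (by simp), conjX_toX _ _ _ r, conjX_toX _ _ _ r']
  · rw [wnorm_coef]
    refine (norm_bil_le le_rfl adm_one _ _).trans ?_
    rw [norm_toX_zero, norm_toX_zero, one_mul]
    exact mul_le_mul n n' wnorm_nonneg hC
  · rw [esum_coef, ev_bil_one, ← esum_coef, ← esum_coef, coef_toX, coef_toX, Complex.ofReal_mul,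
      s, s']

lemma rapid_of_finite {c : Sp 3 → ℂ} (s : Finset (Sp 3)) (h : ∀ ξ ∉ s, c ξ = 0) : Rapid c :=
  fun t => summable_of_ne_finset_zero (s := s) fun ξ hξ => by simp [h ξ hξ]

lemma wien_single (ℓ : Sp 3) (w : ℂ) :
    ∃ C, Wien (fun y => 2 * (w * ech ℓ y).re) C := by
  classical
  set c1 : Sp 3 → ℂ := Pi.single ℓ w
  set c2 : Sp 3 → ℂ := Pi.single (-ℓ) ((starRingEnd ℂ) w)
  have q : ∀ (ξ : Sp 3) (a : ℂ), Rapid (Pi.single ξ a) := fun ξ a =>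
    rapid_of_finite {ξ} fun ζ hζ => by
      rw [Finset.mem_singleton] at hζ; simp [hζ]
  have e : ∀ (ξ : Sp 3) (a : ℂ) y, esum id (Pi.single ξ a) y = a * ech ξ y := fun ξ a y => by
    unfold esum
    rw [tsum_eq_single ξ]
    · simp
    · intro ζ hζ; simp [hζ]
  have q12 : Rapid (c1 + c2) := rapid_of_finite {ℓ, -ℓ} fun ζ hζ => by
    simp only [Finset.mem_insert, Finset.mem_singleton, not_or] at hζ
    simp [c1, c2, hζ.1, hζ.2]
  refine ⟨_, c1 + c2, q12, fun ξ => ?_, le_rfl, fun y => ?_⟩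
  · have h : ∀ (ζ : Sp 3) (a : ℂ), (Pi.single ζ a : Sp 3 → ℂ) (-ξ) = (Pi.single (-ζ) a : Sp 3 → ℂ) ξ :=
      fun ζ a => by
        by_cases hh : ξ = -ζ
        · subst hh; simp
        · have : -ξ ≠ ζ := fun h2 => hh (by rw [← h2, neg_neg])
          simp [hh, this]
    have h' : ∀ (ζ : Sp 3) (a : ℂ), (starRingEnd ℂ) ((Pi.single ζ a : Sp 3 → ℂ) ξ)
        = (Pi.single ζ ((starRingEnd ℂ) a) : Sp 3 → ℂ) ξ := fun ζ a => by
      by_cases hh : ξ = ζ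
      · subst hh; simp
      · simp [hh]
    simp only [c1, c2, Pi.add_apply, map_add, h, h', neg_neg, Complex.conj_conj]
    ring
  · have : esum id (c1 + c2) y = esum id c1 y + esum id c2 y := by
      unfold esum
      rw [← ((q _ _).rapidT.summable y).tsum_add ((q _ _).rapidT.summable y)]
      congr 1; ext ξ; simp only [Pi.add_apply, id, c1, c2]; ring
    rw [this, e, e, ech_neg, ← map_mul, Complex.add_conj]

lemma wien_const (r : ℝ) : ∃ C, Wien (fun _ => r) C := by
  obtain ⟨C, h⟩ := wien_single 0 ((r / 2 : ℝ) : ℂ)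
  refine ⟨C, ?_⟩
  convert h using 2
  simp only [ech_zero, mul_one, Complex.ofReal_re]; ring

lemma ech_re (ℓ y : Sp 3) : (ech ℓ y).re = Real.cos (∑ i, ℓ i * y i) := by
  rw [ech, mul_comm, Complex.exp_ofReal_mul_I_re]

lemma ech_im (ℓ y : Sp 3) : (ech ℓ y).im = Real.sin (∑ i, ℓ i * y i) := by
  rw [ech, mul_comm, Complex.exp_ofReal_mul_I_im]

lemma wien_cos (ℓ : Sp 3) : ∃ C, Wien (fun y => Real.cos (∑ i, ℓ i * y i)) C := by
  obtain ⟨C, h⟩ := wien_single ℓ ((1 / 2 : ℝ) : ℂ)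
  refine ⟨C, ?_⟩
  convert h using 2
  rw [Complex.re_ofReal_mul, ech_re]; ring

lemma wien_sin (ℓ : Sp 3) : ∃ C, Wien (fun y => Real.sin (∑ i, ℓ i * y i)) C := by
  obtain ⟨C, h⟩ := wien_single ℓ (((-1 / 2 : ℝ) : ℂ) * Complex.I)
  refine ⟨C, ?_⟩
  convert h using 2
  rw [mul_assoc, Complex.re_ofReal_mul, Complex.I_mul_re, ech_im]; ring

lemma Wien.dilate {f : Sp 3 → ℝ} {C : ℝ} (hf : Wien f C) {μ : ℝ} (h0 : 0 < μ) (h1 : μ ≤ 1) :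
    Wien (fun y => f (μ • y)) C := by
  obtain ⟨c, q, r, n, s⟩ := hf
  let σ : Sp 3 ≃ Sp 3 :=
    { toFun := fun ξ => μ • ξ, invFun := fun ξ => μ⁻¹ • ξ,
      left_inv := fun ξ => inv_smul_smul₀ h0.ne' ξ, right_inv := fun ξ => smul_inv_smul₀ h0.ne' ξ }
  have hσ : ∀ ξ, σ ξ = μ • ξ := fun _ => rfl
  have hf : ∀ ξ, fsz (σ ξ) ≤ fsz ξ := fun ξ => by
    rw [hσ]
    unfold fsz
    refine Finset.sum_le_sum fun i _ => ?_
    rw [Pi.smul_apply, smul_eq_mul, abs_mul, abs_of_pos h0]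
    exact mul_le_of_le_one_left (abs_nonneg _) h1
  have hb : ∀ (t : ℕ) ξ, (1 + fsz (σ ξ)) ^ t * ‖c ξ‖ ≤ (1 + fsz ξ) ^ t * ‖c ξ‖ := fun t ξ => by
    have h2 := fsz_nonneg (σ ξ)
    have h3 := hf ξ
    gcongr
  have hsum : ∀ t : ℕ, Summable fun ξ => (1 + fsz (σ ξ)) ^ t * ‖c ξ‖ := fun t =>
    Summable.of_nonneg_of_le (fun ξ => by have := fsz_nonneg (σ ξ); positivity) (hb t) (q t)
  refine ⟨fun ξ => c (σ.symm ξ), fun t => ?_, fun ξ => ?_, ?_, fun y => ?_⟩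
  · rw [← σ.summable_iff]
    simpa [Function.comp_def] using hsum t
  · have : σ.symm (-ξ) = -σ.symm ξ := smul_neg μ⁻¹ ξ
    simp only [this, r (σ.symm ξ)]
  · refine le_trans ?_ n
    unfold wnorm
    rw [← σ.tsum_eq]
    simp only [Equiv.symm_apply_apply]
    exact (hsum 2).tsum_le_tsum (hb 2) (q 2)
  · rw [s]
    unfold esum
    rw [← σ.tsum_eq fun ξ => c (σ.symm ξ) * ech (id ξ) y]
    refine tsum_congr fun ξ => ?_
    have hs : σ.symm (μ • ξ) = ξ := σ.symm_apply_apply ξ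
    have : ∀ i, ξ i * (μ * y i) = μ * ξ i * y i := fun i => by ring
    simp only [id, hσ, hs, ech, Pi.smul_apply, smul_eq_mul, this]

lemma Wien.const_mul {f : Sp 3 → ℝ} {C : ℝ} (hf : Wien f C) {μ : ℝ} (h0 : 0 ≤ μ) :
    Wien (fun y => μ * f y) (μ * C) := by
  obtain ⟨c, q, r, n, s⟩ := hf
  have hn : ∀ (t : ℕ) ξ, (1 + fsz ξ) ^ t * ‖(μ : ℂ) * c ξ‖ = μ * ((1 + fsz ξ) ^ t * ‖c ξ‖) :=
    fun t ξ => by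
      rw [norm_mul, Complex.norm_real, Real.norm_eq_abs, abs_of_nonneg h0]; ring
  refine ⟨fun ξ => (μ : ℂ) * c ξ, fun t => ?_, fun ξ => ?_, ?_, fun y => ?_⟩
  · simpa only [hn] using (q t).mul_left μ
  · simp only [r ξ, map_mul, Complex.conj_ofReal]
  · unfold wnorm
    simp only [hn, tsum_mul_left]
    exact mul_le_mul_of_nonneg_left n h0
  · rw [Complex.ofReal_mul, s]
    unfold esum
    simp only [mul_assoc, tsum_mul_left]

/-- Families of functions uniformly bounded in the Wiener algebra. -/
def UW (F : ℝ → Sp 3 → ℝ) : Prop := ∃ C, ∀ μ, 0 < μ → μ ≤ 1 → Wien (F μ) C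

namespace UW

variable {F G : ℝ → Sp 3 → ℝ}

lemma add (hF : UW F) (hG : UW G) : UW fun μ y => F μ y + G μ y := by
  obtain ⟨C, h⟩ := hF
  obtain ⟨C', h'⟩ := hG
  exact ⟨C + C', fun μ h0 h1 => (h μ h0 h1).add (h' μ h0 h1)⟩

lemma mul (hF : UW F) (hG : UW G) : UW fun μ y => F μ y * G μ y := by
  obtain ⟨C, h⟩ := hF
  obtain ⟨C', h'⟩ := hG
  exact ⟨C * C', fun μ h0 h1 => (h μ h0 h1).mul (h' μ h0 h1)⟩

lemma const (r : ℝ) : UW fun _ _ => r := by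
  obtain ⟨C, h⟩ := wien_const r
  exact ⟨C, fun _ _ _ => h⟩

lemma neg (hF : UW F) : UW fun μ y => -F μ y := by
  simpa using (const (-1)).mul hF

lemma sub (hF : UW F) (hG : UW G) : UW fun μ y => F μ y - G μ y := by
  simpa [sub_eq_add_neg] using hF.add hG.neg

lemma sum {ι : Type*} (s : Finset ι) {F : ι → ℝ → Sp 3 → ℝ} (hF : ∀ i ∈ s, UW (F i)) :
    UW fun μ y => ∑ i ∈ s, F i μ y := by
  classical
  induction s using Finset.induction_on with
  | empty => simpa using const 0
  | insert a s ha ih =>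
    simp only [Finset.sum_insert ha]
    exact (hF a (Finset.mem_insert_self a s)).add
      (ih fun i hi => hF i (Finset.mem_insert_of_mem hi))

lemma dil {f : Sp 3 → ℝ} {C : ℝ} (hf : Wien f C) : UW fun μ y => f (μ • y) :=
  ⟨C, fun _ h0 h1 => hf.dilate h0 h1⟩

lemma of_wien {f : Sp 3 → ℝ} (hf : ∃ C, Wien f C) : UW fun _ y => f y :=
  hf.imp fun _ h _ _ _ => h

lemma scale : UW fun μ _ => μ := by
  obtain ⟨C, h⟩ := wien_const 1
  exact ⟨C, fun μ h0 h1 => by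
    simpa using (h.const_mul h0.le).mono (mul_le_of_le_one_left h.nonneg h1)⟩

end UW

/-! ### Smooth functions agree near a compact set with functions of the Wiener class -/

lemma summable_inv_one_add_sq_int : Summable fun n : ℤ => (1 + (n : ℝ) ^ 2)⁻¹ := by
  have h := (Real.summable_one_div_int_pow (p := 2)).mpr one_lt_two
  refine Summable.of_norm_bounded_eventually h ?_
  rw [Filter.eventually_cofinite]
  refine (Set.finite_singleton (0 : ℤ)).subset fun n hn => ?_
  by_contra hne
  refine hn ?_
  have : 0 < (n : ℝ) ^ 2 := by
    have : (n : ℝ) ≠ 0 := by exact_mod_cast hne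
    positivity
  rw [Real.norm_eq_abs, abs_of_pos (by positivity), one_div]
  exact inv_anti₀ this (by linarith)

lemma summable_prod_inv : Summable fun n : Fin 4 → ℤ => ∏ i, (1 + (n i : ℝ) ^ 2)⁻¹ := by
  classical
  have h := summable_inv_one_add_sq_int
  refine summable_of_sum_le (c := (∑' n : ℤ, (1 + (n : ℝ) ^ 2)⁻¹) ^ 4)
    (fun n => Finset.prod_nonneg fun i _ => by positivity) fun s => ?_
  have hs : s ⊆ Fintype.piFinset fun i : Fin 4 => s.image fun n => n i := fun n hn =>
    Fintype.mem_piFinset.mpr fun i => Finset.mem_image_of_mem _ hn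
  refine (Finset.sum_le_sum_of_subset_of_nonneg hs fun n _ _ =>
    Finset.prod_nonneg fun i _ => by positivity).trans ?_
  rw [← Finset.prod_univ_sum (fun i : Fin 4 => s.image fun n => n i)
    (fun _ (k : ℤ) => (1 + (k : ℝ) ^ 2)⁻¹)]
  refine (Finset.prod_le_prod (fun i _ => Finset.sum_nonneg fun k _ => by positivity)
    fun i _ => h.sum_le_tsum _ fun k _ => by positivity).trans ?_
  simp

/-- The frequency `2π n`. -/
def freq (n : Fin 4 → ℤ) : Sp 3 := fun i => 2 * π * n i

lemma freq_injective : Function.Injective freq := fun n n' h => by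
  ext i
  have h' := congrFun h i
  unfold freq at h'
  have := mul_left_cancel₀ (by positivity) h'
  exact_mod_cast this

/-- Periodisation of a function supported in the unit cube. -/
def torusFun (f : Sp 3 → ℝ) (t : UnitAddTorus (Fin 4)) : ℂ :=
  (f fun i => (AddCircle.equivIco 1 (-1 / 2 : ℝ) (t i)).1 : ℝ)

lemma torusFun_coe {f : Sp 3 → ℝ} {x : Sp 3} (hx : ∀ i, x i ∈ Set.Ico (-1 / 2 : ℝ) (-1 / 2 + 1)) :
    torusFun f (fun i => (x i : UnitAddCircle)) = f x := by
  unfold torusFun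
  congr 2; ext i
  exact congrArg Subtype.val (AddCircle.equivIco_coe_eq (p := (1 : ℝ)) (hx i))

lemma unitAddCircle_norm_le (x : ℝ) : ‖(x : UnitAddCircle)‖ ≤ |x| := by
  rw [UnitAddCircle.norm_eq]
  simpa using round_le x 0

lemma continuous_torusFun {f : Sp 3 → ℝ} (hf : Continuous f)
    (h0 : ∀ x i, 1 / 4 < |x i| → f x = 0) : Continuous (torusFun f) := by
  rw [continuous_iff_continuousAt]
  intro t
  by_cases ht : ∀ i, t i ≠ ((-1 / 2 : ℝ) : UnitAddCircle)
  · refine Complex.continuous_ofReal.continuousAt.comp (hf.continuousAt.comp ?_)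
    rw [continuousAt_pi]
    intro i
    have h1 : ContinuousAt (fun s : UnitAddTorus (Fin 4) => s i) t := (continuous_apply i).continuousAt
    have h2 : ContinuousAt (AddCircle.equivIco (1 : ℝ) (-1 / 2 : ℝ)) (t i) :=
      AddCircle.continuousAt_equivIco (1 : ℝ) (-1 / 2 : ℝ) (ht i)
    exact continuous_subtype_val.continuousAt.comp
      (ContinuousAt.comp (f := fun s : UnitAddTorus (Fin 4) => s i) h2 h1)
  · push Not at ht
    obtain ⟨i, hi⟩ := ht
    have ho : IsOpen {s : UnitAddTorus (Fin 4) | 1 / 4 < ‖s i‖} :=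
      isOpen_lt continuous_const (continuous_norm.comp (continuous_apply i))
    have hm : t ∈ {s : UnitAddTorus (Fin 4) | 1 / 4 < ‖s i‖} := by
      have h2 : ‖((-1 / 2 : ℝ) : UnitAddCircle)‖ = 1 / 2 := by
        have h3 : ((-1 / 2 : ℝ) : UnitAddCircle) = -((1 / 2 : ℝ) : UnitAddCircle) := by
          rw [← AddCircle.coe_neg]; congr 1; ring
        rw [h3, norm_neg]
        have h4 := AddCircle.norm_half_period_eq (p := (1 : ℝ))
        simpa using h4
      simp only [Set.mem_ofPred_eq, hi, h2]; norm_num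
    refine (continuousAt_const (y := (0 : ℂ))).congr ?_
    filter_upwards [ho.mem_nhds hm] with s hs
    unfold torusFun
    rw [h0 _ i]
    · simp
    · refine lt_of_lt_of_le hs ?_
      have := unitAddCircle_norm_le (AddCircle.equivIco 1 (-1 / 2 : ℝ) (s i)).1
      rwa [AddCircle.coe_equivIco] at this

lemma mFourier_coe (n : Fin 4 → ℤ) (x : Sp 3) :
    UnitAddTorus.mFourier n (fun i => (x i : UnitAddCircle)) = ech (freq n) x := by
  simp only [UnitAddTorus.mFourier, ContinuousMap.coe_mk, fourier_coe_apply, ← Complex.exp_sum, ech,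
    freq]
  congr 1
  push_cast
  rw [Finset.mul_sum]
  exact Finset.sum_congr rfl fun i _ => by ring

lemma mFourierCoeff_torusFun {f : Sp 3 → ℝ} (h0 : ∀ x i, 1 / 4 < |x i| → f x = 0)
    (n : Fin 4 → ℤ) :
    UnitAddTorus.mFourierCoeff (torusFun f) n = ∫ x : Sp 3, ech (freq (-n)) x * (f x : ℂ) := by
  rw [UnitAddTorus.mFourierCoeff_eq_integral _ _ (fun _ => (-1 / 2 : ℝ))]
  rw [← setIntegral_eq_integral_of_forall_compl_eq_zero
    (s := {x : Sp 3 | ∀ i, x i ∈ Set.Ioc (-1 / 2 : ℝ) (-1 / 2 + 1)})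
    (f := fun x : Sp 3 => ech (freq (-n)) x * (f x : ℂ))]
  · refine setIntegral_congr_fun ?_ fun x hx => ?_
    · have : {x : Sp 3 | ∀ i, x i ∈ Set.Ioc (-1 / 2 : ℝ) (-1 / 2 + 1)}
          = Set.pi Set.univ fun _ => Set.Ioc (-1 / 2 : ℝ) (-1 / 2 + 1) := by
        ext x; simp
      rw [this]
      exact MeasurableSet.univ_pi fun _ => measurableSet_Ioc
    · simp only [mFourier_coe, smul_eq_mul]
      congr 1
      by_cases hx' : ∀ i, x i ∈ Set.Ico (-1 / 2 : ℝ) (-1 / 2 + 1)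
      · exact torusFun_coe hx'
      · push Not at hx'
        obtain ⟨i, hi⟩ := hx'
        have hxi : x i = 1 / 2 := by
          have h1 := hx i
          simp only [Set.mem_Ioc, Set.mem_Ico, not_and_or, not_le, not_lt] at h1 hi
          rcases hi with h | h <;> linarith [h1.1, h1.2]
        rw [h0 x i (by rw [hxi, abs_of_pos] <;> norm_num)]
        unfold torusFun
        rw [h0 _ i]
        simp only [hxi]
        have h3 : ((1 / 2 : ℝ) : UnitAddCircle) = ((-1 / 2 : ℝ) : UnitAddCircle) := by
          rw [← AddCircle.coe_add_period (1 : ℝ) (-1 / 2 : ℝ)]; norm_num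
        rw [h3, AddCircle.equivIco_coe_eq (p := (1 : ℝ)) (by norm_num)]
        simp only
        rw [abs_of_neg] <;> norm_num
  · intro x hx
    simp only [Set.mem_ofPred_eq, not_forall, Set.mem_Ioc, not_and_or, not_lt, not_le] at hx
    obtain ⟨i, hi⟩ := hx
    rw [h0 x i]
    · simp
    · rw [lt_abs]
      rcases hi with h | h
      · right; linarith
      · left; linarith

lemma fourier_coeff_eq {f : Sp 3 → ℝ} (n : Fin 4 → ℤ) :
    ∫ x : Sp 3, ech (freq (-n)) x * (f x : ℂ)
      = FourierTransform.fourier (fun v : EuclideanSpace ℝ (Fin 4) => ((f (v.ofLp) : ℝ) : ℂ))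
        (WithLp.toLp 2 fun i => (n i : ℝ)) := by
  rw [Real.fourier_eq', ← (EuclideanSpace.volume_preserving_symm_measurableEquiv_toLp
    (Fin 4)).integral_comp (MeasurableEquiv.measurableEmbedding _)]
  refine integral_congr_ae (Filter.Eventually.of_forall fun v => ?_)
  simp only [smul_eq_mul, ech, freq]
  congr 2
  simp [PiLp.inner_apply]
  rw [mul_comm, Finset.mul_sum]
  congr 1
  exact Finset.sum_congr rfl fun i _ => by ring

/-- The coefficients of an exponential sum with frequencies in `2πℤ⁴`. -/
def extCoeff (b : (Fin 4 → ℤ) → ℂ) : Sp 3 → ℂ := Function.extend freq b 0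

lemma extCoeff_freq (b : (Fin 4 → ℤ) → ℂ) (n) : extCoeff b (freq n) = b n :=
  freq_injective.extend_apply b 0 n

lemma extCoeff_of_notMem (b : (Fin 4 → ℤ) → ℂ) {ξ} (h : ξ ∉ Set.range freq) : extCoeff b ξ = 0 :=
  Function.extend_apply' _ _ _ fun ⟨n, hn⟩ => h ⟨n, hn⟩

lemma freq_neg (n : Fin 4 → ℤ) : freq (-n) = -freq n := by
  ext i; simp [freq]

lemma rapid_extCoeff {b : (Fin 4 → ℤ) → ℂ}
    (h : ∀ s : ℕ, ∃ C, ∀ n, (1 + fsz (freq n)) ^ s * ‖b n‖ ≤ C) : Rapid (extCoeff b) := by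
  intro s
  rw [← freq_injective.summable_iff]
  · obtain ⟨C, hC⟩ := h (s + 8)
    refine Summable.of_nonneg_of_le (fun n => ?_) (fun n => ?_) (summable_prod_inv.mul_left C)
    · have := fsz_nonneg (freq n)
      simp only [Function.comp_apply]; positivity
    · simp only [Function.comp_apply, extCoeff_freq]
      have h0 := fsz_nonneg (freq n)
      have h1 : ∀ i, 1 + (n i : ℝ) ^ 2 ≤ (1 + fsz (freq n)) ^ 2 := fun i => by
        have h2 : |(n i : ℝ)| ≤ fsz (freq n) := by
          refine le_trans ?_ (abs_apply_le_fsz (freq n) i)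
          unfold freq
          rw [abs_mul (2 * π), abs_of_pos (by positivity : 0 < 2 * π)]
          exact le_mul_of_one_le_left (abs_nonneg _) (by linarith [Real.pi_gt_three])
        have h3 := abs_nonneg (n i : ℝ)
        rw [← sq_abs]; nlinarith
      have h4 : ∏ i, (1 + (n i : ℝ) ^ 2) ≤ (1 + fsz (freq n)) ^ 8 := by
        refine (Finset.prod_le_prod (fun i _ => by positivity) fun i _ => h1 i).trans ?_
        simp [← pow_mul]
      have h5 : 0 < ∏ i, (1 + (n i : ℝ) ^ 2) := Finset.prod_pos fun i _ => by positivity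
      rw [Finset.prod_inv_distrib, ← div_eq_mul_inv, le_div_iff₀ h5]
      refine le_trans ?_ (hC n)
      calc (1 + fsz (freq n)) ^ s * ‖b n‖ * ∏ i, (1 + (n i : ℝ) ^ 2)
          ≤ (1 + fsz (freq n)) ^ s * ‖b n‖ * (1 + fsz (freq n)) ^ 8 := by gcongr
        _ = _ := by ring
  · intro ξ hξ
    simp [extCoeff_of_notMem b hξ]

lemma wien_of_coeff {b : (Fin 4 → ℤ) → ℂ}
    (h : ∀ s : ℕ, ∃ C, ∀ n, (1 + fsz (freq n)) ^ s * ‖b n‖ ≤ C)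
    (hr : ∀ n, b (-n) = (starRingEnd ℂ) (b n)) :
    ∃ C, Wien (fun y => (∑' n, b n * ech (freq n) y).re) C := by
  have hR := rapid_extCoeff h
  have hC : RealC (extCoeff b) := fun ξ => by
    by_cases hξ : ξ ∈ Set.range freq
    · obtain ⟨n, rfl⟩ := hξ
      rw [← freq_neg, extCoeff_freq, extCoeff_freq, hr]
    · rw [extCoeff_of_notMem b hξ, extCoeff_of_notMem, map_zero]
      rintro ⟨n, hn⟩
      exact hξ ⟨-n, by rw [freq_neg, hn, neg_neg]⟩
  refine ⟨_, extCoeff b, hR, hC, le_rfl, fun y => ?_⟩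
  have : esum id (extCoeff b) y = ∑' n, b n * ech (freq n) y := by
    unfold esum
    rw [← freq_injective.tsum_eq]
    · simp only [extCoeff_freq, id]
    · intro ξ hξ
      by_contra h2
      exact hξ (by simp [extCoeff_of_notMem b h2])
  simp only [← this]
  rw [← esum_eq_re hC]

lemma fourier_coeff_rapid {f : Sp 3 → ℝ} (hf : ContDiff ℝ (⊤ : ℕ∞) f)
    (h0 : ∀ x i, 1 / 4 < |x i| → f x = 0) (s : ℕ) :
    ∃ C, ∀ n : Fin 4 → ℤ, (1 + fsz (freq n)) ^ s
      * ‖UnitAddTorus.mFourierCoeff (torusFun f) n‖ ≤ C := by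
  set F : EuclideanSpace ℝ (Fin 4) → ℂ := fun v => ((f (v.ofLp) : ℝ) : ℂ) with hF
  have hFs : ContDiff ℝ (⊤ : ℕ∞) F :=
    Complex.ofRealCLM.contDiff.comp (hf.comp (PiLp.contDiff_ofLp))
  have hFc : HasCompactSupport F := by
    refine HasCompactSupport.intro (K := Metric.closedBall 0 1) (isCompact_closedBall _ _) ?_
    intro v hv
    simp only [Metric.mem_closedBall, dist_zero_right, not_le] at hv
    by_contra hne
    have hall : ∀ i, |v i| ≤ 1 / 4 := fun i => by
      by_contra hi
      exact hne (by simp only [hF, h0 v.ofLp i (not_le.mp hi), Complex.ofReal_zero])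
    have h1 : ‖v‖ ^ 2 ≤ 1 := by
      rw [EuclideanSpace.norm_sq_eq]
      calc ∑ i, ‖v i‖ ^ 2 ≤ ∑ i : Fin 4, (1 / 4 : ℝ) ^ 2 := by
            refine Finset.sum_le_sum fun i _ => ?_
            rw [Real.norm_eq_abs]
            exact pow_le_pow_left₀ (abs_nonneg _) (hall i) 2
        _ ≤ 1 := by norm_num
    nlinarith
  set G := FourierTransform.fourier (hFc.toSchwartzMap hFs)
  refine ⟨(8 * π) ^ s * (2 ^ s * ((Finset.Iic (s, 0)).sup fun m => SchwartzMap.seminorm ℝ m.1 m.2) G),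
    fun n => ?_⟩
  rw [mFourierCoeff_torusFun h0, fourier_coeff_eq]
  set w : EuclideanSpace ℝ (Fin 4) := WithLp.toLp 2 fun i => (n i : ℝ) with hw
  have h1 := SchwartzMap.one_add_le_sup_seminorm_apply (𝕜 := ℝ) (m := (s, 0)) (k := s) (n := 0)
    le_rfl le_rfl G w
  rw [norm_iteratedFDeriv_zero] at h1
  have h2 : G w = FourierTransform.fourier F w := rfl
  rw [← h2]
  have h3 : 1 + fsz (freq n) ≤ 8 * π * (1 + ‖w‖) := by
    have h4 : ∀ i, |freq n i| ≤ 2 * π * ‖w‖ := fun i => by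
      unfold freq
      rw [abs_mul, abs_of_pos (by positivity)]
      gcongr
      exact PiLp.norm_apply_le w i
    have h5 : fsz (freq n) ≤ 4 * (2 * π * ‖w‖) := by
      refine (Finset.sum_le_sum fun i _ => h4 i).trans ?_
      simp
    nlinarith [Real.pi_gt_three, norm_nonneg w]
  have h6 := fsz_nonneg (freq n)
  calc (1 + fsz (freq n)) ^ s * ‖G w‖ ≤ (8 * π * (1 + ‖w‖)) ^ s * ‖G w‖ := by gcongr
    _ = (8 * π) ^ s * ((1 + ‖w‖) ^ s * ‖G w‖) := by rw [mul_pow]; ring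
    _ ≤ _ := by gcongr

lemma exists_wien_cube {f : Sp 3 → ℝ} (hf : ContDiff ℝ (⊤ : ℕ∞) f)
    (h0 : ∀ x i, 1 / 4 < |x i| → f x = 0) :
    ∃ f' C, Wien f' C ∧ ∀ x : Sp 3, (∀ i, |x i| < 1 / 2) → f' x = f x := by
  have hr := fourier_coeff_rapid hf h0
  obtain ⟨C, hC⟩ := wien_of_coeff hr fun n => by
    rw [mFourierCoeff_torusFun h0, mFourierCoeff_torusFun h0, ← integral_conj]
    refine integral_congr_ae (Filter.Eventually.of_forall fun x => ?_)
    simp only [neg_neg, map_mul, Complex.conj_ofReal, freq_neg, ech_neg, Complex.conj_conj]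
  refine ⟨_, C, hC, fun x hx => ?_⟩
  set g : C(UnitAddTorus (Fin 4), ℂ) := ⟨torusFun f, continuous_torusFun hf.continuous h0⟩
  have hs : Summable (UnitAddTorus.mFourierCoeff g) := by
    have h1 : Summable fun n => UnitAddTorus.mFourierCoeff (torusFun f) n
        * ech (freq n) 0 := by
      have := (rapid_extCoeff hr).rapidT.summable 0
      refine ((freq_injective.summable_iff fun ξ hξ => ?_).mpr this).congr fun n => ?_
      · simp [extCoeff_of_notMem _ hξ]
      · simp [extCoeff_freq]
    refine h1.congr fun n => ?_
    simp [ech]; rfl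
  have h2 := UnitAddTorus.hasSum_mFourier_series_apply_of_summable hs
    (fun i => (x i : UnitAddCircle))
  have h3 : g (fun i => (x i : UnitAddCircle)) = f x := torusFun_coe fun i => by
    have := abs_lt.mp (hx i)
    exact ⟨by linarith, by linarith⟩
  rw [h3] at h2
  simp only [smul_eq_mul, mFourier_coe] at h2
  have h4 := h2.tsum_eq
  change (∑' n, UnitAddTorus.mFourierCoeff (torusFun f) n * ech (freq n) x).re = f x
  change (∑' n, UnitAddTorus.mFourierCoeff (torusFun f) n * ech (freq n) x) = f x at h4
  rw [h4, Complex.ofReal_re]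

/-- A smooth function agrees near a given compact set with a function of the Wiener class. -/
theorem exists_wien_eqOn {f : Sp 3 → ℝ} (hf : ContDiff ℝ (⊤ : ℕ∞) f) {K : Set (Sp 3)}
    (hK : IsCompact K) : ∃ f' C, Wien f' C ∧ ∃ U, IsOpen U ∧ K ⊆ U ∧ ∀ x ∈ U, f' x = f x := by
  obtain ⟨R, hR0, hR⟩ : ∃ R, 1 ≤ R ∧ K ⊆ Metric.ball (0 : Sp 3) R := by
    obtain ⟨R, hR⟩ := hK.isBounded.subset_ball (0 : Sp 3)
    exact ⟨max 1 R, le_max_left _ _, hR.trans (Metric.ball_subset_ball (le_max_right _ _))⟩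
  let χ : ContDiffBump (0 : Sp 3) := ⟨R, 2 * R, by linarith, by linarith⟩
  have hc : ContDiff ℝ (⊤ : ℕ∞) fun x : Sp 3 => χ ((8 * R) • x) * f ((8 * R) • x) :=
    (χ.contDiff.comp (contDiff_const_smul _)).mul (hf.comp (contDiff_const_smul _))
  obtain ⟨f', C, hW, hf'⟩ := exists_wien_cube hc fun x i hx => by
    rw [χ.zero_of_le_dist, zero_mul]
    rw [dist_zero_right, norm_smul, Real.norm_eq_abs, abs_of_pos (by linarith)]
    have h1 : 1 / 4 < ‖x‖ := hx.trans_le (norm_le_pi_norm x i)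
    change 2 * R ≤ _
    nlinarith
  have hpos : 0 < (8 * R)⁻¹ := by positivity
  refine ⟨_, C, hW.dilate hpos (inv_le_one_of_one_le₀ (by linarith)), Metric.ball 0 R,
    Metric.isOpen_ball, hR, fun x hx => ?_⟩
  rw [mem_ball_zero_iff] at hx
  rw [hf' _ fun i => ?_]
  · rw [smul_inv_smul₀ (by positivity), χ.one_of_mem_closedBall, one_mul]
    rw [mem_closedBall_zero_iff]
    exact hx.le
  · refine (norm_le_pi_norm ((8 * R)⁻¹ • x) i).trans_lt ?_
    rw [norm_smul, Real.norm_eq_abs, abs_of_pos hpos, inv_mul_lt_iff₀ (by positivity)]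
    linarith

/-! ### Calculus helpers -/

section calculus

variable {E : Type*} [NormedAddCommGroup E] [NormedSpace ℝ E]

lemma contDiff_pd {f : Sp 3 → E} (hf : ContDiff ℝ (⊤ : ℕ∞) f) (i : Fin 4) :
    ContDiff ℝ (⊤ : ℕ∞) (pd i f) :=
  (hf.fderiv_right (m := (⊤ : ℕ∞)) (by simp)).clm_apply contDiff_const

lemma ContDiffOn.pd {f : Sp 3 → E} {U : Set (Sp 3)} (hU : IsOpen U)
    (hf : ContDiffOn ℝ (⊤ : ℕ∞) f U) (i : Fin 4) :
    ContDiffOn ℝ (⊤ : ℕ∞) (pd i f) U :=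
  (hf.fderiv_of_isOpen hU (m := (⊤ : ℕ∞)) (by simp)).clm_apply contDiffOn_const

lemma smooth_differentiableAt {f : Sp 3 → E} (hf : ContDiff ℝ (⊤ : ℕ∞) f) (x : Sp 3) :
    DifferentiableAt ℝ f x := (hf.differentiable (by simp)) x

lemma pd_of_hasFDerivAt {f : Sp 3 → E} {f' : Sp 3 →L[ℝ] E} {x : Sp 3}
    (h : HasFDerivAt f f' x) (i : Fin 4) : pd i f x = f' (Pi.single i 1) := by
  unfold pd; rw [h.fderiv]

lemma pd_congr {f g : Sp 3 → E} {x : Sp 3} (h : f =ᶠ[nhds x] g) (i : Fin 4) :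
    pd i f x = pd i g x := by unfold pd; rw [h.fderiv_eq]

lemma pd_const (v : E) (i : Fin 4) (x : Sp 3) : pd i (fun _ => v) x = 0 := by
  unfold pd; simp

lemma pd_add {f g : Sp 3 → E} {x : Sp 3} (hf : DifferentiableAt ℝ f x)
    (hg : DifferentiableAt ℝ g x) (i : Fin 4) :
    pd i (fun y => f y + g y) x = pd i f x + pd i g x := by
  exact pd_of_hasFDerivAt (hf.hasFDerivAt.add hg.hasFDerivAt) i

lemma pd_smul {c : Sp 3 → ℝ} {f : Sp 3 → E} {x : Sp 3} (hc : DifferentiableAt ℝ c x)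
    (hf : DifferentiableAt ℝ f x) (i : Fin 4) :
    pd i (fun y => c y • f y) x = c x • pd i f x + pd i c x • f x := by
  exact pd_of_hasFDerivAt (hc.hasFDerivAt.smul hf.hasFDerivAt) i

lemma pd_mul {c f : Sp 3 → ℝ} {x : Sp 3} (hc : DifferentiableAt ℝ c x)
    (hf : DifferentiableAt ℝ f x) (i : Fin 4) :
    pd i (fun y => c y * f y) x = c x * pd i f x + pd i c x * f x := pd_smul hc hf i

lemma pd_const_smul (c : ℝ) {f : Sp 3 → E} {x : Sp 3}
    (hf : DifferentiableAt ℝ f x) (i : Fin 4) :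
    pd i (fun y => c • f y) x = c • pd i f x := by
  exact pd_of_hasFDerivAt (hf.hasFDerivAt.const_smul c) i

lemma pd_const_mul (c : ℝ) {f : Sp 3 → ℝ} {x : Sp 3}
    (hf : DifferentiableAt ℝ f x) (i : Fin 4) :
    pd i (fun y => c * f y) x = c * pd i f x := pd_const_smul c hf i

lemma pd_sum {ι : Type*} (s : Finset ι) {f : ι → Sp 3 → E} {x : Sp 3}
    (hf : ∀ k ∈ s, DifferentiableAt ℝ (f k) x) (i : Fin 4) :
    pd i (fun y => ∑ k ∈ s, f k y) x = ∑ k ∈ s, pd i (f k) x := by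
  have h := HasFDerivAt.fun_sum fun k hk => (hf k hk).hasFDerivAt
  rw [pd_of_hasFDerivAt h, _root_.sum_apply]; rfl

lemma pd_lin (ℓ : Sp 3) (τ : ℝ) (i : Fin 4) (x : Sp 3) :
    pd i (fun y => τ * ∑ j, ℓ j * y j) x = τ * ℓ i := by
  have h : HasFDerivAt (fun y : Sp 3 => τ * ∑ j, ℓ j * y j)
      (τ • ∑ j, ℓ j • (ContinuousLinearMap.proj (R := ℝ) (φ := fun _ : Fin 4 => ℝ) j)) x :=
    (HasFDerivAt.fun_sum fun j _ => (hasFDerivAt_apply j x).const_mul (ℓ j)).const_mul τ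
  rw [pd_of_hasFDerivAt h]
  simp [_root_.sum_apply, _root_.smul_apply, Pi.single_apply]

lemma pd_comp_real {φ : ℝ → ℝ} {φ' : ℝ} {c : Sp 3 → ℝ} {x : Sp 3} (hφ : HasDerivAt φ φ' (c x))
    (hc : DifferentiableAt ℝ c x) (i : Fin 4) :
    pd i (fun y => φ (c y)) x = φ' * pd i c x := by
  have h := hφ.comp_hasFDerivAt x hc.hasFDerivAt
  have h2 : pd i (fun y => φ (c y)) x = (φ' • fderiv ℝ c x) (Pi.single i 1) := pd_of_hasFDerivAt h i
  rw [h2]; rfl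

lemma pd_inner {F : Type*} [NormedAddCommGroup F] [InnerProductSpace ℝ F] {f g : Sp 3 → F}
    {x : Sp 3} (hf : DifferentiableAt ℝ f x) (hg : DifferentiableAt ℝ g x) (i : Fin 4) :
    pd i (fun y => ⟪f y, g y⟫) x = ⟪f x, pd i g x⟫ + ⟪pd i f x, g x⟫ := by
  unfold pd; rw [fderiv_inner_apply ℝ hf hg]

end calculus

open scoped Manifold ContDiff in
/-- A smooth function on a neighbourhood of a compact set agrees near that set with a globally
smooth function. -/
theorem exists_contDiff_eqOn {E : Type*} [NormedAddCommGroup E] [NormedSpace ℝ E]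
    {f : Sp 3 → E} {U K : Set (Sp 3)} (hU : IsOpen U) (hK : IsCompact K) (hKU : K ⊆ U)
    (hf : ContDiffOn ℝ (⊤ : ℕ∞) f U) :
    ∃ f' : Sp 3 → E, ContDiff ℝ (⊤ : ℕ∞) f' ∧
      ∃ V, IsOpen V ∧ K ⊆ V ∧ V ⊆ U ∧ ∀ x ∈ V, f' x = f x := by
  obtain ⟨χ, h0, h1, -⟩ := exists_contMDiffMap_zero_one_nhds_of_isClosed (M := Sp 3) (n := ⊤)
    𝓘(ℝ, Sp 3) hU.isClosed_compl hK.isClosed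
    (Set.disjoint_left.mpr fun x hx hxK => hx (hKU hxK))
  have hχ : ContDiff ℝ (⊤ : ℕ∞) χ := χ.contMDiff.contDiff
  refine ⟨fun x => χ x • f x, ?_, ?_⟩
  · rw [contDiff_iff_contDiffAt]
    intro x
    by_cases hx : x ∈ U
    · exact hχ.contDiffAt.smul (hf.contDiffAt (hU.mem_nhds hx))
    · have : ∀ᶠ y in nhds x, χ y = 0 := (eventually_nhdsSet_iff_forall.mp h0) x hx
      refine (contDiffAt_const (c := (0 : E))).congr_of_eventuallyEq ?_
      filter_upwards [this] with y hy
      rw [hy, zero_smul]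
  · obtain ⟨V, hV, hKV, h⟩ := eventually_nhdsSet_iff_exists.mp h1
    exact ⟨V ∩ U, hV.inter hU, fun x hx => ⟨hKV hx, hKU hx⟩, Set.inter_subset_right,
      fun x hx => by simp only [h x hx.1, one_smul]⟩

/-! ### Smooth normal fields -/

lemma contDiff_det {n : Type*} [Fintype n] [DecidableEq n] {G : Sp 3 → Matrix n n ℝ}
    (hG : ∀ i j, ContDiff ℝ (⊤ : ℕ∞) fun x => G x i j) :
    ContDiff ℝ (⊤ : ℕ∞) fun x => (G x).det := by
  simp only [Matrix.det_apply']
  exact ContDiff.sum fun σ _ => contDiff_const.mul (contDiff_prod fun i _ => hG _ _)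

lemma contDiff_adjugate {n : Type*} [Fintype n] [DecidableEq n] {G : Sp 3 → Matrix n n ℝ}
    (hG : ∀ i j, ContDiff ℝ (⊤ : ℕ∞) fun x => G x i j) (i j : n) :
    ContDiff ℝ (⊤ : ℕ∞) fun x => (G x).adjugate i j := by
  simp only [Matrix.adjugate_apply]
  refine contDiff_det fun k l => ?_
  simp only [Matrix.updateRow_apply]
  split_ifs
  · exact contDiff_const
  · exact hG k l

/-- A smooth field normal to given smooth fields, nonzero where these are independent. -/
lemma exists_normal {r q : ℕ} (h : 4 + r < q) (b : Fin r → Sp 3 → Em q)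
    (hb : ∀ k, ContDiff ℝ (⊤ : ℕ∞) (b k)) :
    ∃ ν : Sp 3 → Em q, ContDiff ℝ (⊤ : ℕ∞) ν ∧ (∀ x k, ⟪ν x, b k x⟫ = 0) ∧
      ∀ x, LinearIndependent ℝ (fun k => b k x) → ν x ≠ 0 := by
  have hΦ : ContDiff ℝ 1 fun p : Sp 3 × (Fin r → ℝ) => ∑ k, p.2 k • b k p.1 := by
    refine ContDiff.sum fun k _ => ?_
    have h1 : ContDiff ℝ 1 (b k) :=
      (hb k).of_le (by change ((1 : ℕ∞) : WithTop ℕ∞) ≤ _; exact WithTop.coe_le_coe.mpr le_top)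
    have h2 : ContDiff ℝ 1 fun p : Sp 3 × (Fin r → ℝ) => p.2 k :=
      (contDiff_apply ℝ ℝ k).comp contDiff_snd
    exact h2.smul (h1.comp contDiff_fst)
  obtain ⟨n, hn⟩ := (hΦ.dense_compl_range_of_finrank_lt_finrank (by simpa using h)).nonempty
  let G : Sp 3 → Matrix (Fin r) (Fin r) ℝ := fun x => Matrix.gram ℝ fun k => b k x
  have hG : ∀ i j, ContDiff ℝ (⊤ : ℕ∞) fun x => G x i j := fun i j => (hb i).inner ℝ (hb j)
  refine ⟨fun x => (G x).det • n - ∑ i, (∑ j, (G x).adjugate i j * ⟪b j x, n⟫) • b i x, ?_, ?_, ?_⟩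
  · refine ((contDiff_det hG).smul contDiff_const).sub (ContDiff.sum fun i _ => ?_)
    have h1 : ContDiff ℝ (⊤ : ℕ∞) fun x => ∑ j, (G x).adjugate i j * ⟪b j x, n⟫ :=
      ContDiff.sum fun j _ => (contDiff_adjugate hG i j).mul ((hb j).inner ℝ contDiff_const)
    exact h1.smul (hb i)
  · intro x k
    rw [inner_sub_left, real_inner_smul_left, sum_inner]
    simp only [real_inner_smul_left, Finset.sum_mul]
    rw [Finset.sum_comm]
    have h1 : ∀ j, ∑ i, (G x).adjugate i j * ⟪b j x, n⟫ * ⟪b i x, b k x⟫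
        = (G x).det * (if k = j then 1 else 0) * ⟪b j x, n⟫ := fun j => by
      have h2 := congrFun (congrFun (Matrix.mul_adjugate (G x)) k) j
      rw [Matrix.mul_apply, Matrix.smul_apply, Matrix.one_apply, smul_eq_mul] at h2
      rw [← h2, Finset.sum_mul]
      refine Finset.sum_congr rfl fun i _ => ?_
      change _ = ⟪b k x, b i x⟫ * _ * _
      rw [real_inner_comm (b k x)]; ring
    simp only [h1]
    simp [real_inner_comm n]
  · intro x hx h0
    have hdet : (G x).det ≠ 0 := (Matrix.posDef_gram_iff_linearIndependent.mpr hx).det_pos.ne'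
    refine hn ⟨(x, fun i => (G x).det⁻¹ * ∑ j, (G x).adjugate i j * ⟪b j x, n⟫), ?_⟩
    rw [sub_eq_zero] at h0
    simp only [mul_smul, ← Finset.smul_sum, ← h0]
    rw [inv_smul_smul₀ hdet]

lemma exists_normalize {q : ℕ} {ν : Sp 3 → Em q} (hν : ContDiff ℝ (⊤ : ℕ∞) ν) {a : Sp 3 → ℝ}
    (ha : ContDiff ℝ (⊤ : ℕ∞) a) {K : Set (Sp 3)} (hK : IsCompact K) (h : ∀ x ∈ K, ν x ≠ 0) :
    ∃ w : Sp 3 → Em q, ContDiff ℝ (⊤ : ℕ∞) w ∧ ∀ x ∈ K, w x = (a x * ‖ν x‖⁻¹) • ν x := by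
  have hU : IsOpen {x | ν x ≠ 0} := isOpen_ne_fun hν.continuous continuous_const
  obtain ⟨w, hw, V, -, hKV, -, hV⟩ := exists_contDiff_eqOn (f := fun x => (a x * ‖ν x‖⁻¹) • ν x)
    hU hK h (by
      intro x hx
      have : ‖ν x‖ ≠ 0 := norm_ne_zero_iff.mpr hx
      exact ((ha.contDiffAt.mul ((hν.contDiffAt.norm ℝ hx).inv this)).smul
        hν.contDiffAt).contDiffWithinAt)
  exact ⟨w, hw, fun x hx => hV x (hKV hx)⟩

/-- Two orthogonal normal fields of prescribed length along an immersion. -/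
lemma exists_frame {F : Sp 3 → Em 10} (hF : ContDiff ℝ (⊤ : ℕ∞) F) {a : Sp 3 → ℝ}
    (ha : ContDiff ℝ (⊤ : ℕ∞) a) {K : Set (Sp 3)} (hK : IsCompact K)
    (hI : ∀ x ∈ K, LinearIndependent ℝ (fun i => pd i F x)) :
    ∃ w₁ w₂ : Sp 3 → Em 10, ContDiff ℝ (⊤ : ℕ∞) w₁ ∧ ContDiff ℝ (⊤ : ℕ∞) w₂ ∧
      ∀ x ∈ K, ⟪w₁ x, w₁ x⟫ = a x ^ 2 ∧ ⟪w₂ x, w₂ x⟫ = a x ^ 2 ∧ ⟪w₁ x, w₂ x⟫ = 0 ∧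
        ∀ i, ⟪w₁ x, pd i F x⟫ = 0 ∧ ⟪w₂ x, pd i F x⟫ = 0 := by
  obtain ⟨ν, hν, ho, hne⟩ := exists_normal (r := 4) (q := 10) (by norm_num) (fun i => pd i F)
    (contDiff_pd hF)
  obtain ⟨ν', hν', ho', hne'⟩ := exists_normal (r := 5) (q := 10) (by norm_num)
    (Fin.cons ν fun i => pd i F) (by
      intro k
      refine Fin.cases ?_ (fun i => ?_) k
      · exact hν
      · exact contDiff_pd hF i)
  have hne2 : ∀ x ∈ K, ν' x ≠ 0 := fun x hx => hne' x <| by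
    have : (fun k => (Fin.cons ν (fun i => pd i F) : Fin 5 → Sp 3 → Em 10) k x)
        = (Fin.cons (ν x) fun i => pd i F x : Fin 5 → Em 10) := by
      ext k
      refine Fin.cases ?_ (fun i => ?_) k <;> rfl
    rw [this, linearIndependent_finCons]
    refine ⟨hI x hx, fun hmem => hne x (hI x hx) ?_⟩
    have : ∀ y ∈ Submodule.span ℝ (Set.range fun i => pd i F x), ⟪ν x, y⟫ = 0 := fun y hy => by
      induction hy using Submodule.span_induction with
      | mem y hy => obtain ⟨i, rfl⟩ := hy; exact ho x i
      | zero => simp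
      | add y z _ _ h1 h2 => rw [inner_add_right, h1, h2, add_zero]
      | smul c y _ h1 => rw [real_inner_smul_right, h1, mul_zero]
    exact inner_self_eq_zero.mp (this _ hmem)
  obtain ⟨w₁, hw₁, e₁⟩ := exists_normalize hν ha hK fun x hx => hne x (hI x hx)
  obtain ⟨w₂, hw₂, e₂⟩ := exists_normalize hν' ha hK hne2
  refine ⟨w₁, w₂, hw₁, hw₂, fun x hx => ?_⟩
  have hs : ∀ v : Em 10, v ≠ 0 → ⟪(a x * ‖v‖⁻¹) • v, (a x * ‖v‖⁻¹) • v⟫ = a x ^ 2 := fun v hv => by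
    rw [real_inner_smul_left, real_inner_smul_right, real_inner_self_eq_norm_sq]
    have := norm_ne_zero_iff.mpr hv
    field_simp
  have h0 : ⟪ν' x, ν x⟫ = 0 := ho' x 0
  rw [e₁ x hx, e₂ x hx]
  refine ⟨hs _ (hne x (hI x hx)), hs _ (hne2 x hx), ?_, fun i => ⟨?_, ?_⟩⟩
  · rw [real_inner_smul_left, real_inner_smul_right, real_inner_comm, h0]; simp
  · rw [real_inner_smul_left, ho x i, mul_zero]
  · have := ho' x i.succ
    rw [Fin.cons_succ] at this
    rw [real_inner_smul_left, this, mul_zero]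

/-! ### Corrugations -/

/-- One corrugation: adds `a² ℓ ℓᵀ` to the induced metric, up to a small error. -/
lemma exists_corrugation {F : Sp 3 → Em 10} (hF : ContDiff ℝ (⊤ : ℕ∞) F) {a : Sp 3 → ℝ}
    (ha : ContDiff ℝ (⊤ : ℕ∞) a) (ℓ : Sp 3) {K : Set (Sp 3)} (hK : IsCompact K)
    (hI : ∀ x ∈ K, LinearIndependent ℝ (fun i => pd i F x)) {ε : ℝ} (hε : 0 < ε) :
    ∃ F' : Sp 3 → Em 10, ContDiff ℝ (⊤ : ℕ∞) F' ∧
      (∀ x ∈ K, LinearIndependent ℝ (fun i => pd i F' x)) ∧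
      ∀ x ∈ K, ‖F' x - F x‖ ≤ ε ∧ ∀ i j,
        |⟪pd i F' x, pd j F' x⟫ - (⟪pd i F x, pd j F x⟫ + a x ^ 2 * ℓ i * ℓ j)| ≤ ε := by
  obtain ⟨w₁, w₂, hw₁, hw₂, hw⟩ := exists_frame hF ha hK hI
  let V : Sp 3 × ℝ × ℝ → Fin 4 → Em 10 := fun p i =>
    pd i F p.1 + ℓ i • (p.2.1 • w₂ p.1 - p.2.2 • w₁ p.1)
  let Φ : ℝ → Sp 3 × ℝ × ℝ → Fin 4 → Em 10 := fun τ p i =>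
    V p i + τ • (p.2.1 • pd i w₁ p.1 + p.2.2 • pd i w₂ p.1)
  have hc1 := hw₁.continuous
  have hc2 := hw₂.continuous
  have hcF : ∀ i, Continuous (pd i F) := fun i => (contDiff_pd hF i).continuous
  have hcd1 : ∀ i, Continuous (pd i w₁) := fun i => (contDiff_pd hw₁ i).continuous
  have hcd2 : ∀ i, Continuous (pd i w₂) := fun i => (contDiff_pd hw₂ i).continuous
  have hV : Continuous V := continuous_pi fun i => by
    have := hcF i
    fun_prop
  have hΦ : Continuous fun z : ℝ × Sp 3 × ℝ × ℝ => Φ z.1 z.2 := continuous_pi fun i => by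
    have := hcF i
    have := hcd1 i
    have := hcd2 i
    fun_prop
  have hVi : ∀ i, Continuous fun p => V p i := fun i => (continuous_apply i).comp hV
  have hΦi : ∀ i, Continuous fun z : ℝ × Sp 3 × ℝ × ℝ => Φ z.1 z.2 i := fun i =>
    (continuous_apply i).comp hΦ
  have hVV : ∀ x ∈ K, ∀ c s : ℝ, ∀ i j, ⟪V (x, c, s) i, V (x, c, s) j⟫
      = ⟪pd i F x, pd j F x⟫ + (c ^ 2 + s ^ 2) * (a x ^ 2 * ℓ i * ℓ j) := by
    intro x hx c s i j
    obtain ⟨h11, h22, h12, h⟩ := hw x hx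
    have h21 : ⟪w₂ x, w₁ x⟫ = 0 := by rw [real_inner_comm, h12]
    have h1 : ∀ k, ⟪pd k F x, w₁ x⟫ = 0 := fun k => by rw [real_inner_comm, (h k).1]
    have h2 : ∀ k, ⟪pd k F x, w₂ x⟫ = 0 := fun k => by rw [real_inner_comm, (h k).2]
    simp only [V, inner_add_left, inner_add_right, inner_sub_left, inner_sub_right,
      real_inner_smul_left, real_inner_smul_right, h11, h22, h12, h21, h1, h2, (h _).1, (h _).2]
    ring
  have hLI : ∀ x ∈ K, ∀ c s : ℝ, LinearIndependent ℝ (V (x, c, s)) := by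
    intro x hx c s
    rw [Fintype.linearIndependent_iff]
    intro t ht
    obtain ⟨-, -, -, h⟩ := hw x hx
    have h1 : ∑ i, t i • pd i F x = 0 := by
      set w := ∑ i, t i • pd i F x with hwd
      have e1 : ∑ i, t i • V (x, c, s) i = w + (∑ i, t i * ℓ i) • (c • w₂ x - s • w₁ x) := by
        simp only [V, smul_add, Finset.sum_add_distrib, smul_smul, ← Finset.sum_smul, hwd]
      have e2 : ∀ v : Em 10, (∀ i, ⟪v, pd i F x⟫ = 0) → ⟪v, w⟫ = 0 := fun v hv => by
        simp [hwd, inner_sum, real_inner_smul_right, hv]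
      have e3 : ⟪w, w⟫ = 0 := by
        have : ⟪∑ i, t i • V (x, c, s) i, w⟫ = 0 := by rw [ht, inner_zero_left]
        rw [e1, inner_add_left, real_inner_smul_left, inner_sub_left, real_inner_smul_left,
          real_inner_smul_left, e2 _ fun i => (h i).1, e2 _ fun i => (h i).2] at this
        linarith
      exact inner_self_eq_zero.mp e3
    exact Fintype.linearIndependent_iff.mp (hI x hx) t h1
  have hK' : IsCompact (K ×ˢ (Set.Icc (-1 : ℝ) 1 ×ˢ Set.Icc (-1 : ℝ) 1)) :=
    hK.prod (isCompact_Icc.prod isCompact_Icc)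
  have key : ∀ᶠ τ : ℝ in nhds 0, ∀ p ∈ K ×ˢ (Set.Icc (-1 : ℝ) 1 ×ˢ Set.Icc (-1 : ℝ) 1),
      LinearIndependent ℝ (Φ τ p) ∧ ‖τ • (p.2.1 • w₁ p.1 + p.2.2 • w₂ p.1)‖ < ε ∧
      ∀ i j, |⟪Φ τ p i, Φ τ p j⟫ - ⟪V p i, V p j⟫| < ε := by
    refine hK'.eventually_forall_of_forall_eventually fun p hp => ?_
    have hz : Φ 0 p = V p := by ext1 i; simp [Φ]
    refine Filter.Eventually.and ?_ (Filter.Eventually.and ?_ ?_)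
    · refine hΦ.continuousAt.eventually (isOpen_setOfPred_linearIndependent.mem_nhds ?_)
      change LinearIndependent ℝ (Φ 0 p)
      rw [hz]
      exact hLI p.1 hp.1 p.2.1 p.2.2
    · have : Continuous fun z : ℝ × Sp 3 × ℝ × ℝ =>
          ‖z.1 • (z.2.2.1 • w₁ z.2.1 + z.2.2.2 • w₂ z.2.1)‖ := by fun_prop
      exact this.continuousAt.eventually_lt continuousAt_const (by simpa using hε)
    · rw [Filter.eventually_all]
      intro i
      rw [Filter.eventually_all]
      intro j
      have : Continuous fun z : ℝ × Sp 3 × ℝ × ℝ =>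
          |⟪Φ z.1 z.2 i, Φ z.1 z.2 j⟫ - ⟪V z.2 i, V z.2 j⟫| := by
        have h1 := hΦi i
        have h2 := hΦi j
        have h3 := (hVi i).comp (continuous_snd (X := ℝ))
        have h4 := (hVi j).comp (continuous_snd (X := ℝ))
        exact ((h1.inner h2).sub (h3.inner h4)).abs
      exact this.continuousAt.eventually_lt continuousAt_const (by simpa [hz] using hε)
  obtain ⟨τ, hτ, hτ0⟩ := ((key.filter_mono nhdsWithin_le_nhds).and
    (self_mem_nhdsWithin : Set.Ioi (0 : ℝ) ∈ nhdsWithin 0 (Set.Ioi 0))).exists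
  have hτ0 : τ ≠ 0 := (Set.mem_Ioi.mp hτ0).ne'
  let φ : Sp 3 → ℝ := fun y => τ⁻¹ * ∑ j, ℓ j * y j
  have hφ : ContDiff ℝ (⊤ : ℕ∞) φ :=
    contDiff_const.mul (ContDiff.sum fun j _ => contDiff_const.mul (contDiff_apply ℝ ℝ j))
  have hcos : ContDiff ℝ (⊤ : ℕ∞) fun y => Real.cos (φ y) := hφ.cos
  have hsin : ContDiff ℝ (⊤ : ℕ∞) fun y => Real.sin (φ y) := hφ.sin
  have hmem : ∀ x ∈ K, (x, Real.cos (φ x), Real.sin (φ x)) ∈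
      K ×ˢ (Set.Icc (-1 : ℝ) 1 ×ˢ Set.Icc (-1 : ℝ) 1) := fun x hx =>
    ⟨hx, Real.cos_mem_Icc _, Real.sin_mem_Icc _⟩
  have hP : ContDiff ℝ (⊤ : ℕ∞) fun y => Real.cos (φ y) • w₁ y := hcos.smul hw₁
  have hQ : ContDiff ℝ (⊤ : ℕ∞) fun y => Real.sin (φ y) • w₂ y := hsin.smul hw₂
  have hPQ : ContDiff ℝ (⊤ : ℕ∞) fun y => Real.cos (φ y) • w₁ y + Real.sin (φ y) • w₂ y :=
    hP.add hQ
  have hτPQ : ContDiff ℝ (⊤ : ℕ∞)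
      fun y => τ • (Real.cos (φ y) • w₁ y + Real.sin (φ y) • w₂ y) := hPQ.const_smul τ
  have hpd : ∀ i x, pd i (fun y => F y + τ • (Real.cos (φ y) • w₁ y + Real.sin (φ y) • w₂ y)) x
      = Φ τ (x, Real.cos (φ x), Real.sin (φ x)) i := by
    intro i x
    rw [pd_add (smooth_differentiableAt hF x) (smooth_differentiableAt hτPQ x),
      pd_const_smul _ (smooth_differentiableAt hPQ x),
      pd_add (smooth_differentiableAt hP x) (smooth_differentiableAt hQ x),
      pd_smul (smooth_differentiableAt hcos x) (smooth_differentiableAt hw₁ x),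
      pd_smul (smooth_differentiableAt hsin x) (smooth_differentiableAt hw₂ x),
      pd_comp_real (Real.hasDerivAt_cos _) (smooth_differentiableAt hφ x),
      pd_comp_real (Real.hasDerivAt_sin _) (smooth_differentiableAt hφ x), pd_lin]
    simp only [Φ, V]
    match_scalars <;> field_simp
  refine ⟨fun y => F y + τ • (Real.cos (φ y) • w₁ y + Real.sin (φ y) • w₂ y), hF.add hτPQ, ?_, ?_⟩
  · intro x hx
    simp only [hpd]
    exact (hτ _ (hmem x hx)).1
  · intro x hx
    obtain ⟨-, h2, h3⟩ := hτ _ (hmem x hx)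
    refine ⟨by simpa using h2.le, fun i j => ?_⟩
    have := h3 i j
    rw [hVV x hx, Real.cos_sq_add_sin_sq, one_mul] at this
    rw [hpd, hpd]
    exact this.le

/-- Finitely many corrugations. -/
lemma exists_corrugations {N : ℕ} (a : Fin N → Sp 3 → ℝ)
    (ha : ∀ l, ContDiff ℝ (⊤ : ℕ∞) (a l)) (ℓ : Fin N → Sp 3) {K : Set (Sp 3)} (hK : IsCompact K)
    {F : Sp 3 → Em 10} (hF : ContDiff ℝ (⊤ : ℕ∞) F)
    (hI : ∀ x ∈ K, LinearIndependent ℝ (fun i => pd i F x)) {ε : ℝ} (hε : 0 < ε) :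
    ∃ F' : Sp 3 → Em 10, ContDiff ℝ (⊤ : ℕ∞) F' ∧
      (∀ x ∈ K, LinearIndependent ℝ (fun i => pd i F' x)) ∧
      ∀ x ∈ K, ‖F' x - F x‖ ≤ ε ∧ ∀ i j,
        |⟪pd i F' x, pd j F' x⟫ - (⟪pd i F x, pd j F x⟫ + ∑ l, a l x ^ 2 * ℓ l i * ℓ l j)| ≤ ε := by
  induction N generalizing ε with
  | zero => exact ⟨F, hF, hI, fun x _ => by simp [hε.le]⟩
  | succ N ih =>
    obtain ⟨F₁, hF₁, hI₁, h₁⟩ := ih (fun l => a l.castSucc) (fun l => ha _)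
      (fun l => ℓ l.castSucc) (half_pos hε)
    obtain ⟨F₂, hF₂, hI₂, h₂⟩ := exists_corrugation hF₁ (ha (Fin.last N)) (ℓ (Fin.last N)) hK hI₁
      (half_pos hε)
    refine ⟨F₂, hF₂, hI₂, fun x hx => ⟨?_, fun i j => ?_⟩⟩
    · calc ‖F₂ x - F x‖ = ‖(F₂ x - F₁ x) + (F₁ x - F x)‖ := by congr 1; abel
        _ ≤ ε / 2 + ε / 2 := (norm_add_le _ _).trans (add_le_add (h₂ x hx).1 (h₁ x hx).1)
        _ = ε := by ring
    · rw [Fin.sum_univ_castSucc]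
      have e1 := abs_le.mp ((h₁ x hx).2 i j)
      have e2 := abs_le.mp ((h₂ x hx).2 i j)
      rw [abs_le]
      constructor <;> linarith

/-! ### Approximate isometric embeddings -/

open scoped MatrixOrder Matrix.Norms.L2Operator in
/-- Continuous fields of positive semidefinite matrices are approximately sums of squares of
constant linear forms with smooth coefficients. -/
lemma exists_sum_sq_approx {h : Fin 4 → Fin 4 → Sp 3 → ℝ} (hc : ∀ i j, Continuous (h i j))
    {K : Set (Sp 3)} (hK : IsCompact K)
    (hp : ∀ x ∈ K, (Matrix.of fun i j => h i j x).PosSemidef) {η : ℝ} (hη : 0 < η) :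
    ∃ (N : ℕ) (a : Fin N → Sp 3 → ℝ) (ℓ : Fin N → Sp 3), (∀ l, ContDiff ℝ (⊤ : ℕ∞) (a l)) ∧
      ∀ x ∈ K, ∀ i j, |h i j x - ∑ l, a l x ^ 2 * ℓ l i * ℓ l j| ≤ η := by
  let W : Sp 3 → Set (Sp 3) := fun p => {x | ∀ i j, |h i j x - h i j p| < η}
  have hW : ∀ p, W p ∈ nhds p := fun p => by
    refine Filter.eventually_all.mpr fun i => Filter.eventually_all.mpr fun j => ?_
    have : Continuous fun x => |h i j x - h i j p| := ((hc i j).sub continuous_const).abs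
    exact this.continuousAt.eventually_lt continuousAt_const (by simpa using hη)
  choose χ hχs _ hχ _ hχ1 using fun p => exists_contDiff_tsupport_subset (n := ⊤) (hW p)
  have hopen : ∀ p, IsOpen {x | χ p x ≠ 0} := fun p =>
    isOpen_ne_fun (hχ p).continuous continuous_const
  obtain ⟨t, ht⟩ := hK.elim_nhds_subcover' (fun p _ => {x | χ p x ≠ 0}) (fun p _ =>
    (hopen p).mem_nhds (by simp [hχ1]))
  have hB : ∀ p : K, ∃ B : Matrix (Fin 4) (Fin 4) ℝ, ∀ i j, h i j p = ∑ r, B r i * B r j := by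
    intro p
    obtain ⟨B, hB⟩ := CStarAlgebra.nonneg_iff_eq_star_mul_self.mp
      (Matrix.nonneg_iff_posSemidef.mpr (hp p p.2))
    refine ⟨B, fun i j => ?_⟩
    have := congrFun (congrFun hB i) j
    simpa [Matrix.mul_apply] using this
  choose B hB using hB
  let Q : Sp 3 → ℝ := fun x => ∑ p ∈ t, χ p x ^ 2
  have hQ : ContDiff ℝ (⊤ : ℕ∞) Q := ContDiff.sum fun p _ => (hχ p).pow 2
  have hQpos : ∀ x ∈ K, 0 < Q x := fun x hx => by
    obtain ⟨p, hp, hpx⟩ := Set.mem_iUnion₂.mp (ht hx)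
    exact (sq_pos_of_ne_zero hpx).trans_le
      (Finset.single_le_sum (f := fun p : K => χ p x ^ 2) (fun _ _ => sq_nonneg _) hp)
  have hU : IsOpen {x | 0 < Q x} := isOpen_lt continuous_const hQ.continuous
  have hglob : ∀ p : K, ∃ f : Sp 3 → ℝ, ContDiff ℝ (⊤ : ℕ∞) f ∧
      ∀ x ∈ K, f x = χ p x * (√(Q x))⁻¹ := fun p => by
    obtain ⟨f, hf, V, -, hKV, -, hV⟩ := exists_contDiff_eqOn (f := fun x => χ p x * (√(Q x))⁻¹)
      hU hK hQpos fun x hx => by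
        have hx : 0 < Q x := hx
        exact ((hχ p).contDiffAt.mul ((hQ.contDiffAt.sqrt hx.ne').inv
          (Real.sqrt_pos.mpr hx).ne')).contDiffWithinAt
    exact ⟨f, hf, fun x hx => hV x (hKV hx)⟩
  choose f hf hfK using hglob
  let e := (Fintype.equivFin (t × Fin 4)).symm
  refine ⟨_, fun l => f (e l).1, fun l => B (e l).1 (e l).2, fun l => hf _, fun x hx i j => ?_⟩
  have hQx := hQpos x hx
  have hsq : ∀ p : K, f p x ^ 2 = χ p x ^ 2 / Q x := fun p => by
    rw [hfK p x hx, mul_pow, inv_pow, Real.sq_sqrt hQx.le, div_eq_mul_inv]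
  have hsum : ∑ p : t, f p x ^ 2 = 1 := by
    simp only [hsq]
    rw [← Finset.sum_div, Finset.sum_coe_sort t fun p => χ p x ^ 2]
    exact div_self hQx.ne'
  rw [e.sum_comp fun q : t × Fin 4 => f q.1 x ^ 2 * B q.1 q.2 i * B q.1 q.2 j,
    Fintype.sum_prod_type]
  simp only [mul_assoc, ← Finset.mul_sum, ← hB]
  have : h i j x - ∑ p : t, f p x ^ 2 * h i j p = ∑ p : t, f p x ^ 2 * (h i j x - h i j p) := by
    simp only [mul_sub, Finset.sum_sub_distrib, ← Finset.sum_mul, hsum, one_mul]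
  rw [this]
  calc |∑ p : t, f p x ^ 2 * (h i j x - h i j p)|
      ≤ ∑ p : t, |f p x ^ 2 * (h i j x - h i j p)| := Finset.abs_sum_le_sum_abs _ _
    _ ≤ ∑ p : t, f p x ^ 2 * η := Finset.sum_le_sum fun p _ => by
        rw [abs_mul, abs_of_nonneg (sq_nonneg _)]
        by_cases h0 : χ p x = 0
        · rw [hfK p x hx, h0]; simp
        · exact mul_le_mul_of_nonneg_left (hχs p (subset_tsupport _ h0) i j).le (sq_nonneg _)
    _ = η := by rw [← Finset.sum_mul, hsum, one_mul]

/-- A nearly constant map into `ℝ¹⁰` inducing approximately a given metric. -/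
theorem exists_approx_isometric {h : Fin 4 → Fin 4 → Sp 3 → ℝ} (hc : ∀ i j, Continuous (h i j))
    {K : Set (Sp 3)} (hK : IsCompact K)
    (hp : ∀ x ∈ K, (Matrix.of fun i j => h i j x).PosSemidef) {η : ℝ} (hη : 0 < η) :
    ∃ F : Sp 3 → Em 10, ContDiff ℝ (⊤ : ℕ∞) F ∧
      ∀ x ∈ K, ‖F x‖ ≤ η ∧ ∀ i j, |⟪pd i F x, pd j F x⟫ - h i j x| ≤ η := by
  let v : Fin 4 → Em 10 := fun i => EuclideanSpace.single (Fin.castLE (by norm_num) i) 1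
  have hvv : ∀ i j, ⟪v i, v j⟫ = if i = j then 1 else 0 := fun i j => by
    simp [v, EuclideanSpace.inner_single_left, Fin.ext_iff]
  have hv : LinearIndependent ℝ v := by
    have : Orthonormal ℝ v := orthonormal_iff_ite.mpr hvv
    exact this.linearIndependent
  have hL : ContDiff ℝ (⊤ : ℕ∞) fun y : Sp 3 => ∑ i, y i • v i :=
    ContDiff.sum fun i _ => (contDiff_apply ℝ ℝ i).smul contDiff_const
  obtain ⟨C, hC⟩ := hK.exists_bound_of_continuousOn hL.continuous.continuousOn
  set δ : ℝ := min 1 (η / (3 * (|C| + 1))) with hδ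
  have hC1 : 0 < |C| + 1 := by positivity
  have hδ0 : 0 < δ := lt_min one_pos (by positivity)
  have hδC : δ * (|C| + 1) ≤ η / 3 := by
    have : δ ≤ η / (3 * (|C| + 1)) := min_le_right _ _
    calc δ * (|C| + 1) ≤ η / (3 * (|C| + 1)) * (|C| + 1) := by gcongr
      _ = η / 3 := by field_simp
  have hδη : δ ≤ η / 3 := by nlinarith [abs_nonneg C]
  have hδ2 : δ ^ 2 ≤ η / 3 := by nlinarith [min_le_left 1 (η / (3 * (|C| + 1)))]
  let F₀ : Sp 3 → Em 10 := fun y => δ • ∑ i, y i • v i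
  have hF₀ : ContDiff ℝ (⊤ : ℕ∞) F₀ := hL.const_smul δ
  have hpd : ∀ i x, pd i F₀ x = δ • v i := fun i x => by
    rw [pd_const_smul _ (smooth_differentiableAt hL x), 
      pd_sum (f := fun k y => y k • v k) _ fun k _ =>
        smooth_differentiableAt ((contDiff_apply ℝ ℝ k).smul contDiff_const) x]
    congr 1
    have : ∀ k, pd i (fun y : Sp 3 => y k • v k) x = if k = i then v k else 0 := fun k => by
      have h1 : HasFDerivAt (fun y : Sp 3 => y k • v k)
          ((ContinuousLinearMap.proj (R := ℝ) (φ := fun _ : Fin 4 => ℝ) k).smulRight (v k)) x :=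
        (hasFDerivAt_apply k x).smul_const (v k)
      rw [pd_of_hasFDerivAt h1]
      simp [Pi.single_apply]
    simp [this]
  obtain ⟨N, a, ℓ, ha, hal⟩ := exists_sum_sq_approx hc hK hp (show 0 < η / 3 by positivity)
  obtain ⟨F, hF, -, hFK⟩ := exists_corrugations a ha ℓ hK hF₀ (fun x _ => by
    simp only [hpd]
    exact hv.units_smul fun _ => Units.mk0 δ hδ0.ne') (show 0 < η / 3 by positivity)
  refine ⟨F, hF, fun x hx => ⟨?_, fun i j => ?_⟩⟩
  · have h1 : ‖F₀ x‖ ≤ η / 3 := by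
      simp only [F₀]
      rw [norm_smul, Real.norm_of_nonneg hδ0.le]
      refine le_trans ?_ hδC
      gcongr
      exact (hC x hx).trans ((le_abs_self C).trans (by linarith))
    calc ‖F x‖ = ‖(F x - F₀ x) + F₀ x‖ := by congr 1; abel
      _ ≤ η / 3 + η / 3 := (norm_add_le _ _).trans (add_le_add (hFK x hx).1 h1)
      _ ≤ η := by linarith
  · have e1 := abs_le.mp ((hFK x hx).2 i j)
    have e2 := abs_le.mp (hal x hx i j)
    rw [hpd, hpd, real_inner_smul_left, real_inner_smul_right, hvv] at e1
    have e3 : 0 ≤ δ * (δ * if i = j then (1 : ℝ) else 0) ∧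
        δ * (δ * if i = j then (1 : ℝ) else 0) ≤ η / 3 := by
      split_ifs
      · constructor <;> nlinarith
      · simp; positivity
    rw [abs_le]
    constructor <;> linarith [e1.1, e1.2, e2.1, e2.2, e3.1, e3.2]

/-! ### A basis of symmetric matrices made of squares of linear forms -/

set_option maxHeartbeats 1600000 in
lemma exists_squares_subtype : ∃ (ℓ : {p : Fin 4 × Fin 4 // p.1 ≤ p.2} → Sp 3)
    (c : {p : Fin 4 × Fin 4 // p.1 ≤ p.2} → Fin 4 → Fin 4 → ℝ)
    (κ : Fin 4 → {p : Fin 4 × Fin 4 // p.1 ≤ p.2}),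
    Function.Injective κ ∧ (∀ i, ℓ (κ i) = Pi.single i 2) ∧
    (∀ (h : Fin 4 → Fin 4 → ℝ) i j,
      ∑ k, (∑ p, ∑ q, c k p q * h p q) * ℓ k i * ℓ k j = (h i j + h j i) / 2) ∧
    ∀ k, ∑ p, ∑ q, c k p q * ∑ l, ℓ l p * ℓ l q = 1 := by
  let ℓ : Fin 4 × Fin 4 → Sp 3 := fun p => Pi.single p.1 1 + Pi.single p.2 1
  let c : Fin 4 × Fin 4 → Fin 4 → Fin 4 → ℝ := fun k p q =>
    if k.1 = k.2 then
      (if p = k.1 then (if q = k.1 then 1 / 4 else -1 / 8) else (if q = k.1 then -1 / 8 else 0))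
    else (if p = k.1 ∧ q = k.2 ∨ p = k.2 ∧ q = k.1 then 1 / 2 else 0)
  have hs : ∀ f : Fin 4 × Fin 4 → ℝ, ∑ k : {p : Fin 4 × Fin 4 // p.1 ≤ p.2}, f k =
      ∑ i, ∑ j, if i ≤ j then f (i, j) else 0 := fun f => by
    rw [← Finset.sum_subtype (Finset.univ.filter fun p : Fin 4 × Fin 4 => p.1 ≤ p.2) (by simp) f,
      Finset.sum_filter, Fintype.sum_prod_type]
  refine ⟨fun k => ℓ k, fun k => c k, fun i => ⟨(i, i), le_rfl⟩, ?_, ?_, ?_, ?_⟩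
  · intro i j h
    simpa using h
  · intro i
    simp only [ℓ, ← Pi.single_add]
    norm_num
  · intro h i j
    rw [hs fun k => (∑ p, ∑ q, c k p q * h p q) * ℓ k i * ℓ k j]
    fin_cases i <;> fin_cases j <;> simp [Fin.sum_univ_four, c, ℓ] <;> ring
  · have hH : ∀ p q, ∑ l : {p : Fin 4 × Fin 4 // p.1 ≤ p.2}, ℓ l p * ℓ l q
        = if p = q then 7 else 1 := fun p q => by
      rw [hs fun k => ℓ k p * ℓ k q]
      fin_cases p <;> fin_cases q <;> simp [Fin.sum_univ_four, ℓ] <;> norm_num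
    rintro ⟨⟨k, k'⟩, hk⟩
    simp only [hH]
    clear hk hH hs
    fin_cases k <;> fin_cases k' <;> simp [Fin.sum_univ_four, c] <;> norm_num

lemma exists_squares : ∃ (ℓ : Fin 10 → Sp 3) (c : Fin 10 → Fin 4 → Fin 4 → ℝ)
    (κ : Fin 4 → Fin 10), Function.Injective κ ∧ (∀ i, ℓ (κ i) = Pi.single i 2) ∧
    (∀ (h : Fin 4 → Fin 4 → ℝ) i j,
      ∑ k, (∑ p, ∑ q, c k p q * h p q) * ℓ k i * ℓ k j = (h i j + h j i) / 2) ∧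
    ∀ k, ∑ p, ∑ q, c k p q * ∑ l, ℓ l p * ℓ l q = 1 := by
  obtain ⟨ℓ, c, κ, h1, h2, h3, h4⟩ := exists_squares_subtype
  have hcard : Fintype.card {p : Fin 4 × Fin 4 // p.1 ≤ p.2} = 10 := by decide
  let e := Fintype.equivFinOfCardEq hcard
  refine ⟨fun k => ℓ (e.symm k), fun k => c (e.symm k), fun i => e (κ i),
    e.injective.comp h1, fun i => by simp [h2], fun h i j => ?_, fun k => ?_⟩
  · rw [← h3 h i j]
    exact e.symm.sum_comp fun k => (∑ p, ∑ q, c k p q * h p q) * ℓ k i * ℓ k j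
  · rw [← h4 (e.symm k)]
    refine Finset.sum_congr rfl fun p _ => Finset.sum_congr rfl fun q _ => ?_
    rw [e.symm.sum_comp fun l => ℓ l p * ℓ l q]

lemma pd_comm {f : Sp 3 → ℝ} (hf : ContDiff ℝ (⊤ : ℕ∞) f) (i j : Fin 4) (x : Sp 3) :
    pd i (pd j f) x = pd j (pd i f) x := by
  have hd : Differentiable ℝ (fderiv ℝ f) :=
    (hf.fderiv_right (m := (⊤ : ℕ∞)) (by simp)).differentiable (by simp)
  have h : ∀ i j, pd i (pd j f) x = fderiv ℝ (fderiv ℝ f) x (Pi.single i 1) (Pi.single j 1) :=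
    fun i j => by
      have h1 : HasFDerivAt (pd j f) ((fderiv ℝ (fderiv ℝ f) x).flip (Pi.single j 1)) x := by
        have h2 := (hd x).hasFDerivAt.clm_apply (hasFDerivAt_const (Pi.single j (1 : ℝ)) x)
        rw [ContinuousLinearMap.comp_zero, zero_add] at h2
        exact h2
      rw [pd_of_hasFDerivAt h1]; rfl
  rw [h, h]
  exact (hf.contDiffAt.isSymmSndFDerivAt (by simp; exact WithTop.coe_le_coe.mpr le_top)) _ _

/-- Local smooth data near a compact set extends to data in the Wiener algebra. -/
lemma exists_wien_of_contDiffOn {f : Sp 3 → ℝ} {U K : Set (Sp 3)} (hU : IsOpen U)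
    (hK : IsCompact K) (hKU : K ⊆ U) (hf : ContDiffOn ℝ (⊤ : ℕ∞) f U) :
    ∃ f' : Sp 3 → ℝ, (∃ C, Wien f' C) ∧ ∀ᶠ x in nhdsSet K, f' x = f x := by
  obtain ⟨f₁, hf₁, V, hV, hKV, -, h₁⟩ := exists_contDiff_eqOn hU hK hKU hf
  obtain ⟨f₂, C, hf₂, W, hW, hKW, h₂⟩ := exists_wien_eqOn hf₁ hK
  refine ⟨f₂, ⟨C, hf₂⟩, eventually_nhdsSet_iff_exists.mpr ⟨V ∩ W, hV.inter hW,
    Set.subset_inter hKV hKW, fun x hx => ?_⟩⟩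
  rw [h₂ x hx.2, h₁ x hx.1]

namespace UW

lemma exists_bound {ι : Type*} [Fintype ι] {F : ι → ℝ → Sp 3 → ℝ} (hF : ∀ i, UW (F i)) :
    ∃ C, 0 < C ∧ ∀ i μ, 0 < μ → μ ≤ 1 → Wien (F i μ) C := by
  choose C hC using hF
  have h0 : ∀ i, 0 ≤ C i := fun i => (hC i 1 one_pos le_rfl).nonneg
  refine ⟨∑ i, C i + 1, by have := Finset.sum_nonneg fun i (_ : i ∈ Finset.univ) => h0 i; linarith,
    fun i μ h h' => (hC i μ h h').mono ?_⟩
  have := Finset.single_le_sum (f := C) (fun i _ => h0 i) (Finset.mem_univ i)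
  linarith

lemma exists_small {ι : Type*} [Fintype ι] {F : ι → ℝ → Sp 3 → ℝ} (hF : ∀ i, UW (F i))
    {ε : ℝ} (hε : 0 < ε) :
    ∃ μ₀, 0 < μ₀ ∧ ∀ i μ, 0 < μ → μ ≤ 1 → μ ≤ μ₀ → Wien (fun y => μ * F i μ y) ε := by
  obtain ⟨C, hC0, hC⟩ := exists_bound hF
  refine ⟨ε / C, by positivity, fun i μ h h1 h2 => ((hC i μ h h1).const_mul h.le).mono ?_⟩
  rwa [le_div_iff₀ hC0] at h2

end UW

/-! ### The perturbation system -/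

section perturbation

/-- Components of the perturbed map: ten planes and one extra direction. -/
abbrev PIdx := Fin 10 ⊕ Fin 10 ⊕ Unit

def cosL (ℓ y : Sp 3) : ℝ := Real.cos (∑ i, ℓ i * y i)

def sinL (ℓ y : Sp 3) : ℝ := Real.sin (∑ i, ℓ i * y i)

variable (ℓ : Fin 10 → Sp 3) (c : Fin 10 → Fin 4 → Fin 4 → ℝ) (κ : Fin 4 → Fin 10)

/-- The oscillating approximate solution in the dilated variable. -/
def baseMap (a : Fin 10 → Sp 3 → ℝ) (r : Sp 3 → ℝ) (μ : ℝ) : PIdx → Sp 3 → ℝ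
  | .inl k => fun y => a k (μ • y) * cosL (ℓ k) y
  | .inr (.inl k) => fun y => a k (μ • y) * sinL (ℓ k) y
  | .inr (.inr _) => fun y => μ⁻¹ * r (μ • y)

def coefP (IA : Fin 10 → Sp 3 → ℝ) (μ : ℝ) (k : Fin 10) : Idx → Sp 3 → ℝ
  | .inl _ => fun _ => 0
  | .inr (.inl _) => fun _ => 0
  | .inr (.inr p) => fun y => -(c k p.1 p.2 * IA k (μ • y))

def coefQ (IA : Fin 10 → Sp 3 → ℝ) (B : Fin 4 → Sp 3 → ℝ) (μ : ℝ) (k : Fin 10) : Idx → Sp 3 → ℝ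
  | .inl _ => fun y => -∑ i, (if κ i = k then 1 / 2 else 0) * (IA k (μ • y) * B i (μ • y))
  | .inr (.inl i) => fun y => (if κ i = k then 1 / 2 else 0) * IA k (μ • y)
  | .inr (.inr _) => fun _ => 0

/-- Right inverse of the leading part of the linearised system. -/
def coefE (IA : Fin 10 → Sp 3 → ℝ) (IR : Sp 3 → ℝ) (B : Fin 4 → Sp 3 → ℝ) (μ : ℝ) :
    PIdx → Idx → Sp 3 → ℝ
  | .inl k, j => fun y => coefP c IA μ k j y * cosL (ℓ k) y - coefQ κ IA B μ k j y * sinL (ℓ k) y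
  | .inr (.inl k), j =>
    fun y => coefP c IA μ k j y * sinL (ℓ k) y + coefQ κ IA B μ k j y * cosL (ℓ k) y
  | .inr (.inr _), .inl _ => fun y => IR (μ • y)
  | .inr (.inr _), .inr _ => fun _ => 0

/-- The lower order part of the linearised system. -/
def coefL (A₀ : Fin 10 → Sp 3 → ℝ) (A₁ : Fin 4 → Fin 10 → Sp 3 → ℝ)
    (A₂ : Fin 4 → Fin 4 → Fin 10 → Sp 3 → ℝ) (R₂ : Fin 4 → Fin 4 → Sp 3 → ℝ) (μ : ℝ) :
    Idx → PIdx → Sp 3 → ℝ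
  | .inl _, .inl k => fun y => A₀ k (μ • y) * cosL (ℓ k) y
  | .inl _, .inr (.inl k) => fun y => A₀ k (μ • y) * sinL (ℓ k) y
  | .inr (.inl i), .inl k => fun y => A₁ i k (μ • y) * cosL (ℓ k) y
  | .inr (.inl i), .inr (.inl k) => fun y => A₁ i k (μ • y) * sinL (ℓ k) y
  | .inr (.inr p), .inl k => fun y =>
    -((A₁ p.1 k (μ • y) * ℓ k p.2 + A₁ p.2 k (μ • y) * ℓ k p.1) * sinL (ℓ k) y)
      + μ * (A₂ p.1 p.2 k (μ • y) * cosL (ℓ k) y)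
  | .inr (.inr p), .inr (.inl k) => fun y =>
    (A₁ p.1 k (μ • y) * ℓ k p.2 + A₁ p.2 k (μ • y) * ℓ k p.1) * cosL (ℓ k) y
      + μ * (A₂ p.1 p.2 k (μ • y) * sinL (ℓ k) y)
  | .inr (.inr p), .inr (.inr _) => fun y => R₂ p.1 p.2 (μ • y)
  | .inl _, .inr (.inr _) => fun _ => 0
  | .inr (.inl _), .inr (.inr _) => fun _ => 0

variable {ℓ c κ}

lemma uw_cosL (k : Fin 10) : UW fun _ y => cosL (ℓ k) y := UW.of_wien (wien_cos (ℓ k))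

lemma uw_sinL (k : Fin 10) : UW fun _ y => sinL (ℓ k) y := UW.of_wien (wien_sin (ℓ k))

lemma uw_dil {f : Sp 3 → ℝ} (hf : ∃ C, Wien f C) : UW fun μ y => f (μ • y) :=
  UW.dil hf.choose_spec

lemma uw_coefE {IA : Fin 10 → Sp 3 → ℝ} {IR : Sp 3 → ℝ} {B : Fin 4 → Sp 3 → ℝ}
    (hIA : ∀ k, ∃ C, Wien (IA k) C) (hIR : ∃ C, Wien IR C) (hB : ∀ i, ∃ C, Wien (B i) C)
    (s : PIdx) (j : Idx) : UW fun μ => coefE ℓ c κ IA IR B μ s j := by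
  have hP : ∀ k, UW fun μ => coefP c IA μ k j := fun k => by
    rcases j with _ | i | p
    · exact UW.const 0
    · exact UW.const 0
    · exact ((UW.const _).mul (uw_dil (hIA k))).neg
  have hQ : ∀ k, UW fun μ => coefQ κ IA B μ k j := fun k => by
    rcases j with _ | i | p
    · exact (UW.sum _ fun i _ => (UW.const _).mul ((uw_dil (hIA k)).mul (uw_dil (hB i)))).neg
    · exact (UW.const _).mul (uw_dil (hIA k))
    · exact UW.const 0
  rcases s with k | k | _
  · exact ((hP k).mul (uw_cosL k)).sub ((hQ k).mul (uw_sinL k))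
  · exact ((hP k).mul (uw_sinL k)).add ((hQ k).mul (uw_cosL k))
  · rcases j with _ | j
    · exact uw_dil hIR
    · exact UW.const 0

lemma uw_coefL {A₀ : Fin 10 → Sp 3 → ℝ} {A₁ : Fin 4 → Fin 10 → Sp 3 → ℝ}
    {A₂ : Fin 4 → Fin 4 → Fin 10 → Sp 3 → ℝ} {R₂ : Fin 4 → Fin 4 → Sp 3 → ℝ}
    (h₀ : ∀ k, ∃ C, Wien (A₀ k) C) (h₁ : ∀ i k, ∃ C, Wien (A₁ i k) C)
    (h₂ : ∀ i j k, ∃ C, Wien (A₂ i j k) C) (hR : ∀ i j, ∃ C, Wien (R₂ i j) C)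
    (s : PIdx) (j : Idx) : UW fun μ => coefL ℓ A₀ A₁ A₂ R₂ μ j s := by
  rcases j with _ | i | p <;> rcases s with k | k | _
  · exact (uw_dil (h₀ k)).mul (uw_cosL k)
  · exact (uw_dil (h₀ k)).mul (uw_sinL k)
  · exact UW.const 0
  · exact (uw_dil (h₁ i k)).mul (uw_cosL k)
  · exact (uw_dil (h₁ i k)).mul (uw_sinL k)
  · exact UW.const 0
  · exact (((((uw_dil (h₁ _ k)).mul (UW.const _)).add ((uw_dil (h₁ _ k)).mul (UW.const _))).mul
      (uw_sinL k)).neg).add (UW.scale.mul ((uw_dil (h₂ _ _ k)).mul (uw_cosL k)))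
  · exact ((((uw_dil (h₁ _ k)).mul (UW.const _)).add ((uw_dil (h₁ _ k)).mul (UW.const _))).mul
      (uw_cosL k)).add (UW.scale.mul ((uw_dil (h₂ _ _ k)).mul (uw_sinL k)))
  · exact uw_dil (hR _ _)

lemma cosL_sq_add (l y : Sp 3) : cosL l y ^ 2 + sinL l y ^ 2 = 1 := Real.cos_sq_add_sin_sq _

lemma contDiff_lin (l : Sp 3) : ContDiff ℝ (⊤ : ℕ∞) fun y : Sp 3 => ∑ i, l i * y i :=
  ContDiff.sum fun j _ => contDiff_const.mul (contDiff_apply ℝ ℝ j)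

lemma contDiff_cosL (l : Sp 3) : ContDiff ℝ (⊤ : ℕ∞) (cosL l) := (contDiff_lin l).cos

lemma contDiff_sinL (l : Sp 3) : ContDiff ℝ (⊤ : ℕ∞) (sinL l) := (contDiff_lin l).sin

lemma pd_linear (l : Sp 3) (i : Fin 4) (x : Sp 3) : pd i (fun y => ∑ j, l j * y j) x = l i := by
  simpa using pd_lin l 1 i x

lemma pd_cosL (l : Sp 3) (i : Fin 4) (x : Sp 3) : pd i (cosL l) x = -(l i * sinL l x) := by
  have := pd_comp_real (Real.hasDerivAt_cos _) (smooth_differentiableAt (contDiff_lin l) x) i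
  rw [pd_linear] at this
  rw [show cosL l = fun y => Real.cos (∑ j, l j * y j) from rfl, this]
  simp only [sinL]; ring

lemma pd_sinL (l : Sp 3) (i : Fin 4) (x : Sp 3) : pd i (sinL l) x = l i * cosL l x := by
  have := pd_comp_real (Real.hasDerivAt_sin _) (smooth_differentiableAt (contDiff_lin l) x) i
  rw [pd_linear] at this
  rw [show sinL l = fun y => Real.sin (∑ j, l j * y j) from rfl, this]
  simp only [cosL]; ring

lemma contDiff_dilate {E : Type*} [NormedAddCommGroup E] [NormedSpace ℝ E] {f : Sp 3 → E}
    (hf : ContDiff ℝ (⊤ : ℕ∞) f) (μ : ℝ) : ContDiff ℝ (⊤ : ℕ∞) fun y => f (μ • y) :=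
  hf.comp (contDiff_id.const_smul μ)

lemma pd_dilate {E : Type*} [NormedAddCommGroup E] [NormedSpace ℝ E] {f : Sp 3 → E}
    (hf : ContDiff ℝ (⊤ : ℕ∞) f) (μ : ℝ) (i : Fin 4) (x : Sp 3) :
    pd i (fun y => f (μ • y)) x = μ • pd i f (μ • x) := by
  have h1 : HasFDerivAt (fun y : Sp 3 => μ • y) (μ • ContinuousLinearMap.id ℝ (Sp 3)) x :=
    (hasFDerivAt_id x).const_smul μ
  have h := (smooth_differentiableAt hf (μ • x)).hasFDerivAt.comp x h1
  have h2 : pd i (fun y => f (μ • y)) x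
      = ((fderiv ℝ f (μ • x)).comp (μ • ContinuousLinearMap.id ℝ (Sp 3))) (Pi.single i 1) :=
    pd_of_hasFDerivAt h i
  rw [h2]
  simp [pd]

lemma pd_dilate_cosL {α : Sp 3 → ℝ} (hα : ContDiff ℝ (⊤ : ℕ∞) α) (l : Sp 3) (μ : ℝ) (i : Fin 4)
    (x : Sp 3) : pd i (fun y => α (μ • y) * cosL l y) x
      = μ * (pd i α (μ • x) * cosL l x) + -l i * (α (μ • x) * sinL l x) := by
  rw [pd_mul (smooth_differentiableAt (contDiff_dilate hα μ) x)
    (smooth_differentiableAt (contDiff_cosL l) x), pd_cosL, pd_dilate hα, smul_eq_mul]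
  ring

lemma pd_dilate_sinL {α : Sp 3 → ℝ} (hα : ContDiff ℝ (⊤ : ℕ∞) α) (l : Sp 3) (μ : ℝ) (i : Fin 4)
    (x : Sp 3) : pd i (fun y => α (μ • y) * sinL l y) x
      = μ * (pd i α (μ • x) * sinL l x) + l i * (α (μ • x) * cosL l x) := by
  rw [pd_mul (smooth_differentiableAt (contDiff_dilate hα μ) x)
    (smooth_differentiableAt (contDiff_sinL l) x), pd_sinL, pd_dilate hα, smul_eq_mul]
  ring

lemma smooth_dilate_cosL {α : Sp 3 → ℝ} (hα : ContDiff ℝ (⊤ : ℕ∞) α) (l : Sp 3) (μ : ℝ) :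
    ContDiff ℝ (⊤ : ℕ∞) fun y => α (μ • y) * cosL l y :=
  (contDiff_dilate hα μ).mul (contDiff_cosL l)

lemma smooth_dilate_sinL {α : Sp 3 → ℝ} (hα : ContDiff ℝ (⊤ : ℕ∞) α) (l : Sp 3) (μ : ℝ) :
    ContDiff ℝ (⊤ : ℕ∞) fun y => α (μ • y) * sinL l y :=
  (contDiff_dilate hα μ).mul (contDiff_sinL l)

lemma pd_pd_dilate_cosL {α : Sp 3 → ℝ} (hα : ContDiff ℝ (⊤ : ℕ∞) α) (l : Sp 3) (μ : ℝ)
    (i j : Fin 4) (x : Sp 3) : pd i (pd j fun y => α (μ • y) * cosL l y) x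
      = -(l i * l j * (α (μ • x) * cosL l x)) + μ *
        (-((pd i α (μ • x) * l j + pd j α (μ • x) * l i) * sinL l x)
          + μ * (pd i (pd j α) (μ • x) * cosL l x)) := by
  rw [funext (pd_dilate_cosL hα l μ j),
    pd_add (smooth_differentiableAt
        (contDiff_const.mul (smooth_dilate_cosL (contDiff_pd hα j) l μ)) x)
      (smooth_differentiableAt (contDiff_const.mul (smooth_dilate_sinL hα l μ)) x),
    pd_const_mul _ (smooth_differentiableAt (smooth_dilate_cosL (contDiff_pd hα j) l μ) x),
    pd_const_mul _ (smooth_differentiableAt (smooth_dilate_sinL hα l μ) x),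
    pd_dilate_cosL (contDiff_pd hα j), pd_dilate_sinL hα]
  ring

lemma pd_pd_dilate_sinL {α : Sp 3 → ℝ} (hα : ContDiff ℝ (⊤ : ℕ∞) α) (l : Sp 3) (μ : ℝ)
    (i j : Fin 4) (x : Sp 3) : pd i (pd j fun y => α (μ • y) * sinL l y) x
      = -(l i * l j * (α (μ • x) * sinL l x)) + μ *
        ((pd i α (μ • x) * l j + pd j α (μ • x) * l i) * cosL l x
          + μ * (pd i (pd j α) (μ • x) * sinL l x)) := by
  rw [funext (pd_dilate_sinL hα l μ j),
    pd_add (smooth_differentiableAt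
        (contDiff_const.mul (smooth_dilate_sinL (contDiff_pd hα j) l μ)) x)
      (smooth_differentiableAt (contDiff_const.mul (smooth_dilate_cosL hα l μ)) x),
    pd_const_mul _ (smooth_differentiableAt (smooth_dilate_sinL (contDiff_pd hα j) l μ) x),
    pd_const_mul _ (smooth_differentiableAt (smooth_dilate_cosL hα l μ) x),
    pd_dilate_sinL (contDiff_pd hα j), pd_dilate_cosL hα]
  ring

end perturbation

section perturbation

variable {ℓ : Fin 10 → Sp 3} {c : Fin 10 → Fin 4 → Fin 4 → ℝ} {κ : Fin 4 → Fin 10}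

lemma contDiff_baseMap {a : Fin 10 → Sp 3 → ℝ} {r : Sp 3 → ℝ} (ha : ∀ k, ContDiff ℝ (⊤ : ℕ∞) (a k))
    (hr : ContDiff ℝ (⊤ : ℕ∞) r) (μ : ℝ) (s : PIdx) :
    ContDiff ℝ (⊤ : ℕ∞) (baseMap ℓ a r μ s) := by
  rcases s with k | k | _
  · exact smooth_dilate_cosL (ha k) _ μ
  · exact smooth_dilate_sinL (ha k) _ μ
  · exact contDiff_const.mul (contDiff_dilate hr μ)

lemma pd_baseMap_unit {r : Sp 3 → ℝ} (hr : ContDiff ℝ (⊤ : ℕ∞) r) {μ : ℝ} (hμ : μ ≠ 0) (i : Fin 4)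
    (y : Sp 3) : pd i (fun y => μ⁻¹ * r (μ • y)) y = pd i r (μ • y) := by
  rw [pd_const_mul _ (smooth_differentiableAt (contDiff_dilate hr μ) y), pd_dilate hr, smul_eq_mul,
    inv_mul_cancel_left₀ hμ]

lemma sum_coefP (IA : Fin 10 → Sp 3 → ℝ) (μ : ℝ) (k : Fin 10) (y : Sp 3) (z : Idx → ℝ) :
    ∑ j, coefP c IA μ k j y * z j
      = -(IA k (μ • y) * ∑ p, ∑ q, c k p q * z (.inr (.inr (p, q)))) := by
  simp only [Fintype.sum_sum_type, coefP, zero_mul, Finset.sum_const_zero, zero_add,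
    Fintype.sum_prod_type, Finset.mul_sum, ← Finset.sum_neg_distrib]
  exact Finset.sum_congr rfl fun p _ => Finset.sum_congr rfl fun q _ => by ring

lemma sum_coefQ (IA : Fin 10 → Sp 3 → ℝ) (B : Fin 4 → Sp 3 → ℝ) (μ : ℝ) (k : Fin 10) (y : Sp 3)
    (z : Idx → ℝ) :
    ∑ j, coefQ κ IA B μ k j y * z j = IA k (μ • y) *
      ∑ i, (if κ i = k then 1 / 2 else 0) * (z (.inr (.inl i)) - B i (μ • y) * z (.inl ())) := by
  simp only [Fintype.sum_sum_type, coefQ, zero_mul, Finset.sum_const_zero, add_zero,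
    Finset.univ_unique, Finset.sum_singleton, neg_mul, Finset.sum_mul, Finset.mul_sum,
    ← Finset.sum_neg_distrib]
  rw [← Finset.sum_add_distrib]
  exact Finset.sum_congr rfl fun p _ => by ring

variable {a : Fin 10 → Sp 3 → ℝ} {r : Sp 3 → ℝ} {IA : Fin 10 → Sp 3 → ℝ} {IR : Sp 3 → ℝ}
  {B : Fin 4 → Sp 3 → ℝ} {A₀ : Fin 10 → Sp 3 → ℝ} {A₁ : Fin 4 → Fin 10 → Sp 3 → ℝ}
  {A₂ : Fin 4 → Fin 4 → Fin 10 → Sp 3 → ℝ} {R₂ : Fin 4 → Fin 4 → Sp 3 → ℝ} {μ : ℝ} {y : Sp 3}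
  {z : Idx → ℝ} {v : PIdx → ℝ}

lemma linearized_zero (hμ : μ ≠ 0) (hA : ∀ k, A₀ k (μ • y) = a k (μ • y))
    (hIR : r (μ • y) * IR (μ • y) = 1) (hv : ∀ s, v s = ∑ j, coefE ℓ c κ IA IR B μ s j y * z j) :
    μ * ∑ s, baseMap ℓ a r μ s y * v s
      = z (.inl ()) + μ * ∑ s, coefL ℓ A₀ A₁ A₂ R₂ μ (.inl ()) s y * v s := by
  have hvr : v (.inr (.inr ())) = IR (μ • y) * z (.inl ()) := by
    rw [hv]; simp [Fintype.sum_sum_type, coefE]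
  simp only [Fintype.sum_sum_type, baseMap, coefL, hA, Finset.univ_unique, Finset.sum_singleton,
    PUnit.default_eq_unit, hvr, zero_mul, add_zero, mul_add]
  have : μ * (μ⁻¹ * r (μ • y) * (IR (μ • y) * z (.inl ()))) = z (.inl ()) := by
    calc _ = (μ * μ⁻¹) * (r (μ • y) * IR (μ • y)) * z (.inl ()) := by ring
      _ = _ := by rw [mul_inv_cancel₀ hμ, hIR]; ring
  linarith

lemma linearized_one (hμ : μ ≠ 0) (ha : ∀ k, ContDiff ℝ (⊤ : ℕ∞) (a k))
    (hr : ContDiff ℝ (⊤ : ℕ∞) r) (hκ : ∀ i, ℓ (κ i) = Pi.single i 2)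
    (hA : ∀ i k, A₁ i k (μ • y) = pd i (a k) (μ • y))
    (hIA : ∀ k, a k (μ • y) * IA k (μ • y) = 1)
    (hB : ∀ i, B i (μ • y) = pd i r (μ • y) * IR (μ • y))
    (hv : ∀ s, v s = ∑ j, coefE ℓ c κ IA IR B μ s j y * z j) (i : Fin 4) :
    ∑ s, pd i (baseMap ℓ a r μ s) y * v s = z (.inr (.inl i))
      + μ * ∑ s, coefL ℓ A₀ A₁ A₂ R₂ μ (.inr (.inl i)) s y * v s := by
  have hvr : v (.inr (.inr ())) = IR (μ • y) * z (.inl ()) := by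
    rw [hv]; simp [Fintype.sum_sum_type, coefE]
  have hq : ∀ k, -sinL (ℓ k) y * v (.inl k) + cosL (ℓ k) y * v (.inr (.inl k))
      = ∑ j, coefQ κ IA B μ k j y * z j := fun k => by
    rw [hv, hv, Finset.mul_sum, Finset.mul_sum, ← Finset.sum_add_distrib]
    refine Finset.sum_congr rfl fun j _ => ?_
    simp only [coefE]
    linear_combination (coefQ κ IA B μ k j y * z j) * cosL_sq_add (ℓ k) y
  have hmain : ∑ k, a k (μ • y) * ℓ k i *
      (-sinL (ℓ k) y * v (.inl k) + cosL (ℓ k) y * v (.inr (.inl k)))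
      = z (.inr (.inl i)) - B i (μ • y) * z (.inl ()) := by
    simp only [hq, sum_coefQ]
    calc _ = ∑ k, ∑ j, (if κ j = k then ℓ k i * (1 / 2) *
            (z (.inr (.inl j)) - B j (μ • y) * z (.inl ())) else 0) := by
          refine Finset.sum_congr rfl fun k _ => ?_
          rw [Finset.mul_sum, Finset.mul_sum]
          refine Finset.sum_congr rfl fun j _ => ?_
          split_ifs
          · linear_combination (ℓ k i * (1 / 2) *
              (z (.inr (.inl j)) - B j (μ • y) * z (.inl ()))) * hIA k
          · ring
      _ = _ := by
          rw [Finset.sum_comm]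
          simp [hκ, Pi.single_apply]
  simp only [Fintype.sum_sum_type, baseMap, coefL, hA, Finset.univ_unique, Finset.sum_singleton,
    PUnit.default_eq_unit, zero_mul, add_zero, mul_add, pd_dilate_cosL (ha _),
    pd_dilate_sinL (ha _), pd_baseMap_unit hr hμ, hvr]
  rw [hB] at hmain
  have hsum : ∀ (X Y X' Y' W : Fin 10 → ℝ), (∀ k, X k + Y k - μ * X' k - μ * Y' k = W k) →
      ∑ k, X k + ∑ k, Y k - μ * ∑ k, X' k - μ * ∑ k, Y' k = ∑ k, W k := fun X Y X' Y' W h => by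
    simp only [Finset.mul_sum, ← Finset.sum_add_distrib, ← Finset.sum_sub_distrib, h]
  have := hsum _ _ (fun k => pd i (a k) (μ • y) * cosL (ℓ k) y * v (.inl k))
    (fun k => pd i (a k) (μ • y) * sinL (ℓ k) y * v (.inr (.inl k))) _ fun k => (by ring :
    (μ * (pd i (a k) (μ • y) * cosL (ℓ k) y) + -ℓ k i * (a k (μ • y) * sinL (ℓ k) y)) * v (.inl k)
    + (μ * (pd i (a k) (μ • y) * sinL (ℓ k) y) + ℓ k i * (a k (μ • y) * cosL (ℓ k) y))
      * v (.inr (.inl k)) - μ * (pd i (a k) (μ • y) * cosL (ℓ k) y * v (.inl k))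
      - μ * (pd i (a k) (μ • y) * sinL (ℓ k) y * v (.inr (.inl k)))
    = a k (μ • y) * ℓ k i *
      (-sinL (ℓ k) y * v (.inl k) + cosL (ℓ k) y * v (.inr (.inl k))))
  linarith

lemma linearized_two (hμ : μ ≠ 0) (ha : ∀ k, ContDiff ℝ (⊤ : ℕ∞) (a k))
    (hr : ContDiff ℝ (⊤ : ℕ∞) r)
    (hc : ∀ (h : Fin 4 → Fin 4 → ℝ) i j,
      ∑ k, (∑ p, ∑ q, c k p q * h p q) * ℓ k i * ℓ k j = (h i j + h j i) / 2)
    (hA : ∀ i k, A₁ i k (μ • y) = pd i (a k) (μ • y))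
    (hA₂ : ∀ i j k, A₂ i j k (μ • y) = pd i (pd j (a k)) (μ • y))
    (hR₂ : ∀ i j, R₂ i j (μ • y) = pd i (pd j r) (μ • y))
    (hIA : ∀ k, a k (μ • y) * IA k (μ • y) = 1)
    (hv : ∀ s, v s = ∑ j, coefE ℓ c κ IA IR B μ s j y * z j) (i j : Fin 4)
    (hz : z (.inr (.inr (i, j))) = z (.inr (.inr (j, i)))) :
    ∑ s, pd i (pd j (baseMap ℓ a r μ s)) y * v s = z (.inr (.inr (i, j)))
      + μ * ∑ s, coefL ℓ A₀ A₁ A₂ R₂ μ (.inr (.inr (i, j))) s y * v s := by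
  have hp : ∀ k, cosL (ℓ k) y * v (.inl k) + sinL (ℓ k) y * v (.inr (.inl k))
      = ∑ j, coefP c IA μ k j y * z j := fun k => by
    rw [hv, hv, Finset.mul_sum, Finset.mul_sum, ← Finset.sum_add_distrib]
    refine Finset.sum_congr rfl fun j _ => ?_
    simp only [coefE]
    linear_combination (coefP c IA μ k j y * z j) * cosL_sq_add (ℓ k) y
  have hmain : ∑ k, -(a k (μ • y) * ℓ k i * ℓ k j *
      (cosL (ℓ k) y * v (.inl k) + sinL (ℓ k) y * v (.inr (.inl k))))
      = z (.inr (.inr (i, j))) := by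
    simp only [hp, sum_coefP]
    have h1 := hc (fun p q => z (.inr (.inr (p, q)))) i j
    rw [← hz, add_self_div_two] at h1
    rw [← h1]
    refine Finset.sum_congr rfl fun k _ => ?_
    linear_combination (ℓ k i * ℓ k j * ∑ p, ∑ q, c k p q * z (.inr (.inr (p, q)))) * hIA k
  have hunit : pd i (pd j fun y => μ⁻¹ * r (μ • y)) y = μ * pd i (pd j r) (μ • y) := by
    rw [funext (pd_baseMap_unit hr hμ j), pd_dilate (contDiff_pd hr j), smul_eq_mul]
  have hsum : ∀ (X Y X' Y' W : Fin 10 → ℝ), (∀ k, X k + Y k - μ * X' k - μ * Y' k = W k) →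
      ∑ k, X k + ∑ k, Y k - μ * ∑ k, X' k - μ * ∑ k, Y' k = ∑ k, W k := fun X Y X' Y' W h => by
    simp only [Finset.mul_sum, ← Finset.sum_add_distrib, ← Finset.sum_sub_distrib, h]
  have := hsum
    (fun k => pd i (pd j fun y => a k (μ • y) * cosL (ℓ k) y) y * v (.inl k))
    (fun k => pd i (pd j fun y => a k (μ • y) * sinL (ℓ k) y) y * v (.inr (.inl k)))
    (fun k => coefL ℓ A₀ A₁ A₂ R₂ μ (.inr (.inr (i, j))) (.inl k) y * v (.inl k))
    (fun k => coefL ℓ A₀ A₁ A₂ R₂ μ (.inr (.inr (i, j))) (.inr (.inl k)) y * v (.inr (.inl k)))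
    (fun k => -(a k (μ • y) * ℓ k i * ℓ k j *
      (cosL (ℓ k) y * v (.inl k) + sinL (ℓ k) y * v (.inr (.inl k))))) fun k => by
    simp only [pd_pd_dilate_cosL (ha _), pd_pd_dilate_sinL (ha _), coefL, hA, hA₂]
    ring
  rw [hmain] at this
  have hu : pd i (pd j (baseMap ℓ a r μ (.inr (.inr ())))) y
      = μ * coefL ℓ A₀ A₁ A₂ R₂ μ (.inr (.inr (i, j))) (.inr (.inr ())) y := by
    simp only [coefL, hR₂]
    exact hunit
  simp only [Fintype.sum_sum_type, Finset.univ_unique, Finset.sum_singleton,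
    PUnit.default_eq_unit, hu]
  simp only [baseMap]
  linarith

end perturbation

/-- If the first order equations hold near a point, the quadratic and second order equations at
that point give the induced metric of the perturbed map. -/
lemma sum_pd_mul_pd_add {A : Type*} [Fintype A] {f v : A → Sp 3 → ℝ} {N : Fin 4 → Sp 3 → ℝ}
    {y : Sp 3} {i j : Fin 4} {e q : ℝ} (hf : ∀ s, ContDiff ℝ (⊤ : ℕ∞) (f s))
    (hv : ∀ s, ContDiff ℝ (⊤ : ℕ∞) (v s)) (hN : ∀ i, ContDiff ℝ (⊤ : ℕ∞) (N i))
    (h1 : ∀ i, ∀ᶠ x in nhds y, ∑ s, pd i (f s) x * v s x = -N i x)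
    (h2 : ∑ s, pd i (pd j (f s)) y * v s y = e + 1 / 2 * q)
    (h3 : ∑ s, pd i (v s) y * pd j (v s) y = pd i (N j) y + pd j (N i) y + q) :
    ∑ s, pd i (fun x => f s x + v s x) y * pd j (fun x => f s x + v s x) y
      = ∑ s, pd i (f s) y * pd j (f s) y - 2 * e := by
  have key : ∀ i j, ∑ s, pd i (f s) y * pd j (v s) y
      + ∑ s, pd j (pd i (f s)) y * v s y = -pd j (N i) y := fun i j => by
    have hc := pd_congr (h1 i) j
    rw [pd_sum (f := fun s x => pd i (f s) x * v s x) _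
      fun s _ => smooth_differentiableAt ((contDiff_pd (hf s) i).mul (hv s)) y] at hc
    have hneg : pd j (fun x => -N i x) y = -pd j (N i) y := by
      have := pd_const_mul (-1) (smooth_differentiableAt (hN i) y) j
      simpa using this
    rw [hneg] at hc
    rw [← hc, ← Finset.sum_add_distrib]
    refine Finset.sum_congr rfl fun s _ => ?_
    rw [pd_mul (smooth_differentiableAt (contDiff_pd (hf s) i) y)
      (smooth_differentiableAt (hv s) y)]
  have hij := key j i
  have hji := key i j
  simp only [fun s => pd_comm (hf s) j i y] at hji
  have hexp : ∑ s, pd i (fun x => f s x + v s x) y * pd j (fun x => f s x + v s x) y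
      = ∑ s, pd i (f s) y * pd j (f s) y + ∑ s, pd i (f s) y * pd j (v s) y
        + ∑ s, pd j (f s) y * pd i (v s) y + ∑ s, pd i (v s) y * pd j (v s) y := by
    simp only [← Finset.sum_add_distrib]
    refine Finset.sum_congr rfl fun s _ => ?_
    rw [pd_add (smooth_differentiableAt (hf s) y) (smooth_differentiableAt (hv s) y),
      pd_add (smooth_differentiableAt (hf s) y) (smooth_differentiableAt (hv s) y)]
    ring
  rw [hexp, h3]
  linarith

section perturbation

variable {ℓ : Fin 10 → Sp 3} {c : Fin 10 → Fin 4 → Fin 4 → ℝ} {κ : Fin 4 → Fin 10}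

lemma sum_baseMap_sq (a : Fin 10 → Sp 3 → ℝ) (r : Sp 3 → ℝ) (μ : ℝ) (y : Sp 3) :
    ∑ s, baseMap ℓ a r μ s y ^ 2 = ∑ k, a k (μ • y) ^ 2 + (μ⁻¹ * r (μ • y)) ^ 2 := by
  simp only [Fintype.sum_sum_type, baseMap, Finset.univ_unique, Finset.sum_singleton]
  rw [← add_assoc, ← Finset.sum_add_distrib]
  congr 1
  refine Finset.sum_congr rfl fun k _ => ?_
  linear_combination (a k (μ • y)) ^ 2 * cosL_sq_add (ℓ k) y

lemma sum_pd_baseMap_mul {a : Fin 10 → Sp 3 → ℝ} {r : Sp 3 → ℝ}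
    (ha : ∀ k, ContDiff ℝ (⊤ : ℕ∞) (a k)) (hr : ContDiff ℝ (⊤ : ℕ∞) r) {μ : ℝ} (hμ : μ ≠ 0)
    (y : Sp 3) (i j : Fin 4) :
    ∑ s, pd i (baseMap ℓ a r μ s) y * pd j (baseMap ℓ a r μ s) y
      = ∑ k, a k (μ • y) ^ 2 * ℓ k i * ℓ k j + pd i r (μ • y) * pd j r (μ • y)
        + μ ^ 2 * ∑ k, pd i (a k) (μ • y) * pd j (a k) (μ • y) := by
  simp only [Fintype.sum_sum_type, baseMap, Finset.univ_unique, Finset.sum_singleton,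
    pd_dilate_cosL (ha _), pd_dilate_sinL (ha _), pd_baseMap_unit hr hμ]
  rw [← add_assoc, ← Finset.sum_add_distrib, add_right_comm, Finset.mul_sum,
    ← Finset.sum_add_distrib]
  congr 1
  refine Finset.sum_congr rfl fun k _ => ?_
  linear_combination (μ ^ 2 * pd i (a k) (μ • y) * pd j (a k) (μ • y)
    + a k (μ • y) ^ 2 * ℓ k i * ℓ k j) * cosL_sq_add (ℓ k) y

/-- Exact correction of the oscillating map: squares of linear forms plus the metric of the last
component are realised with prescribed length. -/
theorem exists_perturbation (hκ : ∀ i, ℓ (κ i) = Pi.single i 2)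
    (hc : ∀ (h : Fin 4 → Fin 4 → ℝ) i j,
      ∑ k, (∑ p, ∑ q, c k p q * h p q) * ℓ k i * ℓ k j = (h i j + h j i) / 2)
    {a : Fin 10 → Sp 3 → ℝ} {r : Sp 3 → ℝ} (ha : ∀ k, ContDiff ℝ (⊤ : ℕ∞) (a k))
    (hr : ContDiff ℝ (⊤ : ℕ∞) r) {K : Set (Sp 3)} (hK : IsCompact K)
    (ha0 : ∀ k, ∀ x ∈ K, 0 < a k x) (hr0 : ∀ x ∈ K, 0 < r x) :
    ∃ Θ : PIdx → Sp 3 → ℝ, (∀ s, ContDiff ℝ (⊤ : ℕ∞) (Θ s)) ∧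
      ∀ᶠ x in nhdsSet K, ∑ s, Θ s x ^ 2 = r x ^ 2 ∧ ∀ i j,
        ∑ s, pd i (Θ s) x * pd j (Θ s) x
          = ∑ k, a k x ^ 2 * ℓ k i * ℓ k j + pd i r x * pd j r x := by
  have inv_data : ∀ {f : Sp 3 → ℝ}, ContDiff ℝ (⊤ : ℕ∞) f → (∀ x ∈ K, 0 < f x) →
      ∃ f' : Sp 3 → ℝ, (∃ C, Wien f' C) ∧ ∀ᶠ x in nhdsSet K, f x * f' x = 1 := fun {f} hf h0 => by
    have hU : IsOpen {x | 0 < f x} := isOpen_lt continuous_const hf.continuous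
    obtain ⟨f', hw, he⟩ := exists_wien_of_contDiffOn (f := fun x => (f x)⁻¹) hU hK h0
      (hf.contDiffOn.inv fun x hx => ne_of_gt (show 0 < f x from hx))
    refine ⟨f', hw, ?_⟩
    filter_upwards [he, hU.mem_nhdsSet.mpr h0] with x h1 h2
    rw [h1]; exact mul_inv_cancel₀ (ne_of_gt h2)
  have data : ∀ {f : Sp 3 → ℝ}, ContDiff ℝ (⊤ : ℕ∞) f →
      ∃ f' : Sp 3 → ℝ, (∃ C, Wien f' C) ∧ ∀ᶠ x in nhdsSet K, f' x = f x := fun hf =>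
    exists_wien_of_contDiffOn isOpen_univ hK (Set.subset_univ K) hf.contDiffOn
  choose IA hIA hIAe using fun k => inv_data (ha k) (ha0 k)
  obtain ⟨IR, hIR, hIRe⟩ := inv_data hr hr0
  choose A₀ hA₀ hA₀e using fun k => data (ha k)
  choose A₁ hA₁ hA₁e using fun i k => data (contDiff_pd (ha k) i)
  choose A₂ hA₂ hA₂e using fun i j k => data (contDiff_pd (contDiff_pd (ha k) j) i)
  choose R₂ hR₂ hR₂e using fun i j => data (contDiff_pd (contDiff_pd hr j) i)
  choose R₁ hR₁ hR₁e using fun i => data (contDiff_pd hr i)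
  have hB : ∀ i, ∃ C, Wien (fun x => R₁ i x * IR x) C := fun i =>
    ⟨_, (hR₁ i).choose_spec.mul hIR.choose_spec⟩
  set B : Fin 4 → Sp 3 → ℝ := fun i x => R₁ i x * IR x with hBdef
  obtain ⟨C, hC0, hC⟩ := UW.exists_bound
    (F := fun (s : PIdx × Idx) μ => coefE ℓ c κ IA IR B μ s.1 s.2)
    fun s => uw_coefE hIA hIR hB s.1 s.2
  obtain ⟨ε, hε, H⟩ := gunther PIdx C hC0
  obtain ⟨μ₁, hμ₁, HD⟩ := UW.exists_small (ε := ε) (F := fun (s : Idx × Idx) μ y =>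
      ∑ t, coefL ℓ A₀ A₁ A₂ R₂ μ s.1 t y * coefE ℓ c κ IA IR B μ t s.2 y)
    (fun s => UW.sum _ fun t _ => (uw_coefL hA₀ hA₁ hA₂ hR₂ t s.1).mul
      (uw_coefE hIA hIR hB t s.2)) hε
  let e : Idx → ℝ → Sp 3 → ℝ := fun s μ y => match s with
    | .inl _ => -(1 / 2) * ∑ k, A₀ k (μ • y) * A₀ k (μ • y)
    | .inr (.inl _) => 0
    | .inr (.inr p) => 1 / 2 * (μ * ∑ k, A₁ p.1 k (μ • y) * A₁ p.2 k (μ • y))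
  have he : ∀ s, UW (e s) := fun s => by
    rcases s with _ | i | p
    · exact (UW.const _).mul (UW.sum _ fun k _ => (uw_dil (hA₀ k)).mul (uw_dil (hA₀ k)))
    · exact UW.const 0
    · exact (UW.const _).mul (UW.scale.mul
        (UW.sum _ fun k _ => (uw_dil (hA₁ _ k)).mul (uw_dil (hA₁ _ k))))
  obtain ⟨μ₂, hμ₂, He⟩ := UW.exists_small he hε
  obtain ⟨μ, hμ0, hμ⟩ : ∃ μ, 0 < μ ∧ μ ≤ min 1 (min μ₁ μ₂) :=
    ⟨_, lt_min one_pos (lt_min hμ₁ hμ₂), le_rfl⟩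
  have hμ1 : μ ≤ 1 := hμ.trans (min_le_left _ _)
  obtain ⟨z, v, N, Q, hz, hv, hN, hvz, e0, e1, e2, eq⟩ := H μ (coefE ℓ c κ IA IR B μ)
    (fun i j y => μ * ∑ t, coefL ℓ A₀ A₁ A₂ R₂ μ i t y * coefE ℓ c κ IA IR B μ t j y)
    (fun s y => μ * e s μ y) hμ0.le hμ1 (fun s j => hC (s, j) μ hμ0 hμ1)
    (fun i j => HD (i, j) μ hμ0 hμ1 (hμ.trans ((min_le_right _ _).trans (min_le_left _ _))))
    (fun s => He s μ hμ0 hμ1 (hμ.trans ((min_le_right _ _).trans (min_le_right _ _))))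
  have hne := hμ0.ne'
  have hDsum : ∀ i y, ∑ j, (μ * ∑ t, coefL ℓ A₀ A₁ A₂ R₂ μ i t y * coefE ℓ c κ IA IR B μ t j y)
      * z j y = μ * ∑ s, coefL ℓ A₀ A₁ A₂ R₂ μ i s y * v s y := fun i y => by
    simp only [hvz, Finset.mul_sum, Finset.sum_mul]
    rw [Finset.sum_comm]
    exact Finset.sum_congr rfl fun _ _ => Finset.sum_congr rfl fun _ _ => by ring
  simp only [hDsum] at e0 e1 e2
  have hf := contDiff_baseMap (ℓ := ℓ) ha hr μ
  set f := baseMap ℓ a r μ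
  have hall : ∀ᶠ x in nhdsSet K, (∀ k, a k x * IA k x = 1) ∧ r x * IR x = 1 ∧
      (∀ k, A₀ k x = a k x) ∧ (∀ i k, A₁ i k x = pd i (a k) x) ∧
      (∀ i j k, A₂ i j k x = pd i (pd j (a k)) x) ∧ (∀ i j, R₂ i j x = pd i (pd j r) x) ∧
      (∀ i, R₁ i x = pd i r x) := by
    filter_upwards [Filter.eventually_all.2 hIAe, hIRe, Filter.eventually_all.2 hA₀e,
      Filter.eventually_all.2 fun i => Filter.eventually_all.2 (hA₁e i),
      Filter.eventually_all.2 fun i => Filter.eventually_all.2 fun j =>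
        Filter.eventually_all.2 (hA₂e i j),
      Filter.eventually_all.2 fun i => Filter.eventually_all.2 (hR₂e i),
      Filter.eventually_all.2 hR₁e] with x h1 h2 h3 h4 h5 h6 h7
    exact ⟨h1, h2, h3, h4, h5, h6, h7⟩
  obtain ⟨V, hV, hKV, hVall⟩ := eventually_nhdsSet_iff_exists.mp hall
  have hW : IsOpen {y : Sp 3 | μ • y ∈ V} := hV.preimage (continuous_const_smul μ)
  have f0 : ∀ y, μ • y ∈ V → ∑ s, (f s y + v s y) ^ 2 = (μ⁻¹ * r (μ • y)) ^ 2 := fun y hy => by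
    obtain ⟨h1, h2, h3, h4, h5, h6, h7⟩ := hVall _ hy
    have hl := linearized_zero (a := a) (ℓ := ℓ) (c := c) (κ := κ) (IA := IA) (B := B) (A₁ := A₁)
      (A₂ := A₂) (R₂ := R₂) (z := fun s => z s y) (v := fun s => v s y) hne h3 h2 fun s => hvz s y
    rw [e0] at hl
    have hb := sum_baseMap_sq (ℓ := ℓ) a r μ y
    have hx : ∑ s, (f s y + v s y) ^ 2
        = ∑ s, f s y ^ 2 + 2 * ∑ s, f s y * v s y + ∑ s, v s y ^ 2 := by
      rw [Finset.mul_sum, ← Finset.sum_add_distrib, ← Finset.sum_add_distrib]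
      exact Finset.sum_congr rfl fun _ _ => by ring
    have h3' : ∑ k, A₀ k (μ • y) * A₀ k (μ • y) = ∑ k, a k (μ • y) ^ 2 :=
      Finset.sum_congr rfl fun k _ => by rw [h3]; ring
    simp only [e, h3'] at hl
    have hl' : ∑ s, f s y * v s y
        = -(1 / 2) * ∑ k, a k (μ • y) ^ 2 - 1 / 2 * ∑ s, v s y ^ 2 := by
      apply mul_left_cancel₀ hne
      rw [hl]; ring
    rw [hx, hb, hl']; ring
  have f1 : ∀ y, μ • y ∈ V → ∀ i, ∑ s, pd i (f s) y * v s y = -N i y := fun y hy i => by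
    obtain ⟨h1, h2, h3, h4, h5, h6, h7⟩ := hVall _ hy
    have hl := linearized_one (ℓ := ℓ) (c := c) (κ := κ) (A₀ := A₀) (A₁ := A₁) (B := B) (IR := IR)
      (A₂ := A₂) (R₂ := R₂) (z := fun s => z s y) (v := fun s => v s y) hne ha hr hκ h4 h1
      (fun i => by rw [hBdef]; simp only [h7]) (fun s => hvz s y) i
    rw [e1] at hl
    rw [hl]; simp [e]
  have f2 : ∀ y, μ • y ∈ V → ∀ i j, ∑ s, pd i (pd j (f s)) y * v s y
      = μ * e (.inr (.inr (i, j))) μ y + 1 / 2 * Q i j y := fun y hy i j => by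
    obtain ⟨h1, h2, h3, h4, h5, h6, h7⟩ := hVall _ hy
    have hQ : Q i j y = Q j i y := by
      have q1 := eq i j y
      have q2 := eq j i y
      have : ∑ s, pd i (v s) y * pd j (v s) y = ∑ s, pd j (v s) y * pd i (v s) y :=
        Finset.sum_congr rfl fun _ _ => mul_comm _ _
      linarith
    have hL : ∀ s, coefL ℓ A₀ A₁ A₂ R₂ μ (.inr (.inr (i, j))) s y
        = coefL ℓ A₀ A₁ A₂ R₂ μ (.inr (.inr (j, i))) s y := fun s => by
      rcases s with k | k | _
      · simp only [coefL, h5, pd_comm (ha k) i j]; ring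
      · simp only [coefL, h5, pd_comm (ha k) i j]; ring
      · simp only [coefL, h6, pd_comm hr i j]
    have hes : e (.inr (.inr (i, j))) μ y = e (.inr (.inr (j, i))) μ y := by
      simp only [e, mul_comm (A₁ i _ _)]
    have hzs : z (.inr (.inr (i, j))) y = z (.inr (.inr (j, i))) y := by
      have z1 := e2 i j y
      have z2 := e2 j i y
      simp only [hL, hQ, hes] at z1
      linarith
    have hl := linearized_two (ℓ := ℓ) (c := c) (κ := κ) (A₀ := A₀) (A₁ := A₁) (B := B) (IR := IR)
      (A₂ := A₂) (R₂ := R₂) (z := fun s => z s y) (v := fun s => v s y) hne ha hr hc h4 h5 h6 h1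
      (fun s => hvz s y) i j hzs
    rw [e2] at hl
    exact hl
  have hg : ∀ s, ContDiff ℝ (⊤ : ℕ∞) fun y => f s y + v s y := fun s => (hf s).add (hv s)
  refine ⟨fun s x => μ * (f s (μ⁻¹ • x) + v s (μ⁻¹ • x)),
    fun s => contDiff_const.mul (contDiff_dilate (hg s) μ⁻¹), ?_⟩
  refine eventually_nhdsSet_iff_exists.mpr ⟨V, hV, hKV, fun x hx => ?_⟩
  set y := μ⁻¹ • x with hy
  have hxy : μ • y = x := smul_inv_smul₀ hne x
  have hyV : μ • y ∈ V := hxy ▸ hx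
  constructor
  · have := f0 y hyV
    rw [hxy] at this
    calc ∑ s, (μ * (f s y + v s y)) ^ 2 = μ ^ 2 * ∑ s, (f s y + v s y) ^ 2 := by
          simp only [mul_pow, ← Finset.mul_sum]
      _ = r x ^ 2 := by rw [this]; field_simp
  · intro i j
    have hpd : ∀ s i, pd i (fun x => μ * (f s (μ⁻¹ • x) + v s (μ⁻¹ • x))) x
        = pd i (fun y => f s y + v s y) y := fun s i => by
      rw [pd_const_mul (f := fun x => f s (μ⁻¹ • x) + v s (μ⁻¹ • x)) _
        (smooth_differentiableAt (contDiff_dilate (hg s) μ⁻¹) x), pd_dilate (hg s), smul_eq_mul,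
        mul_inv_cancel_left₀ hne]
    simp only [hpd]
    obtain ⟨h1, h2, h3, h4, h5, h6, h7⟩ := hVall _ hyV
    rw [sum_pd_mul_pd_add hf hv hN
      (fun i => Filter.eventually_of_mem (hW.mem_nhds hyV) fun y hy => f1 y hy i) (f2 y hyV i j) (eq i j y),
      sum_pd_baseMap_mul ha hr hne, hxy]
    rw [hxy] at h4
    simp only [e, hxy, h4]
    ring

end perturbation

lemma exists_orthonormal_assembly {ι : Type*} [Fintype ι] {m : ℕ} (hm : Fintype.card ι ≤ m)
    {Θ : ι → Sp 3 → ℝ} (hΘ : ∀ s, ContDiff ℝ (⊤ : ℕ∞) (Θ s)) :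
    ∃ θ : Sp 3 → Em m, ContDiff ℝ (⊤ : ℕ∞) θ ∧ (∀ x, ‖θ x‖ ^ 2 = ∑ s, Θ s x ^ 2) ∧
      (∀ i j x, ⟪pd i θ x, pd j θ x⟫ = ∑ s, pd i (Θ s) x * pd j (Θ s) x) ∧
      ∀ x y, θ x = θ y → ∀ s, Θ s x = Θ s y := by
  obtain ⟨φ⟩ : Nonempty (ι ↪ Fin m) := Function.Embedding.nonempty_of_card_le (by simpa using hm)
  let b : ι → Em m := fun s => EuclideanSpace.basisFun (Fin m) ℝ (φ s)
  have hb : Orthonormal ℝ b := (EuclideanSpace.basisFun (Fin m) ℝ).orthonormal.comp φ φ.injective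
  have hin : ∀ l l' : ι → ℝ, ⟪∑ s, l s • b s, ∑ s, l' s • b s⟫ = ∑ s, l s * l' s := fun l l' => by
    simpa using hb.inner_sum l l' Finset.univ
  have hsm : ∀ s, ContDiff ℝ (⊤ : ℕ∞) fun x => Θ s x • b s := fun s =>
    (hΘ s).smul contDiff_const
  have hpd : ∀ i x, pd i (fun x => ∑ s, Θ s x • b s) x = ∑ s, pd i (Θ s) x • b s := fun i x => by
    rw [pd_sum (f := fun s x => Θ s x • b s) _ fun s _ => smooth_differentiableAt (hsm s) x]
    refine Finset.sum_congr rfl fun s _ => ?_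
    rw [pd_smul (smooth_differentiableAt (hΘ s) x) (differentiableAt_const _), pd_const, smul_zero,
      zero_add]
  refine ⟨fun x => ∑ s, Θ s x • b s, ContDiff.sum fun s _ => hsm s, fun x => ?_, fun i j x => ?_,
    fun x y h s => ?_⟩
  · rw [← real_inner_self_eq_norm_sq, hin]
    exact Finset.sum_congr rfl fun _ _ => (sq _).symm
  · rw [hpd, hpd, hin]
  · have h1 : ∀ x, ⟪b s, ∑ t, Θ t x • b t⟫ = Θ s x := fun x => by
      simpa using hb.inner_right_fintype (fun t => Θ t x) s
    rw [← h1 x, ← h1 y]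
    exact congrArg _ h

/-- A continuous family of positive definite forms on a compact set dominates a small multiple of
any fixed form. -/
lemma exists_pos_forall_posSemidef_sub {g : Fin 4 → Fin 4 → Sp 3 → ℝ}
    (hg : ∀ i j, Continuous (g i j)) {K : Set (Sp 3)} (hK : IsCompact K)
    (hp : ∀ x ∈ K, (Matrix.of fun i j => g i j x).PosDef) (h₀ : Fin 4 → Fin 4 → ℝ)
    (hs : ∀ i j, h₀ i j = h₀ j i) :
    ∃ t > 0, ∀ x ∈ K, (Matrix.of fun i j => g i j x - t * h₀ i j).PosSemidef := by
  let Q : ℝ → Sp 3 × Sp 3 → ℝ := fun t p =>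
    ∑ i, ∑ j, p.2 i * ((g i j p.1 - t * h₀ i j) * p.2 j)
  have hQ : Continuous fun q : ℝ × (Sp 3 × Sp 3) => Q q.1 q.2 := by
    have := fun i j => (hg i j).comp (continuous_fst.comp (continuous_snd (X := ℝ) (Y := Sp 3 × Sp 3)))
    simp only [Function.comp_def] at this
    refine continuous_finsetSum _ fun i _ => continuous_finsetSum _ fun j _ => ?_
    have := this i j
    fun_prop
  have hform : ∀ (t : ℝ) (x v : Sp 3),
      dotProduct (star v) ((Matrix.of fun i j => g i j x - t * h₀ i j).mulVec v) = Q t (x, v) :=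
    fun t x v => by
      simp only [dotProduct, Matrix.mulVec, Matrix.of_apply, Q, Finset.mul_sum, Pi.star_apply,
        star_trivial]
  have hform0 : ∀ x v : Sp 3,
      dotProduct (star v) ((Matrix.of fun i j => g i j x).mulVec v) = Q 0 (x, v) := fun x v => by
    rw [← hform]; simp
  have hS : IsCompact (K ×ˢ Metric.sphere (0 : Sp 3) 1) := hK.prod (isCompact_sphere _ _)
  have hev : ∀ᶠ t in nhds (0 : ℝ), ∀ p ∈ K ×ˢ Metric.sphere (0 : Sp 3) 1, 0 < Q t p := by
    refine hS.eventually_forall_of_forall_eventually fun p hp' => ?_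
    have h0 : 0 < Q 0 p := by
      have hv : p.2 ≠ 0 := fun h => by
        have := hp'.2
        rw [h] at this; simp at this
      have := (hp p.1 hp'.1).dotProduct_mulVec_pos hv
      rwa [hform0] at this
    exact continuous_const.continuousAt.eventually_lt hQ.continuousAt h0
  obtain ⟨t, ht, ht0⟩ := ((hev.filter_mono nhdsWithin_le_nhds).and self_mem_nhdsWithin :
    ∀ᶠ t in nhdsWithin (0 : ℝ) (Set.Ioi 0), _).exists
  refine ⟨t, ht0, fun x hx => Matrix.PosSemidef.of_dotProduct_mulVec_nonneg ?_ fun v => ?_⟩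
  · ext i j
    have := (hp x hx).isHermitian.apply i j
    simp only [Matrix.of_apply, star_trivial] at this
    simp [Matrix.conjTranspose_apply, this, hs i j]
  · rw [hform]
    rcases eq_or_ne v 0 with rfl | hv
    · simp [Q]
    · have hn : 0 < ‖v‖ := norm_pos_iff.mpr hv
      have h1 := ht (x, ‖v‖⁻¹ • v) ⟨hx, by simp [norm_smul, hn.ne']⟩
      have h2 : Q t (x, ‖v‖⁻¹ • v) = (‖v‖⁻¹) ^ 2 * Q t (x, v) := by
        simp only [Q, Pi.smul_apply, smul_eq_mul, Finset.mul_sum]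
        exact Finset.sum_congr rfl fun _ _ => Finset.sum_congr rfl fun _ _ => by ring
      rw [h2] at h1
      exact (pos_of_mul_pos_right h1 (by positivity)).le

lemma exists_contDiff_sqrt {f : Sp 3 → ℝ} (hf : ContDiff ℝ (⊤ : ℕ∞) f) {K : Set (Sp 3)}
    (hK : IsCompact K) (h0 : ∀ x ∈ K, 0 < f x) :
    ∃ s : Sp 3 → ℝ, ContDiff ℝ (⊤ : ℕ∞) s ∧ (∀ x ∈ K, 0 < s x) ∧
      ∀ᶠ x in nhdsSet K, s x ^ 2 = f x := by
  have hU : IsOpen {x | 0 < f x} := isOpen_lt continuous_const hf.continuous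
  obtain ⟨s, hs, V, hV, hKV, hVU, he⟩ := exists_contDiff_eqOn (f := fun x => √(f x)) hU hK h0
    (hf.contDiffOn.sqrt fun x hx => ne_of_gt (show 0 < f x from hx))
  refine ⟨s, hs, fun x hx => ?_, eventually_nhdsSet_iff_exists.mpr ⟨V, hV, hKV, fun x hx => ?_⟩⟩
  · rw [he x (hKV hx)]; exact Real.sqrt_pos.mpr (h0 x hx)
  · rw [he x hx]; exact Real.sq_sqrt (le_of_lt (hVU hx))

lemma exists_small_parameter {τ R H : ℝ} (hτ : 0 < τ) (hR : 0 ≤ R) (hH : 0 ≤ H) :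
    ∃ η, 0 < η ∧ η ≤ 1 / 2 ∧ η * (4 * R) ≤ 1 ∧
      η + η ^ 2 + 2 * (η * (R + H + 1)) ^ 2 ≤ τ := by
  set L := R + H + 1
  have hL : 0 < L := by positivity
  have h1 : 0 < 1 / (4 * R + 1) := by positivity
  have h2 : 0 < τ / (2 + 2 * L ^ 2) := by positivity
  obtain ⟨η, h0, hη⟩ : ∃ η, 0 < η ∧ η ≤ min (1 / 2) (min (1 / (4 * R + 1)) (τ / (2 + 2 * L ^ 2))) :=
    ⟨_, lt_min (by norm_num) (lt_min h1 h2), le_rfl⟩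
  have hη1 := hη.trans (min_le_left _ _)
  have hη2 := (hη.trans (min_le_right _ _)).trans (min_le_left _ _)
  have hη3 := (hη.trans (min_le_right _ _)).trans (min_le_right _ _)
  rw [le_div_iff₀ (by positivity)] at hη2 hη3
  refine ⟨η, h0, hη1, by linarith, ?_⟩
  have h3 : η ^ 2 ≤ η := by nlinarith
  have h4 : (η * L) ^ 2 ≤ η * L ^ 2 := by
    rw [mul_pow]; exact mul_le_mul_of_nonneg_right h3 (sq_nonneg _)
  linarith

lemma pd_norm_sq {n : ℕ} {F : Sp 3 → Em n} (hF : ContDiff ℝ (⊤ : ℕ∞) F) (i : Fin 4) (x : Sp 3) :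
    pd i (fun y => ∑ j, F y j ^ 2) x = 2 * ⟪F x, pd i F x⟫ := by
  have h := pd_inner (smooth_differentiableAt hF x) (smooth_differentiableAt hF x) i
  have h2 : (fun y => ∑ j, F y j ^ 2) = fun y => ⟪F y, F y⟫ := by
    funext y
    rw [real_inner_self_eq_norm_sq, EuclideanSpace.real_norm_sq_eq]
  rw [h2, h, real_inner_comm (F x) (pd i F x)]
  ring

lemma pd_coord (k i : Fin 4) (x : Sp 3) : pd i (fun y => y k) x = if i = k then 1 else 0 := by
  have := pd_of_hasFDerivAt (hasFDerivAt_apply (𝕜 := ℝ) k x) i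
  rw [this]
  simp [Pi.single_apply, eq_comm]

lemma pd_coord_sq (i : Fin 4) (x : Sp 3) : pd i (fun y => ∑ k, y k ^ 2) x = 2 * x i := by
  have hd : ∀ k, DifferentiableAt ℝ (fun y : Sp 3 => y k) x := fun k => differentiableAt_apply k x
  simp only [pow_two]
  rw [pd_sum (f := fun k (y : Sp 3) => y k * y k) _ fun k _ => (hd k).mul (hd k)]
  simp only [pd_mul (hd _) (hd _), pd_coord]
  simp [Finset.sum_add_distrib, two_mul]

lemma pd_apply {n : ℕ} {F : Sp 3 → Em n} (hF : ContDiff ℝ (⊤ : ℕ∞) F) (i : Fin 4) (x : Sp 3)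
    (j : Fin n) : pd i (fun y => F y j) x = pd i F x j := by
  have h := (EuclideanSpace.proj (𝕜 := ℝ) j).hasFDerivAt.comp x
    (smooth_differentiableAt hF x).hasFDerivAt
  have h2 : pd i (fun y => F y j) x
      = ((EuclideanSpace.proj (𝕜 := ℝ) j).comp (fderiv ℝ F x)) (Pi.single i 1) :=
    pd_of_hasFDerivAt h i
  rw [h2]; rfl

/-- A smooth Riemannian metric near a compact subset of `ℝ⁴` is induced by a map to a sphere. -/
theorem exists_isometric_sphere {g : Fin 4 → Fin 4 → Sp 3 → ℝ}
    (hg : ∀ i j, ContDiff ℝ (⊤ : ℕ∞) (g i j)) (hsym : ∀ i j x, g i j x = g j i x)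
    {K : Set (Sp 3)} (hK : IsCompact K)
    (hp : ∀ x ∈ K, (Matrix.of fun i j => g i j x).PosDef) {m : ℕ} (hm : 35 ≤ m) :
    ∃ θ : Sp 3 → Em m, ContDiff ℝ (⊤ : ℕ∞) θ ∧
      (∀ᶠ x in nhdsSet K, ‖θ x‖ = 1 ∧ ∀ i j, ⟪pd i θ x, pd j θ x⟫ = g i j x) ∧
      Function.Injective θ := by
  obtain ⟨ℓ, c, κ, -, hκ, hc, hc1⟩ := exists_squares
  set h₀ : Fin 4 → Fin 4 → ℝ := fun p q => ∑ l, ℓ l p * ℓ l q with hh₀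
  obtain ⟨t, ht, htK⟩ := exists_pos_forall_posSemidef_sub (fun i j => (hg i j).continuous) hK hp h₀
    fun i j => by simp only [hh₀, mul_comm]
  set h : Fin 4 → Fin 4 → Sp 3 → ℝ := fun i j x => g i j x - t * h₀ i j
  have hhc : ∀ i j, Continuous (h i j) := fun i j => (hg i j).continuous.sub continuous_const
  obtain ⟨R, hR0, hR⟩ : ∃ R, 0 ≤ R ∧ ∀ x ∈ K, ∀ i, |x i| ≤ R := by
    obtain ⟨R, hR⟩ := hK.isBounded.exists_norm_le
    exact ⟨max R 0, le_max_right _ _, fun x hx i =>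
      ((norm_le_pi_norm x i).trans (hR x hx)).trans (le_max_left _ _)⟩
  obtain ⟨H, hH0, hH⟩ : ∃ H, 0 ≤ H ∧ ∀ x ∈ K, ∀ i, h i i x ≤ H := by
    have : ∀ i, ∃ C, ∀ x ∈ K, ‖h i i x‖ ≤ C := fun i =>
      hK.exists_bound_of_continuousOn (hhc i i).continuousOn
    choose C hC using this
    refine ⟨∑ i, |C i|, Finset.sum_nonneg fun _ _ => abs_nonneg _, fun x hx i => ?_⟩
    have h1 := Finset.single_le_sum (f := fun i => |C i|) (fun _ _ => abs_nonneg _)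
      (Finset.mem_univ i)
    exact ((le_abs_self _).trans ((hC i x hx).trans (le_abs_self _))).trans h1
  set cs := ∑ k, ∑ p, ∑ q, |c k p q|
  have hsc : 0 ≤ cs := Finset.sum_nonneg fun _ _ => Finset.sum_nonneg fun _ _ =>
    Finset.sum_nonneg fun _ _ => abs_nonneg _
  obtain ⟨η, hη0, hη1, hηR, hητ⟩ := exists_small_parameter (τ := t / (cs + 1)) (by positivity) hR0 hH0
  obtain ⟨F, hF, hFK⟩ := exists_approx_isometric hhc hK htK hη0
  set q : Sp 3 → ℝ := fun x => 1 - η ^ 2 * ∑ k, x k ^ 2 - ∑ j, F x j ^ 2 with hq_def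
  have hFj : ∀ j, ContDiff ℝ (⊤ : ℕ∞) fun x => F x j := fun j =>
    (EuclideanSpace.proj (𝕜 := ℝ) j).contDiff.comp hF
  have hX2 : ContDiff ℝ (⊤ : ℕ∞) fun x : Sp 3 => ∑ k, x k ^ 2 :=
    ContDiff.sum fun k _ => (contDiff_apply ℝ ℝ k).pow 2
  have hF2 : ContDiff ℝ (⊤ : ℕ∞) fun x => ∑ j, F x j ^ 2 := ContDiff.sum fun j _ => (hFj j).pow 2
  have hq : ContDiff ℝ (⊤ : ℕ∞) q := (contDiff_const.sub (contDiff_const.mul hX2)).sub hF2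
  have hqK : ∀ x ∈ K, 1 / 2 ≤ q x := fun x hx => by
    have h1 : ∑ j, F x j ^ 2 ≤ 1 / 4 := by
      rw [← EuclideanSpace.real_norm_sq_eq]
      have := (hFK x hx).1
      have h0 := norm_nonneg (F x)
      nlinarith
    have h2 : ∑ k, x k ^ 2 ≤ 4 * R ^ 2 := by
      calc ∑ k, x k ^ 2 ≤ ∑ _k : Fin 4, R ^ 2 :=
            Finset.sum_le_sum fun k _ => sq_le_sq' (abs_le.mp (hR x hx k)).1 (abs_le.mp (hR x hx k)).2
        _ = 4 * R ^ 2 := by simp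
    have h3 : η ^ 2 * (4 * R ^ 2) ≤ 1 / 4 := by
      have : 0 ≤ η * (4 * R) := by positivity
      nlinarith
    have h4 := mul_le_mul_of_nonneg_left h2 (sq_nonneg η)
    simp only [q]; linarith
  obtain ⟨r, hr, hr0, hre⟩ := exists_contDiff_sqrt hq hK fun x hx => by
    have := hqK x hx; linarith
  have hpdq : ∀ i x, pd i q x = -2 * (η ^ 2 * x i + ⟪F x, pd i F x⟫) := fun i x => by
    have e1 : q = fun y => 1 + ((-η ^ 2) * ∑ k, y k ^ 2 + (-1) * ∑ j, F y j ^ 2) := by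
      funext y; simp only [q]; ring
    rw [e1, pd_add (differentiableAt_const _) (smooth_differentiableAt
        ((contDiff_const.mul hX2).add (contDiff_const.mul hF2)) x), pd_const,
      pd_add (smooth_differentiableAt (contDiff_const.mul hX2) x)
        (smooth_differentiableAt (contDiff_const.mul hF2) x),
      pd_const_mul _ (smooth_differentiableAt hX2 x), pd_const_mul _ (smooth_differentiableAt hF2 x),
      pd_coord_sq, pd_norm_sq hF]
    ring
  have hrpd : ∀ x ∈ K, ∀ i, r x * pd i r x = -(η ^ 2 * x i + ⟪F x, pd i F x⟫) := fun x hx i => by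
    have hnear : (fun y => r y * r y) =ᶠ[nhds x] q := by
      filter_upwards [hre.filter_mono (nhds_le_nhdsSet hx)] with y hy
      rw [← hy, sq]
    have := pd_congr hnear i
    rw [pd_mul (smooth_differentiableAt hr x) (smooth_differentiableAt hr x), hpdq] at this
    linarith
  have hdr : ∀ x ∈ K, ∀ i, |r x * pd i r x| ≤ η * (R + H + 1) := fun x hx i => by
    have h1 : ‖pd i F x‖ ≤ H + 1 := by
      have := (abs_le.mp ((hFK x hx).2 i i)).2
      rw [real_inner_self_eq_norm_sq] at this
      have := hH x hx i
      refine le_of_sq_le_sq ?_ (by positivity)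
      nlinarith
    have h2 : |⟪F x, pd i F x⟫| ≤ η * (H + 1) :=
      (abs_real_inner_le_norm _ _).trans (mul_le_mul (hFK x hx).1 h1 (norm_nonneg _) hη0.le)
    have h3 : |η ^ 2 * x i| ≤ η * R := by
      rw [abs_mul, abs_of_nonneg (sq_nonneg η)]
      have := mul_le_mul_of_nonneg_left (hR x hx i) (sq_nonneg η)
      have h4 : η ^ 2 ≤ η := by nlinarith
      exact this.trans (mul_le_mul_of_nonneg_right h4 hR0)
    rw [hrpd x hx i, abs_neg]
    refine (abs_add_le _ _).trans ?_
    linarith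
  have hdrr : ∀ x ∈ K, ∀ i j, |pd i r x * pd j r x| ≤ 2 * (η * (R + H + 1)) ^ 2 :=
    fun x hx i j => by
      have h1 := hdr x hx i
      have h2 := hdr x hx j
      have h3 : r x ^ 2 = q x := (subset_of_mem_nhdsSet hre) hx
      have h4 := hqK x hx
      have h5 : |r x * pd i r x| * |r x * pd j r x| = q x * |pd i r x * pd j r x| := by
        rw [← abs_mul, ← h3, show r x * pd i r x * (r x * pd j r x)
          = r x ^ 2 * (pd i r x * pd j r x) by ring, abs_mul, abs_of_nonneg (sq_nonneg (r x))]
      have h6 : |r x * pd i r x| * |r x * pd j r x| ≤ (η * (R + H + 1)) ^ 2 := by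
        rw [sq]; exact mul_le_mul h1 h2 (abs_nonneg _) (by positivity)
      have h7 := mul_le_mul_of_nonneg_right h4 (abs_nonneg (pd i r x * pd j r x))
      linarith
  set h' : Fin 4 → Fin 4 → Sp 3 → ℝ := fun i j x =>
    g i j x - (if i = j then η ^ 2 else 0) - ⟪pd i F x, pd j F x⟫ - pd i r x * pd j r x
  have hh's : ∀ i j, ContDiff ℝ (⊤ : ℕ∞) (h' i j) := fun i j =>
    (((hg i j).sub contDiff_const).sub ((contDiff_pd hF i).inner ℝ (contDiff_pd hF j))).sub
      ((contDiff_pd hr i).mul (contDiff_pd hr j))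
  have hh'sym : ∀ i j x, h' i j x = h' j i x := fun i j x => by
    simp only [h', hsym i j, real_inner_comm (pd i F x), mul_comm (pd i r x), eq_comm (a := i)]
  have hclose : ∀ x ∈ K, ∀ i j, |h' i j x - t * h₀ i j| ≤ t / (cs + 1) := fun x hx i j => by
    refine le_trans ?_ hητ
    have e1 := (hFK x hx).2 i j
    have e2 := hdrr x hx i j
    have e3 : |if i = j then η ^ 2 else 0| ≤ η ^ 2 := by
      split_ifs
      · rw [abs_of_nonneg (sq_nonneg η)]
      · simp [sq_nonneg]
    rw [abs_le] at *
    simp only [h', h] at *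
    constructor <;> linarith [e1.1, e1.2, e2.1, e2.2, e3.1, e3.2]
  set A : Fin 10 → Sp 3 → ℝ := fun k x => ∑ p, ∑ q, c k p q * h' p q x
  have hA : ∀ k, ContDiff ℝ (⊤ : ℕ∞) (A k) := fun k =>
    ContDiff.sum fun p _ => ContDiff.sum fun q _ => contDiff_const.mul (hh's p q)
  have hApos : ∀ k, ∀ x ∈ K, 0 < A k x := fun k x hx => by
    have e1 : A k x = t * (∑ p, ∑ q, c k p q * h₀ p q)
        + ∑ p, ∑ q, c k p q * (h' p q x - t * h₀ p q) := by
      simp only [A, Finset.mul_sum, ← Finset.sum_add_distrib]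
      exact Finset.sum_congr rfl fun _ _ => Finset.sum_congr rfl fun _ _ => by ring
    have e0 : ∑ p, ∑ q, c k p q * h₀ p q = 1 := hc1 k
    rw [e0, mul_one] at e1
    have e2 : |∑ p, ∑ q, c k p q * (h' p q x - t * h₀ p q)| ≤ cs * (t / (cs + 1)) := by
      calc _ ≤ ∑ p, ∑ q, |c k p q| * (t / (cs + 1)) := by
            refine (Finset.abs_sum_le_sum_abs _ _).trans (Finset.sum_le_sum fun p _ =>
              (Finset.abs_sum_le_sum_abs _ _).trans (Finset.sum_le_sum fun q _ => ?_))
            rw [abs_mul]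
            exact mul_le_mul_of_nonneg_left (hclose x hx p q) (abs_nonneg _)
        _ = (∑ p, ∑ q, |c k p q|) * (t / (cs + 1)) := by simp only [Finset.sum_mul]
        _ ≤ _ := mul_le_mul_of_nonneg_right
            (Finset.single_le_sum (f := fun k => ∑ p, ∑ q, |c k p q|)
              (fun _ _ => Finset.sum_nonneg fun _ _ => Finset.sum_nonneg fun _ _ => abs_nonneg _)
              (Finset.mem_univ k)) (by positivity)
    have e3 : cs * (t / (cs + 1)) < t := by
      rw [mul_div_assoc', div_lt_iff₀ (by positivity)]; nlinarith
    have := (abs_le.mp e2).1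
    linarith
  choose a ha ha0 hae using fun k => exists_contDiff_sqrt (hA k) hK (hApos k)
  obtain ⟨Θ, hΘ, hΘe⟩ := exists_perturbation hκ hc ha hr hK ha0 hr0
  let T : Fin 4 ⊕ Fin 10 ⊕ PIdx → Sp 3 → ℝ := fun s => match s with
    | .inl k => fun x => η * x k
    | .inr (.inl j) => fun x => F x j
    | .inr (.inr s) => Θ s
  have hT : ∀ s, ContDiff ℝ (⊤ : ℕ∞) (T s) := fun s => by
    rcases s with k | j | s
    · exact contDiff_const.mul (contDiff_apply ℝ ℝ k)
    · exact hFj j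
    · exact hΘ s
  obtain ⟨θ, hθ, hθn, hθp, hθi⟩ := exists_orthonormal_assembly (m := m) (by simpa using hm) hT
  refine ⟨θ, hθ, ?_, fun x y hxy => funext fun k =>
    mul_left_cancel₀ hη0.ne' (hθi x y hxy (.inl k))⟩
  filter_upwards [hΘe, hre, Filter.eventually_all.2 hae] with x h1 h2 h3
  constructor
  · have : ‖θ x‖ ^ 2 = 1 := by
      rw [hθn]
      simp only [Fintype.sum_sum_type (α₁ := Fin 4), Fintype.sum_sum_type (α₁ := Fin 10) (α₂ := PIdx),
        T, h1.1, h2, hq_def, mul_pow, ← Finset.mul_sum]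
      ring
    exact (pow_eq_one_iff_of_nonneg (norm_nonneg _) two_ne_zero).mp this
  · intro i j
    have hX : ∀ (k i : Fin 4), pd i (fun y : Sp 3 => η * y k) x = η * if i = k then 1 else 0 :=
      fun k i => by rw [pd_const_mul _ (differentiableAt_apply k x), pd_coord]
    rw [hθp]
    simp only [Fintype.sum_sum_type (α₁ := Fin 4), Fintype.sum_sum_type (α₁ := Fin 10) (α₂ := PIdx),
      T, h1.2 i j, h3, hX, pd_apply hF]
    have e1 := hc (fun p q => h' p q x) i j
    rw [hh'sym j i, add_self_div_two] at e1
    have e2 : ∑ s, pd i F x s * pd j F x s = ⟪pd i F x, pd j F x⟫ := by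
      simp [PiLp.inner_apply, mul_comm]
    have e3 : ∑ k, (η * if i = k then 1 else 0) * (η * if j = k then 1 else 0)
        = if i = j then η ^ 2 else 0 := by
      simp [eq_comm (a := j), sq]
    rw [e1, e2, e3]
    simp only [h']
    ring

/-! ### Coordinates modulo the discrete scaling -/

/-- The map identifying the cone modulo scaling with a solid torus. -/
def torusMap (S : ℝ) (y : Sp 3) : Sp 3 :=
  ![(3 + y 1 / y 0) * Real.cos (2 * π / S * Real.log (y 0)),
    (3 + y 1 / y 0) * Real.sin (2 * π / S * Real.log (y 0)), y 2 / y 0, y 3 / y 0]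

/-- An open scaling invariant neighbourhood of the cone on which `torusMap` is a local
diffeomorphism. -/
def torusDomain : Set (Sp 3) := {y | 0 < y 0 ∧ 0 < 3 + y 1 / y 0}

lemma isOpen_torusDomain : IsOpen torusDomain := by
  have h0 : IsOpen {y : Sp 3 | 0 < y 0} := isOpen_lt continuous_const (continuous_apply 0)
  have h1 : IsOpen {y : Sp 3 | 0 < 3 * y 0 + y 1} := isOpen_lt continuous_const (by fun_prop)
  have : torusDomain = {y : Sp 3 | 0 < y 0} ∩ {y : Sp 3 | 0 < 3 * y 0 + y 1} := by
    ext y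
    simp only [torusDomain, Set.mem_inter_iff, Set.mem_ofPred_eq]
    refine and_congr_right fun h => ?_
    have : 3 + y 1 / y 0 = (3 * y 0 + y 1) / y 0 := by field_simp
    rw [this, div_pos_iff_of_pos_right h]
  rw [this]; exact h0.inter h1

lemma cone_subset_torusDomain : Cone 3 ⊆ torusDomain := fun y hy => by
  obtain ⟨h0, h1⟩ := hy
  refine ⟨h0, ?_⟩
  have h2 : y 1 ^ 2 ≤ y 0 ^ 2 := by
    rw [Fin.sum_univ_three] at h1
    have e1 : y (Fin.succ 0) = y 1 := rfl
    rw [e1] at h1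
    nlinarith [sq_nonneg (y (Fin.succ 1)), sq_nonneg (y (Fin.succ 2))]
  have h3 := (abs_le_of_sq_le_sq' h2 h0.le).1
  have : -1 ≤ y 1 / y 0 := by rw [le_div_iff₀ h0]; linarith
  linarith

lemma contDiffOn_torusMap (S : ℝ) : ContDiffOn ℝ (⊤ : ℕ∞) (torusMap S) torusDomain := by
  have hc : ∀ i : Fin 4, ContDiffOn ℝ (⊤ : ℕ∞) (fun y : Sp 3 => y i) torusDomain := fun i =>
    (contDiff_apply ℝ ℝ i).contDiffOn
  have h0 : ∀ y ∈ torusDomain, y 0 ≠ 0 := fun y hy => hy.1.ne'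
  have hρ : ContDiffOn ℝ (⊤ : ℕ∞) (fun y : Sp 3 => 3 + y 1 / y 0) torusDomain :=
    contDiffOn_const.add ((hc 1).div (hc 0) h0)
  have hφ : ContDiffOn ℝ (⊤ : ℕ∞) (fun y : Sp 3 => 2 * π / S * Real.log (y 0)) torusDomain :=
    contDiffOn_const.mul ((hc 0).log h0)
  refine contDiffOn_pi.mpr fun i => ?_
  fin_cases i
  · exact hρ.mul hφ.cos
  · exact hρ.mul hφ.sin
  · exact (hc 2).div (hc 0) h0
  · exact (hc 3).div (hc 0) h0

lemma torusMap_exp_smul {S : ℝ} (hS : S ≠ 0) {y : Sp 3} (hy : 0 < y 0) (n : ℤ) :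
    torusMap S (Real.exp (n * S) • y) = torusMap S y := by
  have he := (Real.exp_pos (n * S)).ne'
  have hq : ∀ i, Real.exp (n * S) * y i / (Real.exp (n * S) * y 0) = y i / y 0 := fun i =>
    mul_div_mul_left _ _ he
  have hl : 2 * π / S * Real.log (Real.exp (n * S) * y 0)
      = 2 * π / S * Real.log (y 0) + n * (2 * π) := by
    rw [Real.log_mul he hy.ne', Real.log_exp]
    field_simp; ring
  simp only [torusMap, Pi.smul_apply, smul_eq_mul, hq, hl, Real.cos_add_int_mul_two_pi,
    Real.sin_add_int_mul_two_pi]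

lemma torusMap_eq_imp {S : ℝ} (hS : S ≠ 0) {y z : Sp 3} (hy : y ∈ torusDomain)
    (hz : z ∈ torusDomain) (h : torusMap S y = torusMap S z) :
    ∃ n : ℤ, z = Real.exp (n * S) • y := by
  have h0 := congrFun h 0
  have h1 := congrFun h 1
  have h2 : y 2 / y 0 = z 2 / z 0 := congrFun h 2
  have h3 : y 3 / y 0 = z 3 / z 0 := congrFun h 3
  simp only [torusMap, Matrix.cons_val_zero, Matrix.cons_val_one] at h0 h1
  have hρ : 3 + y 1 / y 0 = 3 + z 1 / z 0 := by
    have hsq : (3 + y 1 / y 0) ^ 2 = (3 + z 1 / z 0) ^ 2 := by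
      have c1 := Real.cos_sq_add_sin_sq (2 * π / S * Real.log (y 0))
      have c2 := Real.cos_sq_add_sin_sq (2 * π / S * Real.log (z 0))
      calc (3 + y 1 / y 0) ^ 2
          = ((3 + y 1 / y 0) * Real.cos (2 * π / S * Real.log (y 0))) ^ 2
            + ((3 + y 1 / y 0) * Real.sin (2 * π / S * Real.log (y 0))) ^ 2 := by
              rw [mul_pow, mul_pow, ← mul_add, c1, mul_one]
        _ = _ := by rw [h0, h1, mul_pow, mul_pow, ← mul_add, c2, mul_one]
    exact (pow_left_inj₀ hy.2.le hz.2.le two_ne_zero).mp hsq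
  have hρ0 := hz.2.ne'
  rw [hρ] at h0 h1
  have hang := Real.Angle.cos_sin_inj (mul_left_cancel₀ hρ0 h0) (mul_left_cancel₀ hρ0 h1)
  obtain ⟨k, hk⟩ := Real.Angle.angle_eq_iff_two_pi_dvd_sub.mp hang
  have hlog : Real.log (z 0) = Real.log (y 0) + ((-k : ℤ) : ℝ) * S := by
    have hpi := Real.pi_ne_zero
    push_cast
    field_simp at hk
    linarith
  have hz0 : z 0 = Real.exp (((-k : ℤ) : ℝ) * S) * y 0 := by
    rw [← Real.exp_log hz.1, hlog, Real.exp_add, Real.exp_log hy.1, mul_comm]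
  have hy0 := hy.1.ne'
  have hcoord : ∀ i, y i / y 0 = z i / z 0 → z i = Real.exp (((-k : ℤ) : ℝ) * S) * y i :=
    fun i hi => by
      have hzz := hz.1.ne'
      rw [div_eq_div_iff hy0 hzz, hz0] at hi
      have : y 0 * z i = y 0 * (Real.exp (((-k : ℤ) : ℝ) * S) * y i) := by linarith
      exact mul_left_cancel₀ hy0 this
  refine ⟨-k, funext fun i => ?_⟩
  fin_cases i
  · exact hz0
  · exact hcoord 1 (add_left_cancel hρ)
  · exact hcoord 2 h2
  · exact hcoord 3 h3

lemma torusMap_fderiv_injective {S : ℝ} (hS : S ≠ 0) {y : Sp 3} (hy : y ∈ torusDomain) :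
    Function.Injective (fderiv ℝ (torusMap S) y) := by
  have hd : DifferentiableAt ℝ (torusMap S) y :=
    ((contDiffOn_torusMap S).contDiffAt (isOpen_torusDomain.mem_nhds hy)).differentiableAt (by simp)
  have hcomp := fun i => (hasFDerivAt_pi'.mp hd.hasFDerivAt) i
  have hy0 := hy.1.ne'
  have hc : ∀ i : Fin 4, HasFDerivAt (fun z : Sp 3 => z i)
      (ContinuousLinearMap.proj (R := ℝ) (φ := fun _ : Fin 4 => ℝ) i) y := fun i =>
    hasFDerivAt_apply i y
  have hq : ∀ i : Fin 4, ∃ L : Sp 3 →L[ℝ] ℝ, HasFDerivAt (fun z : Sp 3 => z i / z 0) L y ∧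
      ∀ v, y 0 * L v = v i - y i / y 0 * v 0 := fun i => by
    have hinv : HasFDerivAt (fun z : Sp 3 => (z 0)⁻¹) _ y :=
      (hasDerivAt_inv hy0).comp_hasFDerivAt y (hc 0)
    have h : HasFDerivAt (fun z : Sp 3 => z i * (z 0)⁻¹) _ y := (hc i).mul hinv
    refine ⟨_, by simp only [div_eq_mul_inv]; exact h, fun v => ?_⟩
    simp
    field_simp
    ring
  choose L hL hLv using hq
  have hlog : HasFDerivAt (fun z : Sp 3 => 2 * π / S * Real.log (z 0)) _ y :=
    ((Real.hasDerivAt_log hy0).comp_hasFDerivAt y (hc 0)).const_mul (2 * π / S)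
  have hρ : HasFDerivAt (fun z : Sp 3 => 3 + z 1 / z 0) (L 1) y := (hL 1).const_add 3
  have hcos := (Real.hasDerivAt_cos _).comp_hasFDerivAt y hlog
  have hsin := (Real.hasDerivAt_sin _).comp_hasFDerivAt y hlog
  have d0 := (hcomp 0).unique (hρ.mul hcos)
  have d1 := (hcomp 1).unique (hρ.mul hsin)
  have d2 := (hcomp 2).unique (hL 2)
  have d3 := (hcomp 3).unique (hL 3)
  rw [injective_iff_map_eq_zero]
  intro v hv
  have e : ∀ i, (ContinuousLinearMap.proj (R := ℝ) (φ := fun _ : Fin 4 => ℝ) i).comp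
      (fderiv ℝ (torusMap S) y) v = 0 := fun i => by simp [hv]
  have e0 := e 0
  have e1 := e 1
  have e2 := e 2
  have e3 := e 3
  rw [d0] at e0
  rw [d1] at e1
  rw [d2] at e2
  rw [d3] at e3
  set φ := 2 * π / S * Real.log (y 0)
  have cs := Real.cos_sq_add_sin_sq φ
  have e0' : (3 + y 1 / y 0) * (-Real.sin φ * (2 * π / S * ((y 0)⁻¹ * v 0)))
      + Real.cos φ * L 1 v = 0 := e0
  have e1' : (3 + y 1 / y 0) * (Real.cos φ * (2 * π / S * ((y 0)⁻¹ * v 0)))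
      + Real.sin φ * L 1 v = 0 := e1
  have hL1 : L 1 v = 0 := by
    linear_combination Real.cos φ * e0' + Real.sin φ * e1' - L 1 v * cs
  have hv0' : (3 + y 1 / y 0) * (2 * π / S * ((y 0)⁻¹ * v 0)) = 0 := by
    linear_combination -Real.sin φ * e0' + Real.cos φ * e1'
      - (3 + y 1 / y 0) * (2 * π / S * ((y 0)⁻¹ * v 0)) * cs
  have hω : 2 * π / S ≠ 0 := div_ne_zero (by positivity) hS
  have hv0 : v 0 = 0 := by
    simpa [hy.2.ne', hω, hy0] using hv0'
  have hi : ∀ i, L i v = 0 → v i = 0 := fun i h => by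
    have := hLv i v
    rw [h, hv0] at this
    linarith
  ext i
  fin_cases i
  · exact hv0
  · exact hi 1 hL1
  · exact hi 2 e2
  · exact hi 3 e3

lemma smul_mem_cone {y : Sp 3} (hy : y ∈ Cone 3) {c : ℝ} (hc : 0 < c) : c • y ∈ Cone 3 := by
  refine ⟨by simpa using mul_pos hc hy.1, ?_⟩
  simp only [Pi.smul_apply, smul_eq_mul, mul_pow, ← Finset.mul_sum]
  exact mul_le_mul_of_nonneg_left hy.2 (sq_nonneg c)

/-- A compact fundamental domain of the cone modulo the discrete scaling. -/
def fundDomain (S : ℝ) : Set (Sp 3) := {y ∈ Cone 3 | 1 ≤ y 0 ∧ y 0 ≤ Real.exp S}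

lemma isCompact_fundDomain (S : ℝ) : IsCompact (fundDomain S) := by
  have heq : fundDomain S = {y : Sp 3 | 1 ≤ y 0} ∩ {y : Sp 3 | y 0 ≤ Real.exp S}
      ∩ {y : Sp 3 | ∑ i : Fin 3, (y i.succ) ^ 2 ≤ (y 0) ^ 2} := by
    ext y
    simp only [fundDomain, Cone, Set.mem_inter_iff, Set.mem_ofPred_eq]
    exact ⟨fun h => ⟨h.2, h.1.2⟩, fun h => ⟨⟨by linarith [h.1.1], h.2⟩, h.1⟩⟩
  have hcl : IsClosed (fundDomain S) := by
    rw [heq]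
    refine ((isClosed_le ?_ ?_).inter (isClosed_le ?_ ?_)).inter (isClosed_le ?_ ?_) <;> fun_prop
  refine (isCompact_Icc (a := fun _ : Fin 4 => -Real.exp S) (b := fun _ => Real.exp S)).of_isClosed_subset
    hcl fun y hy => ?_
  obtain ⟨⟨h0, h1⟩, -, h2⟩ := hy
  have : ∀ i, |y i| ≤ y 0 := fun i => by
    refine Fin.cases (by rw [abs_of_pos h0]) (fun j => ?_) i
    exact abs_le_of_sq_le_sq ((Finset.single_le_sum (f := fun i : Fin 3 => (y i.succ) ^ 2)
      (fun _ _ => sq_nonneg _) (Finset.mem_univ j)).trans h1) h0.le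
  exact ⟨fun i => (abs_le.mp ((this i).trans h2)).1, fun i => (abs_le.mp ((this i).trans h2)).2⟩

lemma exists_mem_fundDomain {S : ℝ} (hS : 0 < S) {y : Sp 3} (hy : y ∈ Cone 3) :
    ∃ n : ℤ, Real.exp (n * S) • y ∈ fundDomain S := by
  refine ⟨-⌊Real.log (y 0) / S⌋, smul_mem_cone hy (Real.exp_pos _), ?_⟩
  have h1 := Int.floor_le (Real.log (y 0) / S)
  have h2 := (Int.lt_floor_add_one (Real.log (y 0) / S)).le
  rw [le_div_iff₀ hS] at h1
  rw [div_le_iff₀ hS] at h2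
  have e : (Real.exp (((-⌊Real.log (y 0) / S⌋ : ℤ) : ℝ) * S) • y) 0
      = Real.exp (((-⌊Real.log (y 0) / S⌋ : ℤ) : ℝ) * S + Real.log (y 0)) := by
    rw [Real.exp_add, Real.exp_log hy.1]; rfl
  rw [e]
  push_cast
  exact ⟨Real.one_le_exp (by linarith), Real.exp_le_exp.mpr (by linarith)⟩

/-- The image of the cone under `torusMap`. -/
def torusImage (S : ℝ) : Set (Sp 3) := torusMap S '' Cone 3

lemma isCompact_torusImage {S : ℝ} (hS : 0 < S) : IsCompact (torusImage S) := by
  have : torusImage S = torusMap S '' fundDomain S := by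
    refine subset_antisymm ?_ (Set.image_mono fun y hy => hy.1)
    rintro _ ⟨y, hy, rfl⟩
    obtain ⟨n, hn⟩ := exists_mem_fundDomain hS hy
    exact ⟨_, hn, torusMap_exp_smul hS.ne' hy.1 n⟩
  rw [this]
  exact (isCompact_fundDomain S).image_of_continuousOn
    ((contDiffOn_torusMap S).continuousOn.mono fun y hy => cone_subset_torusDomain hy.1)

lemma exp_int_mul_invariant {X : Type*} {S : ℝ} {f : Sp 3 → X}
    (h : ∀ y ∈ Cone 3, f (Real.exp S • y) = f y) (n : ℤ) :
    ∀ y ∈ Cone 3, f (Real.exp (n * S) • y) = f y := by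
  have hn : ∀ n : ℕ, ∀ y ∈ Cone 3, f (Real.exp (n * S) • y) = f y := fun n => by
    induction n with
    | zero => simp
    | succ k ih =>
      intro y hy
      have e : Real.exp (((k + 1 : ℕ) : ℝ) * S) • y = Real.exp S • Real.exp (k * S) • y := by
        rw [smul_smul, ← Real.exp_add]; congr 2; push_cast; ring
      rw [e, h _ (smul_mem_cone hy (Real.exp_pos _)), ih y hy]
  obtain ⟨k, rfl | rfl⟩ := n.eq_nat_or_neg
  · simpa using hn k
  · intro y hy
    have := hn k _ (smul_mem_cone hy (Real.exp_pos (((-(k : ℤ) : ℤ) : ℝ) * S)))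
    rw [smul_smul, ← Real.exp_add] at this
    rw [← this]
    simp

/-- The derivative of `torusMap` as an equivalence. -/
def torusEquiv {S : ℝ} (hS : S ≠ 0) {y : Sp 3} (hy : y ∈ torusDomain) : Sp 3 ≃L[ℝ] Sp 3 :=
  (LinearEquiv.ofInjectiveEndo (fderiv ℝ (torusMap S) y : Sp 3 →ₗ[ℝ] Sp 3)
    (torusMap_fderiv_injective hS hy)).toContinuousLinearEquiv

lemma coe_torusEquiv {S : ℝ} (hS : S ≠ 0) {y : Sp 3} (hy : y ∈ torusDomain) :
    (torusEquiv hS hy : Sp 3 →L[ℝ] Sp 3) = fderiv ℝ (torusMap S) y := by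
  ext1; rfl

lemma hasFDerivAt_torusMap {S : ℝ} (hS : S ≠ 0) {y : Sp 3} (hy : y ∈ torusDomain) :
    HasFDerivAt (torusMap S) (torusEquiv hS hy : Sp 3 →L[ℝ] Sp 3) y := by
  rw [coe_torusEquiv]
  exact (((contDiffOn_torusMap S).contDiffAt (isOpen_torusDomain.mem_nhds hy)).differentiableAt
    (by simp)).hasFDerivAt

open Manifold in
/-- Smooth scaling invariant functions on the cone descend along `torusMap`. -/
theorem exists_descent {S : ℝ} (hS : 0 < S) {f : Sp 3 → ℝ} {V : Set (Sp 3)} (hV : IsOpen V)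
    (hΓ : Cone 3 ⊆ V) (hf : ContDiffOn ℝ (⊤ : ℕ∞) f V)
    (hinv : ∀ y ∈ Cone 3, f (Real.exp S • y) = f y) :
    ∃ F : Sp 3 → ℝ, ContDiff ℝ (⊤ : ℕ∞) F ∧ ∀ y ∈ Cone 3, F (torusMap S y) = f y := by
  have key := exists_contMDiffMap_forall_mem_convex_of_local (n := (⊤ : ℕ∞)) 𝓘(ℝ, Sp 3)
    (t := fun x : Sp 3 => {c : ℝ | ∀ y ∈ Cone 3, torusMap S y = x → c = f y}) ?_ ?_
  · obtain ⟨g, hg⟩ := key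
    exact ⟨g, g.contMDiff.contDiff, fun y hy => hg _ y hy rfl⟩
  · intro x a ha b hb s t _ _ hst y hy hyx
    rw [ha y hy hyx, hb y hy hyx, ← add_smul, hst, one_smul]
  · intro x
    by_cases hx : x ∈ torusImage S
    · obtain ⟨y, hy, rfl⟩ := hx
      have hyD := cone_subset_torusDomain hy
      have hc : ContDiffAt ℝ (⊤ : ℕ∞) (torusMap S) y :=
        (contDiffOn_torusMap S).contDiffAt (isOpen_torusDomain.mem_nhds hyD)
      have hd := hasFDerivAt_torusMap hS.ne' hyD
      have h1 : (((⊤ : ℕ∞) : WithTop ℕ∞)) ≠ 0 := by simp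
      set e := hc.toOpenPartialHomeomorph (torusMap S) hd h1 with he
      have heq : (e : Sp 3 → Sp 3) = torusMap S := hc.toOpenPartialHomeomorph_coe hd h1
      have hys : y ∈ e.source := hc.mem_toOpenPartialHomeomorph_source hd h1
      have hsy : e.symm (torusMap S y) = y := by rw [← heq]; exact e.left_inv hys
      have hW : IsOpen (e.target ∩ e.symm ⁻¹' (V ∩ torusDomain)) :=
        e.isOpen_inter_preimage_symm (hV.inter isOpen_torusDomain)
      refine ⟨_, hW.mem_nhds ⟨hc.image_mem_toOpenPartialHomeomorph_target hd h1, ?_⟩,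
        fun z => f (e.symm z), ?_, ?_⟩
      · rw [Set.mem_preimage, hsy]; exact ⟨hΓ hy, hyD⟩
      · refine ContDiffOn.contMDiffOn fun z hz => ContDiffAt.contDiffWithinAt ?_
        have hz2 : e.symm z ∈ torusDomain := hz.2.2
        have hs : ContDiffAt ℝ (⊤ : ℕ∞) e.symm z := by
          refine e.contDiffAt_symm (f₀' := torusEquiv hS.ne' hz2) hz.1 ?_ ?_
          · rw [heq]; exact hasFDerivAt_torusMap hS.ne' hz2
          · rw [heq]
            exact (contDiffOn_torusMap S).contDiffAt (isOpen_torusDomain.mem_nhds hz2)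
        exact (hf.contDiffAt (hV.mem_nhds hz.2.1)).comp z hs
      · intro z hz w hw hwz
        have hez : torusMap S (e.symm z) = z := by rw [← heq]; exact e.right_inv hz.1
        obtain ⟨n, hn⟩ := torusMap_eq_imp hS.ne' (cone_subset_torusDomain hw) hz.2.2
          (hwz.trans hez.symm)
        change f (e.symm z) = f w
        rw [hn, exp_int_mul_invariant hinv n w hw]
    · refine ⟨(torusImage S)ᶜ, (isCompact_torusImage hS).isClosed.isOpen_compl.mem_nhds hx,
        fun _ => 0, contMDiffOn_const, fun z hz y hy hyz => ?_⟩
      exact absurd ⟨y, hy, hyz⟩ hz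

/-- Partial derivatives on the cone only depend on the values on the cone. -/
lemma pd_eq_of_eqOn_cone {F : Type*} [NormedAddCommGroup F] [NormedSpace ℝ F]
    {f h : Sp 3 → F} {V : Set (Sp 3)} (hV : IsOpen V) (hΓ : Cone 3 ⊆ V)
    (hf : ContDiffOn ℝ (⊤ : ℕ∞) f V) (hh : ContDiffOn ℝ (⊤ : ℕ∞) h V)
    (heq : ∀ y ∈ Cone 3, f y = h y) (α : Fin 4) {y : Sp 3} (hy : y ∈ Cone 3) :
    pd α f y = pd α h y := by
  have hcf := ((WaveNash.ContDiffOn.pd hV hf α).continuousOn).continuousAt (hV.mem_nhds (hΓ hy))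
  have hch := ((WaveNash.ContDiffOn.pd hV hh α).continuousOn).continuousAt (hV.mem_nhds (hΓ hy))
  set γ : ℝ → Sp 3 := fun ε => y + ε • Pi.single 0 1 with hγ
  have hγc : Continuous γ := by fun_prop
  have hγ0 : γ 0 = y := by simp [hγ]
  have hlim : Filter.Tendsto γ (nhdsWithin 0 (Set.Ioi 0)) (nhds y) := by
    have := hγc.tendsto 0
    rw [hγ0] at this
    exact this.mono_left nhdsWithin_le_nhds
  have hev : ∀ᶠ ε in nhdsWithin (0 : ℝ) (Set.Ioi 0), pd α f (γ ε) = pd α h (γ ε) := by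
    filter_upwards [self_mem_nhdsWithin] with ε hε
    have hε : 0 < ε := hε
    have hO2 : IsOpen {z : Sp 3 | ∑ i : Fin 3, (z i.succ) ^ 2 < (z 0) ^ 2} :=
      isOpen_lt (by fun_prop) (by fun_prop)
    have hO : IsOpen {z : Sp 3 | 0 < z 0 ∧ ∑ i : Fin 3, (z i.succ) ^ 2 < (z 0) ^ 2} :=
      (isOpen_lt continuous_const (continuous_apply 0)).inter hO2
    refine pd_congr (Filter.eventually_of_mem (hO.mem_nhds ?_) fun z hz =>
      heq z ⟨hz.1, hz.2.le⟩) α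
    have e0 : γ ε 0 = y 0 + ε := by simp [hγ]
    have ei : ∀ i : Fin 3, γ ε i.succ = y i.succ := fun i => by simp [hγ]
    simp only [Set.mem_ofPred_eq, e0, ei]
    have := hy.1
    exact ⟨by linarith, hy.2.trans_lt (by nlinarith)⟩
  exact tendsto_nhds_unique ((hcf.tendsto.comp hlim).congr' hev) (hch.tendsto.comp hlim)

/-- The value of the bilinear form with coefficients `g`. -/
def bform {n : ℕ} (g : Fin n → Fin n → ℝ) (v w : Fin n → ℝ) : ℝ :=
  ∑ i, ∑ j, g i j * (v i * w j)

lemma posDef_iff_bform {n : ℕ} {g : Fin n → Fin n → ℝ} :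
    (Matrix.of fun i j => g i j).PosDef ↔
      (∀ i j, g i j = g j i) ∧ ∀ v, v ≠ 0 → 0 < bform g v v := by
  have hq : ∀ v : Fin n → ℝ,
      dotProduct (star v) ((Matrix.of fun i j => g i j).mulVec v) = bform g v v := fun v => by
    simp only [dotProduct, Matrix.mulVec, Matrix.of_apply, bform, Finset.mul_sum, Pi.star_apply,
      star_trivial]
    exact Finset.sum_congr rfl fun i _ => Finset.sum_congr rfl fun j _ => by ring
  constructor
  · intro h
    refine ⟨fun i j => by simpa using h.1.apply j i, fun v hv => ?_⟩
    rw [← hq]; exact h.dotProduct_mulVec_pos hv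
  · rintro ⟨h1, h2⟩
    refine Matrix.PosDef.of_dotProduct_mulVec_pos ?_ fun v hv => ?_
    · ext i j
      simpa using h1 j i
    · rw [hq]; exact h2 v hv

lemma bform_sum_left {n : ℕ} {ι : Type*} (s : Finset ι) (g : Fin n → Fin n → ℝ) (c : ι → ℝ)
    (v : ι → Fin n → ℝ) (w : Fin n → ℝ) :
    bform g (∑ a ∈ s, c a • v a) w = ∑ a ∈ s, c a * bform g (v a) w := by
  simp only [bform, Finset.mul_sum, Finset.sum_apply, Pi.smul_apply, smul_eq_mul, Finset.sum_mul]
  rw [Finset.sum_comm' (s := s) (t := fun _ => Finset.univ) (t' := Finset.univ) (s' := fun _ => s)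
    (by simp)]
  refine Finset.sum_congr rfl fun i _ => ?_
  rw [Finset.sum_comm]
  exact Finset.sum_congr rfl fun a _ => Finset.sum_congr rfl fun j _ => by ring

lemma bform_swap {n : ℕ} (g : Fin n → Fin n → ℝ) (v w : Fin n → ℝ) :
    bform g v w = bform (fun i j => g j i) w v := by
  unfold bform
  rw [Finset.sum_comm]
  exact Finset.sum_congr rfl fun a _ => Finset.sum_congr rfl fun j _ => by ring

lemma bform_sum_right {n : ℕ} {ι : Type*} (s : Finset ι) (g : Fin n → Fin n → ℝ) (c : ι → ℝ)
    (v : Fin n → ℝ) (w : ι → Fin n → ℝ) :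
    bform g v (∑ a ∈ s, c a • w a) = ∑ a ∈ s, c a * bform g v (w a) := by
  rw [bform_swap, bform_sum_left]
  simp only [← bform_swap]

lemma bform_smul_smul {n : ℕ} (g : Fin n → Fin n → ℝ) (c : ℝ) (v w : Fin n → ℝ) :
    bform g (c • v) (c • w) = c ^ 2 * bform g v w := by
  simp only [bform, Finset.mul_sum, Pi.smul_apply, smul_eq_mul]
  exact Finset.sum_congr rfl fun a _ => Finset.sum_congr rfl fun j _ => by ring

lemma bform_single {n : ℕ} (g : Fin n → Fin n → ℝ) (a b : Fin n) :
    bform g (Pi.single a 1) (Pi.single b 1) = g a b := by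
  simp [bform, Pi.single_apply]

lemma sum_smul_single (v : Sp 3) : ∑ a, v a • (Pi.single a 1 : Sp 3) = v := by
  ext i; simp [Pi.single_apply]

/-- Pulling a bilinear form back along a linear map. -/
lemma bform_pullback (g : Fin 4 → Fin 4 → ℝ) (L : Sp 3 →L[ℝ] Sp 3) (v w : Sp 3) :
    bform (fun a b => bform g (L (Pi.single a 1)) (L (Pi.single b 1))) v w
      = bform g (L v) (L w) := by
  have hL : ∀ v : Sp 3, L v = ∑ a, v a • L (Pi.single a 1) := fun v => by
    conv_lhs => rw [← sum_smul_single v]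
    simp only [map_sum, map_smul]
  rw [hL v, hL w, bform_sum_left]
  simp only [bform_sum_right]
  rw [bform]
  simp only [Finset.mul_sum]
  exact Finset.sum_congr rfl fun a _ => Finset.sum_congr rfl fun b _ => by ring

/-- The inverse of the derivative of `torusMap`. -/
def torusFrame (S : ℝ) (y : Sp 3) : Sp 3 →L[ℝ] Sp 3 :=
  ContinuousLinearMap.inverse (fderiv ℝ (torusMap S) y)

lemma torusFrame_eq {S : ℝ} (hS : S ≠ 0) {y : Sp 3} (hy : y ∈ torusDomain) :
    torusFrame S y = ((torusEquiv hS hy).symm : Sp 3 →L[ℝ] Sp 3) := by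
  rw [torusFrame, ← coe_torusEquiv hS hy, ContinuousLinearMap.inverse_equiv]

lemma torusFrame_fderiv {S : ℝ} (hS : S ≠ 0) {y : Sp 3} (hy : y ∈ torusDomain) (v : Sp 3) :
    torusFrame S y (fderiv ℝ (torusMap S) y v) = v := by
  rw [torusFrame_eq hS hy, ← coe_torusEquiv hS hy]
  exact (torusEquiv hS hy).symm_apply_apply v

lemma fderiv_torusFrame {S : ℝ} (hS : S ≠ 0) {y : Sp 3} (hy : y ∈ torusDomain) (v : Sp 3) :
    fderiv ℝ (torusMap S) y (torusFrame S y v) = v := by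
  rw [torusFrame_eq hS hy, ← coe_torusEquiv hS hy]
  exact (torusEquiv hS hy).apply_symm_apply v

lemma contDiffOn_torusFrame {S : ℝ} (hS : S ≠ 0) :
    ContDiffOn ℝ (⊤ : ℕ∞) (torusFrame S) torusDomain := fun y hy => by
  have h1 : ContDiffAt ℝ (⊤ : ℕ∞) (fderiv ℝ (torusMap S)) y :=
    ((contDiffOn_torusMap S).fderiv_of_isOpen isOpen_torusDomain (m := (⊤ : ℕ∞))
      (by simp)).contDiffAt (isOpen_torusDomain.mem_nhds hy)
  have h2 : ContDiffAt ℝ (⊤ : ℕ∞) ContinuousLinearMap.inverse (fderiv ℝ (torusMap S) y) := by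
    rw [← coe_torusEquiv hS hy]; exact contDiffAt_map_inverse _
  exact (h2.comp y h1).contDiffWithinAt

lemma torusFrame_exp_smul {S : ℝ} (hS : S ≠ 0) {y : Sp 3} (hy : y ∈ Cone 3) (v : Sp 3) :
    torusFrame S (Real.exp S • y) v = Real.exp S • torusFrame S y v := by
  have hyD := cone_subset_torusDomain hy
  have hcyD := cone_subset_torusDomain (smul_mem_cone hy (Real.exp_pos S))
  have hd := hasFDerivAt_torusMap hS hcyD
  have h1 : HasFDerivAt (fun z : Sp 3 => Real.exp S • z)
      (Real.exp S • ContinuousLinearMap.id ℝ (Sp 3)) y :=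
    HasFDerivAt.const_smul (f := fun z : Sp 3 => z) (hasFDerivAt_id y) (Real.exp S)
  have h2 : HasFDerivAt (fun z => torusMap S (Real.exp S • z)) _ y := HasFDerivAt.comp y hd h1
  have heq : (fun z => torusMap S (Real.exp S • z)) =ᶠ[nhds y] torusMap S :=
    Filter.eventually_of_mem (isOpen_torusDomain.mem_nhds hyD) fun z hz => by
      simpa using torusMap_exp_smul hS hz.1 1
  have h3 := (h2.congr_of_eventuallyEq heq.symm).fderiv
  have h4 : ∀ w, fderiv ℝ (torusMap S) y w
      = fderiv ℝ (torusMap S) (Real.exp S • y) (Real.exp S • w) := fun w => by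
    rw [h3, coe_torusEquiv]; simp
  apply torusMap_fderiv_injective hS hcyD
  rw [fderiv_torusFrame hS hcyD, ← h4, fderiv_torusFrame hS hyD]

/-- A metric on the cone with the scaling of the Minkowski coordinates is the pullback of a smooth
metric under `torusMap`. -/
theorem exists_torus_metric {S : ℝ} (hS : 0 < S) {γ : Fin 4 → Fin 4 → Sp 3 → ℝ} {V : Set (Sp 3)}
    (hV : IsOpen V) (hΓ : Cone 3 ⊆ V) (hγ : ∀ α β, ContDiffOn ℝ (⊤ : ℕ∞) (γ α β) V)
    (hsc : ∀ α β, ∀ y ∈ Cone 3, Real.exp S ^ 2 * γ α β (Real.exp S • y) = γ α β y)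
    (hpos : ∀ y ∈ Cone 3, (Matrix.of fun α β => γ α β y).PosDef) :
    ∃ g : Fin 4 → Fin 4 → Sp 3 → ℝ, (∀ a b, ContDiff ℝ (⊤ : ℕ∞) (g a b)) ∧
      (∀ a b x, g a b x = g b a x) ∧
      (∀ x ∈ torusImage S, (Matrix.of fun a b => g a b x).PosDef) ∧
      ∀ y ∈ Cone 3, ∀ α β, bform (fun a b => g a b (torusMap S y)) (pd α (torusMap S) y)
        (pd β (torusMap S) y) = γ α β y := by
  set f : Fin 4 → Fin 4 → Sp 3 → ℝ := fun a b y => bform (fun α β => γ α β y)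
    (torusFrame S y (Pi.single a 1)) (torusFrame S y (Pi.single b 1)) with hf
  have hW : IsOpen (V ∩ torusDomain) := hV.inter isOpen_torusDomain
  have hΓW : Cone 3 ⊆ V ∩ torusDomain := fun y hy => ⟨hΓ hy, cone_subset_torusDomain hy⟩
  have hfr : ∀ a i, ContDiffOn ℝ (⊤ : ℕ∞) (fun y => torusFrame S y (Pi.single a 1) i)
      (V ∩ torusDomain) := fun a i =>
    contDiffOn_pi.mp (((contDiffOn_torusFrame hS.ne').mono Set.inter_subset_right).clm_apply
      contDiffOn_const) i
  have hfs : ∀ a b, ContDiffOn ℝ (⊤ : ℕ∞) (f a b) (V ∩ torusDomain) := fun a b =>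
    ContDiffOn.sum fun i _ => ContDiffOn.sum fun j _ =>
      ((hγ i j).mono Set.inter_subset_left).mul ((hfr a i).mul (hfr b j))
  have hinv : ∀ a b, ∀ y ∈ Cone 3, f a b (Real.exp S • y) = f a b y := fun a b y hy => by
    simp only [hf, torusFrame_exp_smul hS.ne' hy, bform_smul_smul]
    simp only [bform, Finset.mul_sum]
    refine Finset.sum_congr rfl fun i _ => Finset.sum_congr rfl fun j _ => ?_
    rw [← hsc i j y hy]; ring
  choose F hF hFe using fun a b => exists_descent hS hW hΓW (hfs a b) (hinv a b)
  have hγsym : ∀ y ∈ Cone 3, ∀ α β, γ α β y = γ β α y := fun y hy =>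
    (posDef_iff_bform.mp (hpos y hy)).1
  have hfsym : ∀ y ∈ Cone 3, ∀ a b, f a b y = f b a y := fun y hy a b => by
    simp only [hf]
    rw [bform_swap]
    simp only [hγsym y hy]
  have hg : ∀ y ∈ Cone 3, ∀ a b, 1 / 2 * (F a b (torusMap S y) + F b a (torusMap S y)) = f a b y :=
    fun y hy a b => by rw [hFe a b y hy, hFe b a y hy, hfsym y hy b a]; ring
  refine ⟨fun a b x => 1 / 2 * (F a b x + F b a x),
    fun a b => contDiff_const.mul ((hF a b).add (hF b a)), fun a b x => by ring, ?_, ?_⟩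
  · rintro _ ⟨y, hy, rfl⟩
    simp only [hg y hy]
    refine posDef_iff_bform.mpr ⟨hfsym y hy, fun v hv => ?_⟩
    have := bform_pullback (fun α β => γ α β y) (torusFrame S y) v v
    change 0 < bform (fun a b => bform (fun α β => γ α β y) (torusFrame S y (Pi.single a 1))
      (torusFrame S y (Pi.single b 1))) v v
    rw [this]
    refine (posDef_iff_bform.mp (hpos y hy)).2 _ fun h0 => hv ?_
    rw [← fderiv_torusFrame hS.ne' (cone_subset_torusDomain hy) v, h0, map_zero]
  · intro y hy α β
    simp only [hg y hy]
    have := bform_pullback (fun α β => γ α β y) (torusFrame S y) (pd α (torusMap S) y)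
      (pd β (torusMap S) y)
    refine this.trans ?_
    rw [pd, pd, torusFrame_fderiv hS.ne' (cone_subset_torusDomain hy),
      torusFrame_fderiv hS.ne' (cone_subset_torusDomain hy), bform_single]

/-! ### The metric of the direction field -/

lemma ContDiffOn.differentiableAt_of_isOpen {F : Type*} [NormedAddCommGroup F] [NormedSpace ℝ F]
    {f : Sp 3 → F} {U : Set (Sp 3)} (hU : IsOpen U) (hf : ContDiffOn ℝ (⊤ : ℕ∞) f U) {x : Sp 3}
    (hx : x ∈ U) : DifferentiableAt ℝ f x :=
  (hf.contDiffAt (hU.mem_nhds hx)).differentiableAt (by simp)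

lemma pd_dilate_of_differentiableAt {F : Type*} [NormedAddCommGroup F] [NormedSpace ℝ F]
    {f : Sp 3 → F} {c : ℝ} {x : Sp 3} (hf : DifferentiableAt ℝ f (c • x)) (i : Fin 4) :
    pd i (fun y => f (c • y)) x = c • pd i f (c • x) := by
  have h1 : HasFDerivAt (fun y : Sp 3 => c • y) (c • ContinuousLinearMap.id ℝ (Sp 3)) x :=
    HasFDerivAt.const_smul (f := fun z : Sp 3 => z) (hasFDerivAt_id x) c
  have h2 : pd i (fun y => f (c • y)) x
      = ((fderiv ℝ f (c • x)).comp (c • ContinuousLinearMap.id ℝ (Sp 3))) (Pi.single i 1) :=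
    pd_of_hasFDerivAt (hf.hasFDerivAt.comp x h1) i
  rw [h2]
  simp [pd]

/-- Partial derivatives of a function homogeneous under the scaling on the cone. -/
lemma pd_exp_smul {S : ℝ} {f : Sp 3 → ℝ} {V : Set (Sp 3)} (hV : IsOpen V) (hΓ : Cone 3 ⊆ V)
    (hf : ContDiffOn ℝ (⊤ : ℕ∞) f V) {c : ℝ}
    (hsc : ∀ y ∈ Cone 3, f (Real.exp S • y) = c * f y) (i : Fin 4) {y : Sp 3} (hy : y ∈ Cone 3) :
    Real.exp S * pd i f (Real.exp S • y) = c * pd i f y := by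
  set V' : Set (Sp 3) := V ∩ (fun z => Real.exp S • z) ⁻¹' V
  have hcts : Continuous fun z : Sp 3 => Real.exp S • z := by fun_prop
  have hV' : IsOpen V' := hV.inter (hV.preimage hcts)
  have hΓ' : Cone 3 ⊆ V' := fun z hz => ⟨hΓ hz, hΓ (smul_mem_cone hz (Real.exp_pos S))⟩
  have h1 : ContDiffOn ℝ (⊤ : ℕ∞) (fun z => f (Real.exp S • z)) V' :=
    hf.comp (contDiff_id.const_smul (Real.exp S)).contDiffOn fun z hz => hz.2
  have h2 : ContDiffOn ℝ (⊤ : ℕ∞) (fun z => c * f z) V' :=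
    contDiffOn_const.mul (hf.mono Set.inter_subset_left)
  have h3 := pd_eq_of_eqOn_cone hV' hΓ' h1 h2 hsc i hy
  rwa [pd_dilate_of_differentiableAt (ContDiffOn.differentiableAt_of_isOpen hV hf (hΓ' hy).2),
    pd_const_mul _ (ContDiffOn.differentiableAt_of_isOpen hV hf (hΓ hy)), smul_eq_mul] at h3

/-- The metric induced by the direction field of a map with mass density `M` and energy
tensor `E`. -/
def dirMetric (M : Sp 3 → ℝ) (E : Fin 4 → Fin 4 → Sp 3 → ℝ) (α β : Fin 4) (y : Sp 3) : ℝ :=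
  E α β y / M y - pd α M y * pd β M y / (4 * M y ^ 2)

lemma pos_of_bigMat_posDef {M : Sp 3 → ℝ} {E : Fin 4 → Fin 4 → Sp 3 → ℝ} {y : Sp 3}
    (h : (bigMat M E y).PosDef) : 0 < M y := by
  have := (posDef_iff_bform.mp h).2 (Pi.single 0 1) (by simp)
  rw [bform_single] at this
  simpa using this

lemma dirMetric_posDef {M : Sp 3 → ℝ} {E : Fin 4 → Fin 4 → Sp 3 → ℝ} (hsym : ∀ α β, E α β = E β α)
    {y : Sp 3} (h : (bigMat M E y).PosDef) :
    (Matrix.of fun α β => dirMetric M E α β y).PosDef := by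
  have hM := pos_of_bigMat_posDef h
  refine posDef_iff_bform.mpr ⟨fun α β => ?_, fun v hv => ?_⟩
  · simp only [dirMetric]
    rw [hsym α β, mul_comm (pd α M y)]
  · set c := ∑ α, v α * pd α M y with hc
    set w : Fin 5 → ℝ := Fin.cons (-c / (2 * M y)) v with hw
    have hw0 : w ≠ 0 := fun h0 => hv (funext fun i => by simpa [hw] using congrFun h0 i.succ)
    have hpos := (posDef_iff_bform.mp h).2 w hw0
    have e1 : ∀ t : ℝ, bform (fun i j : Fin 5 => bigMat M E y i j) (Fin.cons t v) (Fin.cons t v)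
        = M y * t ^ 2 + t * c + bform (fun α β => E α β y) v v := fun t => by
      simp only [bform, bigMat, Matrix.of_apply, hc]
      rw [Fin.sum_univ_succ]
      simp only [Fin.sum_univ_succ (n := 4), Fin.cons_zero, Fin.cons_succ, Fin.succ_ne_zero,
        dite_true, dite_false, Fin.pred_succ, Finset.sum_add_distrib, Finset.mul_sum]
      have : ∀ s : Fin 4 → ℝ, ∑ i, t * s i = t * ∑ i, s i := fun s => (Finset.mul_sum ..).symm
      have e2 : ∑ i, 1 / 2 * pd i M y * (t * v i) = 1 / 2 * t * ∑ i, v i * pd i M y := by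
        rw [Finset.mul_sum]; exact Finset.sum_congr rfl fun i _ => by ring
      have e3 : ∑ i, 1 / 2 * pd i M y * (v i * t) = 1 / 2 * t * ∑ i, v i * pd i M y := by
        rw [Finset.mul_sum]; exact Finset.sum_congr rfl fun i _ => by ring
      rw [e2, e3, this]
      ring
    have e4 : bform (fun α β => dirMetric M E α β y) v v
        = bform (fun α β => E α β y) v v / M y - c ^ 2 / (4 * M y ^ 2) := by
      rw [pow_two c, hc, Finset.sum_mul_sum]
      simp only [bform, dirMetric, Finset.sum_div, ← Finset.sum_sub_distrib]
      exact Finset.sum_congr rfl fun i _ => Finset.sum_congr rfl fun j _ => by ring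
    have e5 : bform (fun i j : Fin 5 => bigMat M E y i j) w w
        = M y * bform (fun α β => dirMetric M E α β y) v v := by
      rw [hw, e1, e4]
      field_simp
      ring
    have hpos' : 0 < bform (fun i j : Fin 5 => bigMat M E y i j) w w := hpos
    rw [e5] at hpos'
    exact (mul_pos_iff_of_pos_left hM).mp hpos'

lemma dirMetric_exp_smul {S a : ℝ} {M : Sp 3 → ℝ} {E : Fin 4 → Fin 4 → Sp 3 → ℝ} {Ω : Set (Sp 3)}
    (hΩ : IsOpen Ω) (hΩΓ : Cone 3 ⊆ Ω) (hM : ContDiffOn ℝ (⊤ : ℕ∞) M Ω)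
    (hM0 : ∀ y ∈ Cone 3, 0 < M y)
    (hMss : ∀ y ∈ Cone 3, M (Real.exp S • y) = Real.exp (-a * S) * M y)
    (hEss : ∀ α β, ∀ y ∈ Cone 3, E α β (Real.exp S • y) = Real.exp (-(a + 2) * S) * E α β y)
    (α β : Fin 4) {y : Sp 3} (hy : y ∈ Cone 3) :
    Real.exp S ^ 2 * dirMetric M E α β (Real.exp S • y) = dirMetric M E α β y := by
  have hα := pd_exp_smul hΩ hΩΓ hM hMss α hy
  have hβ := pd_exp_smul hΩ hΩΓ hM hMss β hy
  have he := Real.exp_pos S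
  have hd := Real.exp_pos (-a * S)
  have hb : Real.exp (-(a + 2) * S) = Real.exp (-a * S) / Real.exp S ^ 2 := by
    rw [← Real.exp_nat_mul, ← Real.exp_sub]; congr 1; push_cast; ring
  have hMy := (hM0 y hy).ne'
  simp only [dirMetric]
  rw [hMss y hy, hEss α β y hy, hb]
  have hα' : pd α M (Real.exp S • y) = Real.exp (-a * S) * pd α M y / Real.exp S := by
    rw [← hα]; field_simp
  have hβ' : pd β M (Real.exp S • y) = Real.exp (-a * S) * pd β M y / Real.exp S := by
    rw [← hβ]; field_simp
  rw [hα', hβ']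
  field_simp

/-- The direction field, as a map that is injective modulo scaling and induces a given metric. -/
theorem exists_direction {S : ℝ} (hS : 0 < S) {γ : Fin 4 → Fin 4 → Sp 3 → ℝ} {V : Set (Sp 3)}
    (hV : IsOpen V) (hΓ : Cone 3 ⊆ V) (hγ : ∀ α β, ContDiffOn ℝ (⊤ : ℕ∞) (γ α β) V)
    (hsc : ∀ α β, ∀ y ∈ Cone 3, Real.exp S ^ 2 * γ α β (Real.exp S • y) = γ α β y)
    (hpos : ∀ y ∈ Cone 3, (Matrix.of fun α β => γ α β y).PosDef) {m : ℕ} (hm : 35 ≤ m) :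
    ∃ (θ : Sp 3 → Em m) (W : Set (Sp 3)), IsOpen W ∧ Cone 3 ⊆ W ∧
      ContDiffOn ℝ (⊤ : ℕ∞) θ W ∧ (∀ y ∈ W, ‖θ y‖ = 1) ∧
      (∀ α β, ∀ y ∈ Cone 3, ⟪pd α θ y, pd β θ y⟫ = γ α β y) ∧
      (∀ y ∈ Cone 3, θ (Real.exp S • y) = θ y) ∧
      (∀ y ∈ Cone 3, ∀ y' ∈ Cone 3, θ y = θ y' → ∃ n : ℤ, y' = Real.exp (n * S) • y) := by
  obtain ⟨g, hg, hgs, hgp, hgγ⟩ := exists_torus_metric hS hV hΓ hγ hsc hpos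
  obtain ⟨θ, hθ, hev, hinj⟩ := exists_isometric_sphere hg hgs (isCompact_torusImage hS) hgp hm
  obtain ⟨U, hU, hKU, hUe⟩ := eventually_nhdsSet_iff_exists.mp hev
  have hW : IsOpen (torusDomain ∩ torusMap S ⁻¹' U) :=
    (contDiffOn_torusMap S).continuousOn.isOpen_inter_preimage isOpen_torusDomain hU
  have hΓW : Cone 3 ⊆ torusDomain ∩ torusMap S ⁻¹' U := fun y hy =>
    ⟨cone_subset_torusDomain hy, hKU ⟨y, hy, rfl⟩⟩
  refine ⟨fun y => θ (torusMap S y), _, hW, hΓW,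
    hθ.comp_contDiffOn ((contDiffOn_torusMap S).mono Set.inter_subset_left),
    fun y hy => (hUe _ hy.2).1, fun α β y hy => ?_, fun y hy => ?_, fun y hy y' hy' h => ?_⟩
  · have hD := cone_subset_torusDomain hy
    have hd := (ContDiffOn.differentiableAt_of_isOpen isOpen_torusDomain (contDiffOn_torusMap S)
      hD).hasFDerivAt
    have hpd : ∀ α, pd α (fun y => θ (torusMap S y)) y
        = ∑ a, pd α (torusMap S) y a • pd a θ (torusMap S y) := fun α => by
      have h1 := (smooth_differentiableAt hθ (torusMap S y)).hasFDerivAt.comp y hd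
      have h2 : pd α (fun y => θ (torusMap S y)) y
          = fderiv ℝ θ (torusMap S y) (pd α (torusMap S) y) := pd_of_hasFDerivAt h1 α
      rw [h2]
      conv_lhs => rw [← sum_smul_single (pd α (torusMap S) y)]
      simp only [map_sum, map_smul, pd]
    rw [hpd, hpd, ← hgγ y hy, sum_inner, bform]
    refine Finset.sum_congr rfl fun a _ => ?_
    rw [inner_sum]
    refine Finset.sum_congr rfl fun b _ => ?_
    rw [real_inner_smul_left, real_inner_smul_right, (hUe _ (hΓW hy).2).2 a b]
    ring
  · have := torusMap_exp_smul hS.ne' hy.1 1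
    rw [Int.cast_one, one_mul] at this
    change θ _ = θ _
    rw [this]
  · exact torusMap_eq_imp hS.ne' (cone_subset_torusDomain hy) (cone_subset_torusDomain hy')
      (hinj h)

/-! ### The wave operator on maps with prescribed densities -/

section wave

variable {F : Type*} [NormedAddCommGroup F] [InnerProductSpace ℝ F] {u : Sp 3 → F} {W : Set (Sp 3)}

lemma pd_comm_of_contDiffOn (hW : IsOpen W) (hu : ContDiffOn ℝ (⊤ : ℕ∞) u W) (i j : Fin 4)
    {x : Sp 3} (hx : x ∈ W) : pd i (pd j u) x = pd j (pd i u) x := by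
  have hd : DifferentiableAt ℝ (fderiv ℝ u) x := ContDiffOn.differentiableAt_of_isOpen hW
    (hu.fderiv_of_isOpen hW (m := (⊤ : ℕ∞)) (by simp)) hx
  have h : ∀ i j, pd i (pd j u) x = fderiv ℝ (fderiv ℝ u) x (Pi.single i 1) (Pi.single j 1) :=
    fun i j => by
      have h1 : HasFDerivAt (pd j u) ((fderiv ℝ (fderiv ℝ u) x).flip (Pi.single j 1)) x := by
        have h2 := hd.hasFDerivAt.clm_apply (hasFDerivAt_const (Pi.single j (1 : ℝ)) x)
        rw [ContinuousLinearMap.comp_zero, zero_add] at h2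
        exact h2
      rw [pd_of_hasFDerivAt h1]; rfl
  rw [h, h]
  exact ((hu.contDiffAt (hW.mem_nhds hx)).isSymmSndFDerivAt
    (by simp; exact WithTop.coe_le_coe.mpr le_top)) _ _

lemma ContDiffOn.dAlembert (hW : IsOpen W) (hu : ContDiffOn ℝ (⊤ : ℕ∞) u W) :
    ContDiffOn ℝ (⊤ : ℕ∞) (dAlembert u) W :=
  (WaveNash.ContDiffOn.pd hW (WaveNash.ContDiffOn.pd hW hu 0) 0).neg.add
    (ContDiffOn.sum fun _ _ => WaveNash.ContDiffOn.pd hW (WaveNash.ContDiffOn.pd hW hu _) _)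

lemma dAlembert_congr {f g : Sp 3 → F} {x : Sp 3} (h : f =ᶠ[nhds x] g) :
    dAlembert f x = dAlembert g x := by
  have h1 : ∀ i, pd i f =ᶠ[nhds x] pd i g := fun i => by
    filter_upwards [h.eventuallyEq_nhds] with z hz using pd_congr hz i
  simp only [dAlembert, fun i => pd_congr (h1 i) i]

lemma pd_norm_sq_of_contDiffOn (hW : IsOpen W) (hu : ContDiffOn ℝ (⊤ : ℕ∞) u W) (i : Fin 4)
    {x : Sp 3} (hx : x ∈ W) : pd i (fun y => ‖u y‖ ^ 2) x = 2 * ⟪u x, pd i u x⟫ := by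
  have hd := ContDiffOn.differentiableAt_of_isOpen hW hu hx
  simp only [← real_inner_self_eq_norm_sq]
  rw [pd_inner hd hd, real_inner_comm (u x) (pd i u x)]
  ring

lemma pd_pd_norm_sq (hW : IsOpen W) (hu : ContDiffOn ℝ (⊤ : ℕ∞) u W) (i : Fin 4)
    {x : Sp 3} (hx : x ∈ W) : pd i (pd i fun y => ‖u y‖ ^ 2) x
      = 2 * ⟪u x, pd i (pd i u) x⟫ + 2 * ⟪pd i u x, pd i u x⟫ := by
  have hd := ContDiffOn.differentiableAt_of_isOpen hW hu hx
  have hd' := ContDiffOn.differentiableAt_of_isOpen hW (WaveNash.ContDiffOn.pd hW hu i) hx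
  have : pd i (fun y => ‖u y‖ ^ 2) =ᶠ[nhds x] fun y => 2 * ⟪u y, pd i u y⟫ :=
    Filter.eventually_of_mem (hW.mem_nhds hx) fun z hz => pd_norm_sq_of_contDiffOn hW hu i hz
  rw [pd_congr this, pd_const_mul _ (hd.inner ℝ hd'), pd_inner hd hd']
  ring

lemma inner_dAlembert (hW : IsOpen W) (hu : ContDiffOn ℝ (⊤ : ℕ∞) u W) {x : Sp 3} (hx : x ∈ W) :
    ⟪u x, dAlembert u x⟫ = 1 / 2 * dAlembert (fun y => ‖u y‖ ^ 2) x
      - (-⟪pd 0 u x, pd 0 u x⟫ + ∑ i : Fin 3, ⟪pd i.succ u x, pd i.succ u x⟫) := by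
  simp only [dAlembert, pd_pd_norm_sq hW hu _ hx, inner_add_right, inner_neg_right, inner_sum,
    Finset.sum_add_distrib, ← Finset.mul_sum]
  ring

lemma inner_pd_dAlembert (hW : IsOpen W) (hu : ContDiffOn ℝ (⊤ : ℕ∞) u W) (α : Fin 4)
    {x : Sp 3} (hx : x ∈ W) :
    ⟪pd α u x, dAlembert u x⟫ = -(pd 0 (fun y => ⟪pd α u y, pd 0 u y⟫) x)
      + (∑ i : Fin 3, pd i.succ (fun y => ⟪pd α u y, pd i.succ u y⟫) x)
      - 1 / 2 * pd α (fun y => -⟪pd 0 u y, pd 0 u y⟫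
        + ∑ i : Fin 3, ⟪pd i.succ u y, pd i.succ u y⟫) x := by
  have hd : ∀ i, DifferentiableAt ℝ (pd i u) x := fun i =>
    ContDiffOn.differentiableAt_of_isOpen hW (WaveNash.ContDiffOn.pd hW hu i) hx
  have hdd : ∀ i, DifferentiableAt ℝ (fun y => ⟪pd i u y, pd i u y⟫) x := fun i =>
    (hd i).inner ℝ (hd i)
  have h1 : pd α (fun y => -⟪pd 0 u y, pd 0 u y⟫
      + ∑ i : Fin 3, ⟪pd i.succ u y, pd i.succ u y⟫) x
      = -(2 * ⟪pd α (pd 0 u) x, pd 0 u x⟫)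
        + ∑ i : Fin 3, 2 * ⟪pd α (pd i.succ u) x, pd i.succ u x⟫ := by
    have hneg : (fun y => -⟪pd 0 u y, pd 0 u y⟫
        + ∑ i : Fin 3, ⟪pd i.succ u y, pd i.succ u y⟫)
        = fun y => (-1) * ⟪pd 0 u y, pd 0 u y⟫ + ∑ i : Fin 3, ⟪pd i.succ u y, pd i.succ u y⟫ := by
      funext y; ring
    rw [hneg, pd_add ((hdd 0).const_mul _) (DifferentiableAt.fun_sum fun i _ => hdd _),
      pd_const_mul _ (hdd 0),
      pd_sum (f := fun (i : Fin 3) y => ⟪pd i.succ u y, pd i.succ u y⟫) _ fun i _ => hdd _]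
    simp only [pd_inner (hd _) (hd _), fun i : Fin 4 => real_inner_comm (pd α (pd i u) x) (pd i u x)]
    congr 1
    · ring
    · exact Finset.sum_congr rfl fun i _ => by ring
  rw [h1]
  simp only [pd_inner (hd _) (hd _), dAlembert, inner_add_right, inner_neg_right, inner_sum,
    pd_comm_of_contDiffOn hW hu α _ hx, Finset.sum_add_distrib, ← Finset.mul_sum]
  ring

end wave

lemma linearIndependent_of_gram_posDef {n : ℕ} {F : Type*} [NormedAddCommGroup F]
    [InnerProductSpace ℝ F] {v : Fin n → F}
    (h : (Matrix.of fun i j => ⟪v i, v j⟫).PosDef) : LinearIndependent ℝ v := by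
  rw [Fintype.linearIndependent_iff]
  intro c hc
  by_contra! hne
  have hc0 : c ≠ 0 := fun h0 => by obtain ⟨i, hi⟩ := hne; exact hi (congrFun h0 i)
  have hpos := (posDef_iff_bform.mp h).2 c hc0
  have : bform (fun i j => ⟪v i, v j⟫) c c = ⟪∑ i, c i • v i, ∑ j, c j • v j⟫ := by
    rw [sum_inner, bform]
    refine Finset.sum_congr rfl fun i _ => ?_
    rw [inner_sum]
    refine Finset.sum_congr rfl fun j _ => ?_
    rw [real_inner_smul_left, real_inner_smul_right]
    ring
  rw [this, hc, inner_zero_left] at hpos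
  exact lt_irrefl _ hpos

/-- The energy tensor of a map with mass density `M` and unit direction field `θ`. -/
lemma inner_pd_sqrt_smul {F : Type*} [NormedAddCommGroup F] [InnerProductSpace ℝ F]
    {θ : Sp 3 → F} {M : Sp 3 → ℝ} {W : Set (Sp 3)} (hW : IsOpen W)
    (hθ : ContDiffOn ℝ (⊤ : ℕ∞) θ W) (hM : ContDiffOn ℝ (⊤ : ℕ∞) M W) (hM0 : ∀ y ∈ W, 0 < M y)
    (h1 : ∀ y ∈ W, ‖θ y‖ = 1) (α β : Fin 4) {y : Sp 3} (hy : y ∈ W) :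
    ⟪pd α (fun z => √(M z) • θ z) y, pd β (fun z => √(M z) • θ z) y⟫
      = M y * ⟪pd α θ y, pd β θ y⟫ + pd α M y * pd β M y / (4 * M y) := by
  have hdθ := ContDiffOn.differentiableAt_of_isOpen hW hθ hy
  have hdM := ContDiffOn.differentiableAt_of_isOpen hW hM hy
  have hr : ∀ i, pd i (fun z => √(M z)) y = 1 / (2 * √(M y)) * pd i M y := fun i =>
    pd_comp_real (Real.hasDerivAt_sqrt (hM0 y hy).ne') hdM i
  have hdr : DifferentiableAt ℝ (fun z => √(M z)) y := hdM.sqrt (hM0 y hy).ne'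
  have horth : ∀ i, ⟪θ y, pd i θ y⟫ = 0 := fun i => by
    have h2 := pd_norm_sq_of_contDiffOn hW hθ i hy
    have h3 : (fun z => ‖θ z‖ ^ 2) =ᶠ[nhds y] fun _ => (1 : ℝ) :=
      Filter.eventually_of_mem (hW.mem_nhds hy) fun z hz => by simp [h1 z hz]
    rw [pd_congr h3, pd_const] at h2
    linarith
  have horth' : ∀ i, ⟪pd i θ y, θ y⟫ = 0 := fun i => by rw [real_inner_comm]; exact horth i
  rw [pd_smul hdr hdθ, pd_smul hdr hdθ, hr, hr]
  simp only [inner_add_left, inner_add_right, real_inner_smul_left, real_inner_smul_right, horth,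
    horth', real_inner_self_eq_norm_sq, h1 y hy]
  have hs := Real.sqrt_pos.mpr (hM0 y hy)
  have hq : M y = √(M y) ^ 2 := (Real.sq_sqrt (hM0 y hy).le).symm
  rw [hq]
  simp only [Real.sqrt_sq hs.le]
  field_simp
  ring

end WaveNash

open WaveNash in
/-- Section 4: Theorem 4.1 implies Theorem 3.1; eliminating the field,
via the Nash embedding theorem.  Given smooth discretely self-similar fields `M, E_{αβ}`
on `Γ₃` obeying the defocusing inequality, the divergence equations, and strict positive
definiteness of the `5×5` matrix, and given `m ≥ 40`, there is a smooth nowhere-vanishing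
`u : Γ₃ → ℝ^m \ {0}` with mass density `M` and energy tensor `E`, discretely self-similar,
obeying `⟨u,□u⟩ > 0` and `∂_α⟨u,□u⟩ = (p+1)⟨∂_α u,□u⟩`, whose direction map `θ = u/‖u‖`
is injective up to the discrete scaling and immersed. -/
theorem stmt7 (p : ℝ) (hp : 5 < p) (S : ℝ) (hS : 0 < S) (m : ℕ) (hm : 40 ≤ m)
    (M : Sp 3 → ℝ) (E : Fin 4 → Fin 4 → Sp 3 → ℝ) (Ω : Set (Sp 3))
    (hΩ : IsOpen Ω) (hΩΓ : Cone 3 ⊆ Ω)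
    (hM : ContDiffOn ℝ (⊤ : ℕ∞) M Ω) (hE : ∀ α β, ContDiffOn ℝ (⊤ : ℕ∞) (E α β) Ω)
    (hsym : ∀ α β, E α β = E β α)
    (hMss : ∀ y ∈ Cone 3, M (Real.exp S • y) = Real.exp (-(4 / (p - 1)) * S) * M y)
    (hEss : ∀ α β, ∀ y ∈ Cone 3,
      E α β (Real.exp S • y) = Real.exp (-(2 * (p + 1) / (p - 1)) * S) * E α β y)
    (hdef : ∀ y ∈ Cone 3,
      0 < (1 / 2) * dAlembert M y - (-(E 0 0 y) + ∑ i : Fin 3, E i.succ i.succ y))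
    (hdiv : ∀ α : Fin 4, ∀ y ∈ Cone 3,
      pd α (fun z =>
          (1 / 2) * dAlembert M z - (-(E 0 0 z) + ∑ i : Fin 3, E i.succ i.succ z)) y
        = (p + 1) * (-(pd 0 (E α 0) y) + (∑ i : Fin 3, pd i.succ (E α i.succ) y)
            - (1 / 2) * pd α (fun z => -(E 0 0 z) + ∑ i : Fin 3, E i.succ i.succ z) y))
    (hposdef : ∀ y ∈ Cone 3, (bigMat M E y).PosDef) :
    ∃ (u : Sp 3 → Em m) (Ω' : Set (Sp 3)),
      IsOpen Ω' ∧ Cone 3 ⊆ Ω' ∧ ContDiffOn ℝ (⊤ : ℕ∞) u Ω' ∧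
      (∀ y ∈ Cone 3, u y ≠ 0) ∧
      -- `u` realises the prescribed mass density and energy tensor
      (∀ y ∈ Cone 3, ‖u y‖ ^ 2 = M y) ∧
      (∀ α β : Fin 4, ∀ y ∈ Cone 3, ⟪pd α u y, pd β u y⟫ = E α β y) ∧
      -- discrete self-similarity
      (∀ y ∈ Cone 3, u (Real.exp S • y) = Real.exp (-(2 / (p - 1)) * S) • u y) ∧
      -- the defocusing property
      (∀ y ∈ Cone 3, 0 < ⟪u y, dAlembert u y⟫) ∧
      -- the equations `∂_α ⟨u, □u⟩ = (p+1) ⟨∂_α u, □u⟩`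
      (∀ α : Fin 4, ∀ y ∈ Cone 3,
        pd α (fun z => ⟪u z, dAlembert u z⟫) y = (p + 1) * ⟪pd α u y, dAlembert u y⟫) ∧
      -- `θ = u/‖u‖` is injective up to the discrete scaling
      (∀ y ∈ Cone 3, ∀ y' ∈ Cone 3,
        ‖u y‖⁻¹ • u y = ‖u y'‖⁻¹ • u y' → ∃ n : ℤ, y' = Real.exp ((n : ℝ) * S) • y) ∧
      -- `θ` is immersed
      (∀ y ∈ Cone 3,
        LinearIndependent ℝ (fun α : Fin 4 => pd α (fun z => ‖u z‖⁻¹ • u z) y)) := by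
  have hp1 : 0 < p - 1 := by linarith
  have hM0 : ∀ y ∈ Cone 3, 0 < M y := fun y hy => pos_of_bigMat_posDef (hposdef y hy)
  set V : Set (Sp 3) := Ω ∩ M ⁻¹' Set.Ioi 0 with hVdef
  have hV : IsOpen V := hM.continuousOn.isOpen_inter_preimage hΩ isOpen_Ioi
  have hΓV : Cone 3 ⊆ V := fun y hy => ⟨hΩΓ hy, hM0 y hy⟩
  have hMV : ContDiffOn ℝ (⊤ : ℕ∞) M V := hM.mono Set.inter_subset_left
  have hMne : ∀ y ∈ V, M y ≠ 0 := fun y hy => ne_of_gt hy.2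
  have hγ : ∀ α β, ContDiffOn ℝ (⊤ : ℕ∞) (dirMetric M E α β) V := fun α β =>
    (((hE α β).mono Set.inter_subset_left).div hMV hMne).sub
      (((WaveNash.ContDiffOn.pd hV hMV α).mul (WaveNash.ContDiffOn.pd hV hMV β)).div
        (contDiffOn_const.mul (hMV.pow 2))
        fun y hy => mul_ne_zero four_ne_zero (pow_ne_zero 2 (hMne y hy)))
  have hEss' : ∀ α β, ∀ y ∈ Cone 3,
      E α β (Real.exp S • y) = Real.exp (-(4 / (p - 1) + 2) * S) * E α β y := fun α β y hy => by
    rw [hEss α β y hy]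
    congr 3
    field_simp
    ring
  obtain ⟨θ, W₀, hW₀, hΓW₀, hθ₀, hθ1, hθγ, hθS, hθinj⟩ := exists_direction hS hV hΓV hγ
    (fun α β y hy => dirMetric_exp_smul hΩ hΩΓ hM hM0 hMss hEss' α β hy)
    (fun y hy => dirMetric_posDef hsym (hposdef y hy)) (show 35 ≤ m by omega)
  have hW : IsOpen (W₀ ∩ V) := hW₀.inter hV
  have hΓW : Cone 3 ⊆ W₀ ∩ V := fun y hy => ⟨hΓW₀ hy, hΓV hy⟩
  have hθ : ContDiffOn ℝ (⊤ : ℕ∞) θ (W₀ ∩ V) := hθ₀.mono Set.inter_subset_left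
  have hMW : ContDiffOn ℝ (⊤ : ℕ∞) M (W₀ ∩ V) := hMV.mono Set.inter_subset_right
  have hEW : ∀ α β, ContDiffOn ℝ (⊤ : ℕ∞) (E α β) (W₀ ∩ V) := fun α β =>
    (hE α β).mono fun y hy => hy.2.1
  have hMpos : ∀ y ∈ W₀ ∩ V, 0 < M y := fun y hy => hy.2.2
  have hθn : ∀ y ∈ W₀ ∩ V, ‖θ y‖ = 1 := fun y hy => hθ1 y hy.1
  set u : Sp 3 → Em m := fun y => √(M y) • θ y with hu
  have hus : ContDiffOn ℝ (⊤ : ℕ∞) u (W₀ ∩ V) :=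
    (hMW.sqrt fun y hy => (hMpos y hy).ne').smul hθ
  have hun : ∀ y ∈ W₀ ∩ V, ‖u y‖ = √(M y) := fun y hy => by
    rw [hu]
    simp only [norm_smul, hθn y hy, mul_one, Real.norm_eq_abs, abs_of_nonneg (Real.sqrt_nonneg _)]
  have hun2 : ∀ y ∈ W₀ ∩ V, ‖u y‖ ^ 2 = M y := fun y hy => by
    rw [hun y hy, Real.sq_sqrt (hMpos y hy).le]
  have hudir : ∀ y ∈ W₀ ∩ V, ‖u y‖⁻¹ • u y = θ y := fun y hy => by
    rw [hun y hy]
    exact inv_smul_smul₀ (Real.sqrt_pos.mpr (hMpos y hy)).ne' _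
  have huE : ∀ α β : Fin 4, ∀ y ∈ Cone 3, ⟪pd α u y, pd β u y⟫ = E α β y := fun α β y hy => by
    have hMy := (hM0 y hy).ne'
    rw [inner_pd_sqrt_smul hW hθ hMW hMpos hθn α β (hΓW hy), hθγ α β y hy, dirMetric]
    field_simp
    ring
  have huEs : ∀ α β, ContDiffOn ℝ (⊤ : ℕ∞) (fun y => ⟪pd α u y, pd β u y⟫) (W₀ ∩ V) :=
    fun α β => (WaveNash.ContDiffOn.pd hW hus α).inner ℝ (WaveNash.ContDiffOn.pd hW hus β)
  have hbox : ∀ y ∈ Cone 3, ⟪u y, dAlembert u y⟫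
      = 1 / 2 * dAlembert M y - (-(E 0 0 y) + ∑ i : Fin 3, E i.succ i.succ y) := fun y hy => by
    have h1 : (fun z => ‖u z‖ ^ 2) =ᶠ[nhds y] M :=
      Filter.eventually_of_mem (hW.mem_nhds (hΓW hy)) hun2
    rw [inner_dAlembert hW hus (hΓW hy), dAlembert_congr h1]
    simp only [huE _ _ y hy]
  have htr : ContDiffOn ℝ (⊤ : ℕ∞) (fun y => -(E 0 0 y) + ∑ i : Fin 3, E i.succ i.succ y)
      (W₀ ∩ V) := (hEW 0 0).neg.add (ContDiffOn.sum fun i _ => hEW i.succ i.succ)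
  refine ⟨u, W₀ ∩ V, hW, hΓW, hus, fun y hy h0 => ?_, fun y hy => hun2 y (hΓW hy), huE,
    fun y hy => ?_, fun y hy => ?_, fun α y hy => ?_, fun y hy y' hy' h => ?_, fun y hy => ?_⟩
  · have := hun2 y (hΓW hy)
    rw [h0, norm_zero] at this
    have := hM0 y hy
    simp_all
  · have hexp : Real.exp (-(4 / (p - 1)) * S) = Real.exp (-(2 / (p - 1)) * S) ^ 2 := by
      rw [← Real.exp_nat_mul]; congr 1; push_cast; ring
    rw [hu]
    simp only
    rw [hθS y hy, hMss y hy, hexp, Real.sqrt_mul (sq_nonneg _), Real.sqrt_sq (Real.exp_pos _).le,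
      mul_smul]
  · rw [hbox y hy]; exact hdef y hy
  · have e1 : pd α (fun z => ⟪u z, dAlembert u z⟫) y = pd α (fun z =>
        (1 / 2) * dAlembert M z - (-(E 0 0 z) + ∑ i : Fin 3, E i.succ i.succ z)) y :=
      pd_eq_of_eqOn_cone hW hΓW (hus.inner ℝ (WaveNash.ContDiffOn.dAlembert hW hus))
        ((contDiffOn_const.mul (WaveNash.ContDiffOn.dAlembert hW hMW)).sub htr) hbox α hy
    have e2 : ∀ β δ i : Fin 4, pd i (fun z => ⟪pd β u z, pd δ u z⟫) y = pd i (E β δ) y :=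
      fun β δ i => pd_eq_of_eqOn_cone hW hΓW (huEs β δ) (hEW β δ) (huE β δ) i hy
    have e3 : pd α (fun z => -⟪pd 0 u z, pd 0 u z⟫
        + ∑ i : Fin 3, ⟪pd i.succ u z, pd i.succ u z⟫) y
        = pd α (fun z => -(E 0 0 z) + ∑ i : Fin 3, E i.succ i.succ z) y :=
      pd_eq_of_eqOn_cone hW hΓW ((huEs 0 0).neg.add (ContDiffOn.sum fun i _ => huEs i.succ i.succ))
        htr (fun z hz => by simp only [huE _ _ z hz]) α hy
    rw [e1, hdiv α y hy, inner_pd_dAlembert hW hus α (hΓW hy), e3]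
    simp only [e2]
  · rw [hudir y (hΓW hy), hudir y' (hΓW hy')] at h
    exact hθinj y hy y' hy' h
  · have h1 : (fun z => ‖u z‖⁻¹ • u z) =ᶠ[nhds y] θ :=
      Filter.eventually_of_mem (hW.mem_nhds (hΓW hy)) hudir
    simp only [fun α => pd_congr h1 α]
    refine linearIndependent_of_gram_posDef ?_
    simp only [hθγ _ _ y hy]
    exact dirMetric_posDef hsym (hposdef y hy)
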